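/- Let t be a positive integer with t ≠ 3. If Γ and Δ are finite simple graphs whose adjacency matrices (over the integers) have equal characteristic polynomials, and Δ is t-tuple regular, then Γ is t-tuple regular. -/

import Mathlib

/-- `t`-tuple regularity: for every `s ≤ t`, any two `s`-tuples of distinct vertices
inducing isomorphic subgraphs have the same number of common neighbours. -/
def SimpleGraph.IsTupleRegular {V : Type*} (Γ : SimpleGraph V) (t : ℕ) : Prop :=
  ∀ s, s ≤ t → ∀ x y : Fin s → V, Function.Injective x → Function.Injective y →
    (∀ i j, Γ.Adj (x i) (x j) ↔ Γ.Adj (y i) (y j)) →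
    Nat.card {z : V // ∀ i, Γ.Adj z (x i)} = Nat.card {z : V // ∀ i, Γ.Adj z (y i)}

set_option linter.unusedSectionVars false

namespace SimpleGraph

section PairTypes

variable {V : Type*} (G : SimpleGraph V)

open Classical in
/-- The relation between two vertices: `0` if equal, `1` if adjacent, `2` otherwise. -/
noncomputable def typ (x y : V) : Fin 3 := if x = y then 0 else if G.Adj x y then 1 else 2

/-- The function on `Fin 3` with prescribed values. -/
def sel (e a b : ℝ) : Fin 3 → ℝ := ![e, a, b]

/-- The matrix whose entries are `e`, `a`, `b` at equal, adjacent, nonadjacent pairs. -/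
noncomputable def rel (e a b : ℝ) : Matrix V V ℝ := Matrix.of fun x y => sel e a b (G.typ x y)

@[simp] theorem sel_zero (e a b : ℝ) : sel e a b 0 = e := rfl
@[simp] theorem sel_one (e a b : ℝ) : sel e a b 1 = a := rfl
@[simp] theorem sel_two (e a b : ℝ) : sel e a b 2 = b := rfl

theorem rel_apply (e a b : ℝ) (x y : V) : G.rel e a b x y = sel e a b (G.typ x y) := rfl

variable {G}

theorem typ_eq_zero {x y : V} : G.typ x y = 0 ↔ x = y := by
  unfold typ; split_ifs <;> simp_all

theorem typ_eq_one {x y : V} : G.typ x y = 1 ↔ G.Adj x y := by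
  unfold typ; split_ifs <;> simp_all

theorem typ_eq_two {x y : V} : G.typ x y = 2 ↔ x ≠ y ∧ ¬ G.Adj x y := by
  unfold typ; split_ifs <;> simp_all

theorem typ_eq_two' {x y : V} : G.typ x y = 2 ↔ Gᶜ.Adj x y := by
  rw [typ_eq_two, compl_adj]

theorem typ_self (x : V) : G.typ x x = 0 := typ_eq_zero.2 rfl

theorem typ_comm (x y : V) : G.typ x y = G.typ y x := by
  classical unfold typ; exact if_congr eq_comm rfl (if_congr (G.adj_comm x y) rfl rfl)

theorem typ_cases (x y : V) :
    x = y ∧ G.typ x y = 0 ∨ G.Adj x y ∧ G.typ x y = 1 ∨ Gᶜ.Adj x y ∧ G.typ x y = 2 := by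
  rw [compl_adj]; unfold typ; split_ifs <;> simp_all

/-- Interchange of adjacency and nonadjacency. -/
def swapTyp : Fin 3 → Fin 3 := ![0, 2, 1]

theorem typ_compl (x y : V) : Gᶜ.typ x y = swapTyp (G.typ x y) := by
  unfold typ swapTyp; split_ifs <;> simp_all

theorem sel_swapTyp (e a b : ℝ) (i : Fin 3) : sel e a b (swapTyp i) = sel e b a i := by
  fin_cases i <;> rfl

theorem rel_compl (e a b : ℝ) : Gᶜ.rel e a b = G.rel e b a := by
  ext x y; simp [rel_apply, typ_compl, sel_swapTyp]

theorem rel_comm (e a b : ℝ) (x y : V) : G.rel e a b x y = G.rel e a b y x := by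
  rw [rel_apply, rel_apply, typ_comm]

@[simp] theorem rel_self (e a b : ℝ) (x : V) : G.rel e a b x x = e := by
  simp [rel_apply, typ_self]

theorem rel_adj (e a b : ℝ) {x y : V} (h : G.Adj x y) : G.rel e a b x y = a := by
  simp [rel_apply, typ_eq_one.2 h]

theorem rel_nonadj (e a b : ℝ) {x y : V} (h : Gᶜ.Adj x y) : G.rel e a b x y = b := by
  simp [rel_apply, typ_eq_two'.2 h]

theorem typ_comap {W : Type*} {f : W → V} (hf : f.Injective) (x y : W) :
    (G.comap f).typ x y = G.typ (f x) (f y) := by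
  classical unfold typ; exact if_congr hf.eq_iff.symm rfl rfl

end PairTypes

section Invariance

variable {V : Type*} [Fintype V] {G : SimpleGraph V}

theorem sum_prod_rel_eq_card {κ : Type*} [Fintype κ] (x : κ → V) :
    ∑ v, ∏ i, sel 0 1 0 (G.typ v (x i)) = (Nat.card {z : V // ∀ i, G.Adj z (x i)} : ℝ) := by
  classical
  have : ∀ v, ∏ i, sel 0 1 0 (G.typ v (x i)) = if (∀ i, G.Adj v (x i)) then (1 : ℝ) else 0 := by
    intro v
    split_ifs with h
    · exact Finset.prod_eq_one fun i _ => by rw [typ_eq_one.2 (h i)]; rfl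
    · push Not at h
      obtain ⟨i, hi⟩ := h
      refine Finset.prod_eq_zero (Finset.mem_univ i) ?_
      rcases typ_cases (G := G) v (x i) with h | h | h
      · rw [h.2]; rfl
      · exact absurd h.1 hi
      · rw [h.2]; rfl
  simp_rw [this]
  rw [Finset.sum_boole, Nat.card_eq_fintype_card, Fintype.card_subtype]

theorem IsTupleRegular.mono {t s : ℕ} (h : G.IsTupleRegular t) (hst : s ≤ t) :
    G.IsTupleRegular s := fun r hr => h r (hr.trans hst)

theorem IsTupleRegular.sum_prod_eq {t : ℕ} (h : G.IsTupleRegular t) {κ : Type*} [Fintype κ]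
    (hκ : Fintype.card κ ≤ t) {x y : κ → V} (hx : x.Injective)
    (hxy : ∀ i j, G.typ (x i) (x j) = G.typ (y i) (y j)) :
    ∑ v, ∏ i, sel 0 1 0 (G.typ v (x i)) = ∑ v, ∏ i, sel 0 1 0 (G.typ v (y i)) := by
  have hy : y.Injective := fun i j hij => hx <| by
    rw [← typ_eq_zero (G := G), hxy, typ_eq_zero.2 hij]
  let f := Fintype.equivFin κ
  have key : ∀ x : κ → V, ∑ v, ∏ i, sel 0 1 0 (G.typ v (x i)) =
      ∑ v, ∏ i, sel 0 1 0 (G.typ v (x (f.symm i))) := fun x =>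
    Finset.sum_congr rfl fun v _ => (f.symm.prod_comp fun i => sel 0 1 0 (G.typ v (x i))).symm
  rw [key x, key y, sum_prod_rel_eq_card fun i => x (f.symm i),
    sum_prod_rel_eq_card fun i => y (f.symm i)]
  exact_mod_cast h _ hκ _ _ (hx.comp f.symm.injective) (hy.comp f.symm.injective) fun i j => by
    
    rw [← typ_eq_one, Function.comp_apply, Function.comp_apply, hxy, typ_eq_one]; rfl

theorem IsTupleRegular.sum_adj_eq {t : ℕ} (h : G.IsTupleRegular t) {κ : Type*} [Fintype κ]
    (hκ : Fintype.card κ ≤ t) {x y : κ → V} (hx : x.Injective)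
    (hxy : ∀ i j, G.typ (x i) (x j) = G.typ (y i) (y j)) (Ψ : (κ → Prop) → ℝ) :
    ∑ v, Ψ (fun i => G.Adj v (x i)) = ∑ v, Ψ (fun i => G.Adj v (y i)) := by
  classical
  have key : ∀ x : κ → V, ∑ v, Ψ (fun i => G.Adj v (x i)) =
      ∑ q : κ → Prop, ∑ S ∈ (Finset.univ : Finset κ).powerset,
        (Ψ q * ((∏ i ∈ Finset.univ \ S, if q i then (0 : ℝ) else 1) *
          ∏ i ∈ S, if q i then (1 : ℝ) else -1)) *
          ∑ v, ∏ i : S, sel 0 1 0 (G.typ v (x i)) := by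
    intro x
    have h1 : ∀ v, Ψ (fun i => G.Adj v (x i)) = ∑ q : κ → Prop, Ψ q *
        ∏ i, ((if q i then (1 : ℝ) else -1) * sel 0 1 0 (G.typ v (x i)) +
          (if q i then (0 : ℝ) else 1)) := by
      intro v
      have hval : ∀ i, sel 0 1 0 (G.typ v (x i)) = if G.Adj v (x i) then 1 else 0 := by
        intro i
        rcases typ_cases (G := G) v (x i) with h | h | h
        · rw [h.2, h.1]; simp
        · rw [h.2]; simp [h.1]
        · rw [h.2]; simp [((compl_adj _ _ _).1 h.1).2]
      rw [Finset.sum_eq_single (fun i => G.Adj v (x i))]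
      · rw [Finset.prod_eq_one, mul_one]
        intro i _
        rw [hval]; split_ifs <;> norm_num
      · intro q _ hq
        have : ∃ i, ¬ (q i ↔ G.Adj v (x i)) := by
          by_contra! hc
          exact hq (funext fun i => propext (hc i))
        obtain ⟨i, hi⟩ := this
        rw [Finset.prod_eq_zero (Finset.mem_univ i), mul_zero]
        rw [hval]; split_ifs <;> simp_all
      · simp
    simp_rw [h1, Finset.prod_add, Finset.mul_sum]
    rw [Finset.sum_comm]
    refine Finset.sum_congr rfl fun q _ => ?_
    rw [Finset.sum_comm]
    refine Finset.sum_congr rfl fun S _ => ?_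
    refine Finset.sum_congr rfl fun v _ => ?_
    rw [Finset.prod_mul_distrib, Finset.prod_coe_sort S fun i => sel 0 1 0 (G.typ v (x i))]
    ring
  rw [key x, key y]
  refine Finset.sum_congr rfl fun q _ => Finset.sum_congr rfl fun S _ => ?_
  rw [h.sum_prod_eq ((Fintype.card_coe S).trans_le ((Finset.card_le_univ S).trans hκ))
    (x := fun i : S => x i) (y := fun i : S => y i)
    (hx.comp Subtype.val_injective) fun i j => hxy i j]

theorem IsTupleRegular.sum_typ_eq_of_injective {t : ℕ} (h : G.IsTupleRegular t) {κ : Type*}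
    [Fintype κ] (hκ : Fintype.card κ ≤ t) {x y : κ → V} (hx : x.Injective)
    (hxy : ∀ i j, G.typ (x i) (x j) = G.typ (y i) (y j)) (Φ : (κ → Fin 3) → ℝ) :
    ∑ v, Φ (fun i => G.typ v (x i)) = ∑ v, Φ (fun i => G.typ v (y i)) := by
  classical
  have hy : y.Injective := fun i j hij => hx <| by
    rw [← typ_eq_zero (G := G), hxy, typ_eq_zero.2 hij]
  let Ψ : (κ → Prop) → ℝ := fun q => Φ fun i => if q i then 1 else 2
  have key : ∀ x : κ → V, x.Injective → ∑ v, Φ (fun i => G.typ v (x i)) =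
      ∑ v, Ψ (fun i => G.Adj v (x i)) + ∑ j, (Φ (fun i => G.typ (x j) (x i)) -
        Ψ fun i => G.typ (x j) (x i) = 1) := by
    intro x hx
    rw [← sub_eq_iff_eq_add', ← Finset.sum_sub_distrib]
    rw [← Finset.sum_subset (Finset.subset_univ (Finset.univ.image x))]
    · rw [Finset.sum_image fun i _ j _ hij => hx hij]
      simp only [typ_eq_one]
    · intro v _ hv
      have hv : ∀ i, v ≠ x i := fun i hi => hv (by simp [hi])
      rw [sub_eq_zero]
      congr 1
      funext i
      rcases typ_cases (G := G) v (x i) with h | h | h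
      · exact absurd h.1 (hv i)
      · rw [h.2, if_pos h.1]
      · rw [h.2, if_neg ((compl_adj _ _ _).1 h.1).2]
  rw [key x hx, key y hy, h.sum_adj_eq hκ hx hxy Ψ]
  simp only [hxy]

theorem IsTupleRegular.sum_typ_eq {t : ℕ} (h : G.IsTupleRegular t) {κ : Type*}
    [Fintype κ] (hκ : Fintype.card κ ≤ t) {x y : κ → V}
    (hxy : ∀ i j, G.typ (x i) (x j) = G.typ (y i) (y j)) (Φ : (κ → Fin 3) → ℝ) :
    ∑ v, Φ (fun i => G.typ v (x i)) = ∑ v, Φ (fun i => G.typ v (y i)) := by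
  classical
  let g : Set.range x → κ := fun u => u.2.choose
  have hg : ∀ u, x (g u) = u := fun u => u.2.choose_spec
  let q : κ → Set.range x := fun i => ⟨x i, i, rfl⟩
  have h1 : ∀ i, y i = y (g (q i)) := fun i => by
    rw [← typ_eq_zero (G := G), ← hxy, hg]; exact typ_self _
  have h2 := h.sum_typ_eq_of_injective (κ := Set.range x)
    ((Fintype.card_range_le x).trans hκ) (x := Subtype.val) (y := fun u => y (g u))
    Subtype.val_injective (fun i j => by rw [← hxy, hg, hg]) fun p => Φ fun i => p (q i)
  simp only [← h1] at h2
  exact h2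

theorem IsTupleRegular.exists_typ_one {t : ℕ} (h : G.IsTupleRegular t) (ht : 1 ≤ t)
    (Φ : Fin 3 → ℝ) : ∃ c : ℝ, ∀ x, ∑ v, Φ (G.typ v x) = c := by
  classical
  by_cases hV : Nonempty V
  · obtain ⟨x₀⟩ := hV
    refine ⟨∑ v, Φ (G.typ v x₀), fun x => ?_⟩
    refine h.sum_typ_eq (κ := Fin 1) (by simpa) (x := ![x]) (y := ![x₀]) ?_ fun p => Φ (p 0)
    intro i j
    fin_cases i; fin_cases j
    simp [typ_self]
  · exact ⟨0, fun x => absurd ⟨x⟩ hV⟩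

theorem IsTupleRegular.exists_typ_two {t : ℕ} (h : G.IsTupleRegular t) (ht : 2 ≤ t)
    (Φ : Fin 3 → Fin 3 → ℝ) :
    ∃ f : Fin 3 → ℝ, ∀ x y, ∑ v, Φ (G.typ v x) (G.typ v y) = f (G.typ x y) := by
  classical
  let f : Fin 3 → ℝ := fun i => if hp : ∃ p : V × V, G.typ p.1 p.2 = i then
    ∑ v, Φ (G.typ v hp.choose.1) (G.typ v hp.choose.2) else 0
  refine ⟨f, fun x y => ?_⟩
  have hp : ∃ p : V × V, G.typ p.1 p.2 = G.typ x y := ⟨(x, y), rfl⟩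
  have hs := hp.choose_spec
  simp only [f, dif_pos hp]
  generalize hp.choose = p at hs
  refine h.sum_typ_eq (κ := Fin 2) (by simpa) (x := ![x, y]) (y := ![p.1, p.2]) ?_
    fun q => Φ (q 0) (q 1)
  intro i j
  have h1 := typ_comm (G := G) x y
  have h2 := typ_comm (G := G) p.1 p.2
  fin_cases i <;> fin_cases j <;> simp_all [typ_self]

theorem IsTupleRegular.exists_typ_three {t : ℕ} (h : G.IsTupleRegular t) (ht : 3 ≤ t)
    (Φ : Fin 3 → Fin 3 → Fin 3 → ℝ) :
    ∃ f : Fin 3 → Fin 3 → Fin 3 → ℝ, ∀ x y z, ∑ v, Φ (G.typ v x) (G.typ v y) (G.typ v z) =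
      f (G.typ x y) (G.typ x z) (G.typ y z) := by
  classical
  let f : Fin 3 → Fin 3 → Fin 3 → ℝ := fun i j k =>
    if hp : ∃ p : V × V × V,
      G.typ p.1 p.2.1 = i ∧ G.typ p.1 p.2.2 = j ∧ G.typ p.2.1 p.2.2 = k then
    ∑ v, Φ (G.typ v hp.choose.1) (G.typ v hp.choose.2.1) (G.typ v hp.choose.2.2) else 0
  refine ⟨f, fun x y z => ?_⟩
  have hp : ∃ p : V × V × V, G.typ p.1 p.2.1 = G.typ x y ∧ G.typ p.1 p.2.2 = G.typ x z ∧
    G.typ p.2.1 p.2.2 = G.typ y z := ⟨(x, y, z), rfl, rfl, rfl⟩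
  have hs := hp.choose_spec
  simp only [f, dif_pos hp]
  generalize hp.choose = p at hs
  obtain ⟨x', y', z'⟩ := p
  dsimp only at hs ⊢
  refine h.sum_typ_eq (κ := Fin 3) (by simpa) (x := ![x, y, z]) (y := ![x', y', z']) ?_
    fun q => Φ (q 0) (q 1) (q 2)
  obtain ⟨h1, h2, h3⟩ := hs
  have h1' := h1
  have h2' := h2
  have h3' := h3
  rw [typ_comm, typ_comm x] at h1' h2'
  rw [typ_comm, typ_comm y] at h3'
  intro i j
  fin_cases i <;> fin_cases j <;> simp [typ_self, *]

theorem IsTupleRegular.exists_typ_four {t : ℕ} (h : G.IsTupleRegular t) (ht : 4 ≤ t)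
    (Φ : Fin 3 → Fin 3 → Fin 3 → Fin 3 → ℝ) :
    ∃ f : Fin 3 → Fin 3 → Fin 3 → Fin 3 → Fin 3 → Fin 3 → ℝ, ∀ x y z w,
      ∑ v, Φ (G.typ v x) (G.typ v y) (G.typ v z) (G.typ v w) =
      f (G.typ x y) (G.typ x z) (G.typ x w) (G.typ y z) (G.typ y w) (G.typ z w) := by
  classical
  let f : Fin 3 → Fin 3 → Fin 3 → Fin 3 → Fin 3 → Fin 3 → ℝ := fun i j k l m n =>
    if hp : ∃ p : V × V × V × V,
      G.typ p.1 p.2.1 = i ∧ G.typ p.1 p.2.2.1 = j ∧ G.typ p.1 p.2.2.2 = k ∧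
      G.typ p.2.1 p.2.2.1 = l ∧ G.typ p.2.1 p.2.2.2 = m ∧ G.typ p.2.2.1 p.2.2.2 = n then
    ∑ v, Φ (G.typ v hp.choose.1) (G.typ v hp.choose.2.1) (G.typ v hp.choose.2.2.1)
      (G.typ v hp.choose.2.2.2) else 0
  refine ⟨f, fun x y z w => ?_⟩
  have hp : ∃ p : V × V × V × V, G.typ p.1 p.2.1 = G.typ x y ∧ G.typ p.1 p.2.2.1 = G.typ x z ∧
    G.typ p.1 p.2.2.2 = G.typ x w ∧ G.typ p.2.1 p.2.2.1 = G.typ y z ∧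
    G.typ p.2.1 p.2.2.2 = G.typ y w ∧ G.typ p.2.2.1 p.2.2.2 = G.typ z w :=
    ⟨(x, y, z, w), rfl, rfl, rfl, rfl, rfl, rfl⟩
  have hs := hp.choose_spec
  simp only [f, dif_pos hp]
  generalize hp.choose = p at hs
  obtain ⟨x', y', z', w'⟩ := p
  dsimp only at hs ⊢
  refine h.sum_typ_eq (κ := Fin 4) (by simpa) (x := ![x, y, z, w]) (y := ![x', y', z', w']) ?_
    fun q => Φ (q 0) (q 1) (q 2) (q 3)
  obtain ⟨h1, h2, h3, h4, h5, h6⟩ := hs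
  have h1' := h1
  have h2' := h2
  have h3' := h3
  have h4' := h4
  have h5' := h5
  have h6' := h6
  rw [typ_comm, typ_comm x] at h1' h2' h3'
  rw [typ_comm, typ_comm y] at h4' h5'
  rw [typ_comm, typ_comm z] at h6'
  intro i j
  fin_cases i <;> fin_cases j <;> simp [typ_self, *]

theorem isTupleRegular_of_sum {t : ℕ} (h : ∀ s, s ≤ t → ∀ x y : Fin s → V, x.Injective →
    (∀ i j, G.typ (x i) (x j) = G.typ (y i) (y j)) →
    ∑ v, ∏ i, sel 0 1 0 (G.typ v (x i)) = ∑ v, ∏ i, sel 0 1 0 (G.typ v (y i))) :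
    G.IsTupleRegular t := by
  intro s hs x y hx hy hxy
  have := h s hs x y hx fun i j => by
    classical
    unfold typ
    simp only [hx.eq_iff, hy.eq_iff, hxy]
  rw [sum_prod_rel_eq_card, sum_prod_rel_eq_card] at this
  exact_mod_cast this

theorem swapTyp_injective : Function.Injective swapTyp := by
  intro i j; fin_cases i <;> fin_cases j <;> simp [swapTyp]

theorem IsTupleRegular.compl {t : ℕ} (h : G.IsTupleRegular t) : Gᶜ.IsTupleRegular t := by
  refine isTupleRegular_of_sum fun s hs x y hx hxy => ?_
  simp only [typ_compl, swapTyp_injective.eq_iff] at hxy ⊢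
  exact h.sum_typ_eq (by simpa) hxy fun p => ∏ i, sel 0 1 0 (swapTyp (p i))

theorem isTupleRegular_compl_iff {t : ℕ} : Gᶜ.IsTupleRegular t ↔ G.IsTupleRegular t :=
  ⟨fun h => by simpa using h.compl, fun h => h.compl⟩

/-- The graph induced on the neighbourhood of a vertex. -/
abbrev nbhd (G : SimpleGraph V) (x : V) : SimpleGraph {v // G.Adj x v} :=
  G.comap Subtype.val

theorem IsTupleRegular.nbhd {t : ℕ} (h : G.IsTupleRegular (t + 1)) (x : V)
    [Fintype {v // G.Adj x v}] : (G.nbhd x).IsTupleRegular t := by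
  classical
  refine isTupleRegular_of_sum fun s hs y z hy hyz => ?_
  simp only [typ_comap Subtype.val_injective] at hyz ⊢
  have key : ∀ f : V → ℝ, ∑ v : {v // G.Adj x v}, f v = ∑ v, sel 0 1 0 (G.typ v x) * f v := by
    intro f
    rw [← Finset.sum_subtype (Finset.univ.filter fun v => G.Adj x v) (by simp) f,
      Finset.sum_filter]
    refine Finset.sum_congr rfl fun v _ => ?_
    rw [typ_comm]
    rcases typ_cases (G := G) x v with h | h | h
    · rw [h.2, h.1]; simp
    · rw [h.2]; simp [h.1]
    · rw [h.2]; simp [((compl_adj _ _ _).1 h.1).2]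
  rw [key fun v => ∏ i, sel 0 1 0 (G.typ v (y i)), key fun v => ∏ i, sel 0 1 0 (G.typ v (z i))]
  refine h.sum_typ_eq (κ := Option (Fin s)) (by simpa) (x := fun o => o.elim x fun i => y i)
    (y := fun o => o.elim x fun i => z i) ?_
    fun p => sel 0 1 0 (p none) * ∏ i, sel 0 1 0 (p (some i))
  rintro (_ | i) (_ | j)
  · rfl
  · exact (typ_eq_one.2 (y j).2).trans (typ_eq_one.2 (z j).2).symm
  · simp only [Option.elim]
    rw [typ_comm, typ_comm _ x]
    exact (typ_eq_one.2 (y i).2).trans (typ_eq_one.2 (z i).2).symm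
  · exact hyz i j

end Invariance

end SimpleGraph

namespace SimpleGraph

section RelAlgebra

variable {V : Type*} {G : SimpleGraph V}

theorem rel_add (e a b e' a' b' : ℝ) :
    G.rel e a b + G.rel e' a' b' = G.rel (e + e') (a + a') (b + b') := by
  ext x y
  rcases typ_cases (G := G) x y with h | h | h <;> simp [rel_apply, h.2]

theorem rel_sub (e a b e' a' b' : ℝ) :
    G.rel e a b - G.rel e' a' b' = G.rel (e - e') (a - a') (b - b') := by
  ext x y
  rcases typ_cases (G := G) x y with h | h | h <;> simp [rel_apply, h.2]

theorem smul_rel (c e a b : ℝ) : c • G.rel e a b = G.rel (c * e) (c * a) (c * b) := by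
  ext x y
  rcases typ_cases (G := G) x y with h | h | h <;> simp [rel_apply, h.2]

theorem rel_one_zero_zero [DecidableEq V] : G.rel 1 0 0 = 1 := by
  ext x y
  rcases typ_cases (G := G) x y with h | h | h
  · rw [h.1]; simp
  · simp [rel_apply, h.2, h.1.ne]
  · simp [rel_apply, h.2, h.1.ne]

theorem rel_transpose (e a b : ℝ) : (G.rel e a b).transpose = G.rel e a b := by
  ext x y; exact rel_comm _ _ _ _ _

theorem rel_const (c : ℝ) (x y : V) : G.rel c c c x y = c := by
  rcases typ_cases (G := G) x y with h | h | h <;> simp [rel_apply, h.2]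

theorem rel_eq [DecidableEq V] (e a b : ℝ) :
    G.rel e a b = (e - b) • 1 + (a - b) • G.rel 0 1 0 + b • G.rel 1 1 1 := by
  rw [← rel_one_zero_zero (G := G), smul_rel, smul_rel, smul_rel, rel_add, rel_add]
  congr 1 <;> ring

theorem rel_zero_one_zero [DecidableRel G.Adj] : G.rel 0 1 0 = G.adjMatrix ℝ := by
  ext x y
  rw [adjMatrix_apply]
  rcases typ_cases (G := G) x y with h | h | h
  · simp [h.1]
  · simp [rel_apply, h.2, h.1]
  · simp [rel_apply, h.2, ((compl_adj _ _ _).1 h.1).2]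

end RelAlgebra

section StronglyRegular

variable {V : Type*} [Fintype V] [DecidableEq V] {G : SimpleGraph V}

/-- Strong regularity with real parameters, as an identity for the adjacency matrix. -/
def SR (G : SimpleGraph V) (k l m : ℝ) : Prop :=
  G.rel 0 1 0 * G.rel 0 1 0 = G.rel k l m

/-- Regularity of valency `k`. -/
def Reg (G : SimpleGraph V) (k : ℝ) : Prop := ∀ x, ∑ v, G.rel 0 1 0 x v = k

theorem SR.reg {k l m : ℝ} (h : G.SR k l m) : G.Reg k := by
  intro x
  have := congrFun (congrFun h x) x
  rw [Matrix.mul_apply, rel_self] at this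
  rw [← this]
  refine Finset.sum_congr rfl fun v _ => ?_
  rw [rel_comm 0 1 0 v x]
  rcases typ_cases (G := G) x v with h | h | h <;> simp [rel_apply, h.2]

theorem Reg.mul_const {k : ℝ} (h : G.Reg k) :
    G.rel 0 1 0 * G.rel 1 1 1 = k • G.rel 1 1 1 := by
  ext x y
  simp only [Matrix.mul_apply, rel_const, mul_one, Matrix.smul_apply, smul_eq_mul]
  exact h x

theorem Reg.const_mul {k : ℝ} (h : G.Reg k) :
    G.rel 1 1 1 * G.rel 0 1 0 = k • G.rel 1 1 1 := by
  have := congrArg Matrix.transpose h.mul_const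
  rwa [Matrix.transpose_mul, Matrix.transpose_smul, rel_transpose, rel_transpose] at this

theorem const_mul_const : G.rel 1 1 1 * G.rel 1 1 1 = (Fintype.card V : ℝ) • G.rel 1 1 1 := by
  ext x y
  simp only [Matrix.mul_apply, rel_const, mul_one, Matrix.smul_apply, smul_eq_mul]
  simp

theorem SR.mul_rel {k l m : ℝ} (h : G.SR k l m) (e a b e' a' b' : ℝ) :
    G.rel e a b * G.rel e' a' b' =
      G.rel (e * e' + k * a * a' + (Fintype.card V - 1 - k) * b * b')
        (e * a' + a * e' + l * a * a' + (k - 1 - l) * (a * b' + b * a') +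
          (Fintype.card V - 2 * k + l) * b * b')
        (e * b' + b * e' + m * a * a' + (k - m) * (a * b' + b * a') +
          (Fintype.card V - 2 - 2 * k + m) * b * b') := by
  rw [rel_eq e a b, rel_eq e' a' b']
  simp only [add_mul, mul_add, Matrix.smul_mul, Matrix.mul_smul, one_mul, mul_one,
    h.reg.mul_const, h.reg.const_mul, const_mul_const]
  rw [show G.rel 0 1 0 * G.rel 0 1 0 = G.rel k l m from h, ← rel_one_zero_zero (G := G)]
  simp only [smul_rel, rel_add]
  congr 1 <;> ring

theorem SR.compl {k l m : ℝ} (h : G.SR k l m) :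
    Gᶜ.SR (Fintype.card V - 1 - k) (Fintype.card V - 2 - 2 * k + m)
      (Fintype.card V - 2 * k + l) := by
  unfold SR
  rw [rel_compl, rel_compl, h.mul_rel]
  congr 1 <;> ring

theorem sum_typ_eq_sum_rel (x y : V) :
    ∑ v, sel 0 1 0 (G.typ v x) * sel 0 1 0 (G.typ v y) = (G.rel 0 1 0 * G.rel 0 1 0) x y := by
  rw [Matrix.mul_apply]
  refine Finset.sum_congr rfl fun v _ => ?_
  rw [rel_apply, rel_apply, typ_comm x]

theorem IsTupleRegular.exists_reg {t : ℕ} (h : G.IsTupleRegular t) (ht : 1 ≤ t) :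
    ∃ k, G.Reg k := by
  obtain ⟨k, hk⟩ := h.exists_typ_one ht (sel 0 1 0)
  refine ⟨k, fun x => ?_⟩
  rw [← hk x]
  exact Finset.sum_congr rfl fun v _ => by rw [rel_comm, rel_apply]

theorem IsTupleRegular.exists_sr {t : ℕ} (h : G.IsTupleRegular t) (ht : 2 ≤ t) :
    ∃ k l m, G.SR k l m := by
  obtain ⟨f, hf⟩ := h.exists_typ_two ht fun i j => sel 0 1 0 i * sel 0 1 0 j
  refine ⟨f 0, f 1, f 2, ?_⟩
  ext x y
  rw [← sum_typ_eq_sum_rel, hf, rel_apply]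
  rcases typ_cases (G := G) x y with h | h | h <;> simp [h.2]

theorem Reg.isTupleRegular {k : ℝ} (h : G.Reg k) : G.IsTupleRegular 1 := by
  refine isTupleRegular_of_sum fun s hs x y _ _ => ?_
  interval_cases s
  · simp
  · simp only [Finset.univ_unique, Finset.prod_singleton]
    have : ∀ z, ∑ v, sel 0 1 0 (G.typ v z) = k := fun z => by
      rw [← h z]
      exact Finset.sum_congr rfl fun v _ => by rw [rel_comm, rel_apply]
    rw [this, this]

theorem SR.isTupleRegular {k l m : ℝ} (h : G.SR k l m) : G.IsTupleRegular 2 := by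
  refine isTupleRegular_of_sum fun s hs x y hx hxy => ?_
  rcases Nat.lt_succ_iff_lt_or_eq.1 (Nat.lt_succ_of_le hs) with hs | rfl
  · exact h.reg.isTupleRegular.sum_prod_eq (by simpa using by omega) hx hxy
  · simp only [Fin.prod_univ_two]
    rw [sum_typ_eq_sum_rel, sum_typ_eq_sum_rel, show G.rel 0 1 0 * G.rel 0 1 0 = _ from h,
      rel_apply, rel_apply, hxy]

end StronglyRegular

section Spectrum

open Matrix

variable {V W : Type*} [Fintype V] [DecidableEq V] [Fintype W] [DecidableEq W]

theorem _root_.Matrix.IsHermitian.exists_orthogonal_conj {A B : Matrix V V ℝ} (hA : A.IsHermitian)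
    (hB : B.IsHermitian) (h : A.charpoly = B.charpoly) :
    ∃ T : Matrix V V ℝ, T * Tᵀ = 1 ∧ Tᵀ * T = 1 ∧ A = T * B * Tᵀ := by
  have hev := (hA.eigenvalues_eq_eigenvalues_iff hB).2 h
  have h1 := hA.spectral_theorem
  have h2 := hB.spectral_theorem
  rw [Unitary.conjStarAlgAut_apply] at h1 h2
  set U : Matrix V V ℝ := hA.eigenvectorUnitary.1 with hU
  set U' : Matrix V V ℝ := hB.eigenvectorUnitary.1 with hU'
  have hUU : U * Uᵀ = 1 := by
    simpa [star_eq_conjTranspose] using Unitary.coe_mul_star_self hA.eigenvectorUnitary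
  have hUU' : Uᵀ * U = 1 := by
    simpa [star_eq_conjTranspose] using Unitary.coe_star_mul_self hA.eigenvectorUnitary
  have hUU2 : U' * U'ᵀ = 1 := by
    simpa [star_eq_conjTranspose] using Unitary.coe_mul_star_self hB.eigenvectorUnitary
  have hUU2' : U'ᵀ * U' = 1 := by
    simpa [star_eq_conjTranspose] using Unitary.coe_star_mul_self hB.eigenvectorUnitary
  simp only [star_eq_conjTranspose, conjTranspose_eq_transpose_of_trivial] at h1 h2
  refine ⟨U * U'ᵀ, ?_, ?_, ?_⟩
  · rw [transpose_mul, transpose_transpose, Matrix.mul_assoc, ← Matrix.mul_assoc U'ᵀ, hUU2',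
      Matrix.one_mul, hUU]
  · rw [transpose_mul, transpose_transpose, Matrix.mul_assoc, ← Matrix.mul_assoc Uᵀ, hUU',
      Matrix.one_mul, hUU2]
  · rw [h1, h2, hev, transpose_mul, transpose_transpose]
    simp only [Matrix.mul_assoc]
    rw [← Matrix.mul_assoc U'ᵀ U', hUU2', Matrix.one_mul, ← Matrix.mul_assoc U'ᵀ U', hUU2',
      Matrix.one_mul]

variable {G H : SimpleGraph V}

/-- Orthogonal similarity of adjacency matrices. -/
def Cospec (G H : SimpleGraph V) : Prop :=
  ∃ T : Matrix V V ℝ, T * Tᵀ = 1 ∧ Tᵀ * T = 1 ∧ G.rel 0 1 0 = T * H.rel 0 1 0 * Tᵀ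

theorem Reg.of_cospec {k : ℝ} (h : H.Reg k) (hc : Cospec G H) : G.Reg k := by
  classical
  obtain ⟨T, h1, h2, h3⟩ := hc
  have hdeg : ∀ x, (H.degree x : ℝ) = k := fun x => by
    rw [← h x, rel_zero_one_zero, degree_eq_sum_if_adj]; simp only [adjMatrix_apply]
  have hlap : H.lapMatrix ℝ = k • 1 - H.rel 0 1 0 := by
    rw [lapMatrix, rel_zero_one_zero, degMatrix]
    congr 1
    ext x y
    simp [Matrix.diagonal_apply, Matrix.one_apply, hdeg]
  have hpsd : (k • 1 - G.rel 0 1 0).PosSemidef := by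
    have := (posSemidef_lapMatrix ℝ H).mul_mul_conjTranspose_same T
    rw [hlap, conjTranspose_eq_transpose_of_trivial, Matrix.mul_sub, Matrix.sub_mul, ← h3,
      Matrix.mul_smul, Matrix.mul_one, Matrix.smul_mul, h1] at this
    exact this
  have htr : ∀ F : SimpleGraph V, trace (F.rel 0 1 0 * F.rel 0 1 0) =
      (fun _ => 1) ⬝ᵥ (F.rel 0 1 0 *ᵥ fun _ => 1) := by
    intro F
    simp only [trace, diag_apply, Matrix.mul_apply, dotProduct, mulVec, mul_one, one_mul]
    refine Finset.sum_congr rfl fun x _ => Finset.sum_congr rfl fun y _ => ?_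
    rw [rel_comm 0 1 0 y x]
    rcases typ_cases (G := F) x y with h | h | h <;> simp [rel_apply, h.2]
  have heq : trace (G.rel 0 1 0 * G.rel 0 1 0) = trace (H.rel 0 1 0 * H.rel 0 1 0) := by
    have : G.rel 0 1 0 * G.rel 0 1 0 = T * (H.rel 0 1 0 * H.rel 0 1 0 * Tᵀ) := by
      rw [h3]
      simp only [Matrix.mul_assoc]
      rw [← Matrix.mul_assoc Tᵀ T, h2, Matrix.one_mul]
    rw [this, trace_mul_comm, Matrix.mul_assoc, h2, Matrix.mul_one]
  have hH : (H.rel 0 1 0 *ᵥ fun _ => 1) = fun _ => k := by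
    ext x; simpa [mulVec, dotProduct] using h x
  rw [htr, htr, hH] at heq
  have h0 := (hpsd.dotProduct_mulVec_zero_iff fun _ => 1).1 (by
    rw [sub_mulVec, dotProduct_sub, star_trivial, heq, smul_mulVec, one_mulVec]
    simp [dotProduct])
  intro x
  have := congrFun h0 x
  rw [sub_mulVec, smul_mulVec, one_mulVec] at this
  simp [mulVec, dotProduct] at this
  linarith

theorem eq_zero_of_trace_sq {X : Matrix V V ℝ} (hX : Xᵀ = X) (h : trace (X * X) = 0) : X = 0 := by
  rw [← Matrix.trace_conjTranspose_mul_self_eq_zero_iff, conjTranspose_eq_transpose_of_trivial, hX]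
  exact h

theorem SR.of_cospec {k l m : ℝ} (h : H.SR k l m) (hc : Cospec G H) : G.SR k l m := by
  have hreg := h.reg.of_cospec hc
  obtain ⟨T, h1, h2, h3⟩ := hc
  obtain ⟨q, hdef⟩ : ∃ q : SimpleGraph V → Matrix V V ℝ, ∀ F, q F =
    F.rel 0 1 0 * F.rel 0 1 0 - (l - m) • F.rel 0 1 0 - (k - m) • 1 := ⟨_, fun _ => rfl⟩
  have hJ : ∀ c : ℝ, H.rel c c c = G.rel c c c := fun c => by ext; simp [rel_const]
  have hqH : q H = m • G.rel 1 1 1 := by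
    simp only [hdef]
    rw [show H.rel 0 1 0 * H.rel 0 1 0 = _ from h, ← rel_one_zero_zero (G := H), smul_rel,
      smul_rel, smul_rel, rel_sub, rel_sub, ← hJ]
    congr 1 <;> ring
  have hqJ : ∀ F : SimpleGraph V, F.Reg k →
      q F * F.rel 1 1 1 = (k * k - (l - m) * k - (k - m)) • F.rel 1 1 1 := by
    intro F hF
    simp only [hdef]
    rw [Matrix.sub_mul, Matrix.sub_mul, Matrix.mul_assoc, hF.mul_const, Matrix.mul_smul,
      hF.mul_const, Matrix.smul_mul, hF.mul_const, Matrix.smul_mul, Matrix.one_mul]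
    module
  have hq : q G = T * q H * Tᵀ := by
    simp only [hdef]
    rw [h3, Matrix.mul_sub, Matrix.mul_sub, Matrix.sub_mul, Matrix.sub_mul]
    congr 1
    · congr 1
      · simp only [Matrix.mul_assoc]
        rw [← Matrix.mul_assoc Tᵀ T, h2, Matrix.one_mul]
      · simp [Matrix.mul_assoc]
    · simp [h1]
  have hqq : trace (q G * q G) = trace (q H * q H) := by
    have : q G * q G = T * (q H * q H * Tᵀ) := by
      rw [hq]
      simp only [Matrix.mul_assoc]
      rw [← Matrix.mul_assoc Tᵀ T, h2, Matrix.one_mul]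
    rw [this, trace_mul_comm, Matrix.mul_assoc, h2, Matrix.mul_one]
  have htrJ : trace (G.rel 1 1 1) = Fintype.card V := by simp [trace]
  have hqT : (q G)ᵀ = q G := by
    simp only [hdef, transpose_sub, transpose_mul, transpose_smul, rel_transpose, transpose_one]
  have hGJ := hqJ G hreg
  have hJG : G.rel 1 1 1 * q G = (k * k - (l - m) * k - (k - m)) • G.rel 1 1 1 := by
    have := congrArg transpose hGJ
    rwa [transpose_mul, transpose_smul, rel_transpose, hqT] at this
  have hX : q G - m • G.rel 1 1 1 = 0 := by
    refine eq_zero_of_trace_sq ?_ ?_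
    · rw [transpose_sub, hqT, transpose_smul, rel_transpose]
    · have hHJ := congrArg trace (hqJ H h.reg)
      rw [hJ, hqH, Matrix.smul_mul, const_mul_const, trace_smul, trace_smul, trace_smul, htrJ]
        at hHJ
      have e1 : (q G - m • G.rel 1 1 1) * (q G - m • G.rel 1 1 1) = q G * q G -
          (2 * m * (k * k - (l - m) * k - (k - m))) • G.rel 1 1 1 +
          (m * m * Fintype.card V) • G.rel 1 1 1 := by
        simp only [Matrix.sub_mul, Matrix.mul_sub, Matrix.smul_mul, Matrix.mul_smul,
          const_mul_const, hGJ, hJG]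
        module
      rw [e1, trace_add, trace_sub, hqq, hqH, Matrix.smul_mul, Matrix.mul_smul, const_mul_const]
      simp only [trace_smul, htrJ, smul_eq_mul] at hHJ ⊢
      linear_combination (2 * m) * hHJ
  simp only [hdef] at hX
  unfold SR
  rw [sub_sub, sub_sub, sub_eq_zero] at hX
  rw [hX, ← rel_one_zero_zero (G := G), smul_rel, smul_rel, smul_rel, rel_add, rel_add]
  congr 1 <;> ring

theorem IsTupleRegular.comap {t : ℕ} {K : SimpleGraph W} (h : K.IsTupleRegular t) (f : V ≃ W) :
    (K.comap f).IsTupleRegular t := by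
  intro s hs x y hx hy hxy
  have key : ∀ x : Fin s → V, Nat.card {z : V // ∀ i, (K.comap f).Adj z (x i)} =
      Nat.card {z : W // ∀ i, K.Adj z (f (x i))} := fun x =>
    Nat.card_congr (f.subtypeEquiv fun z => by simp)
  rw [key, key]
  exact h s hs _ _ (f.injective.comp hx) (f.injective.comp hy) hxy

theorem charpoly_adjMatrix_real (F : SimpleGraph V) [DecidableRel F.Adj] :
    (F.adjMatrix ℝ).charpoly = (F.adjMatrix ℤ).charpoly.map (Int.castRingHom ℝ) := by
  rw [← Matrix.charpoly_map]
  congr 1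
  ext x y
  simp [adjMatrix_apply]

theorem cospec_comap {K : SimpleGraph W} [DecidableRel G.Adj] [DecidableRel K.Adj]
    (h : (G.adjMatrix ℤ).charpoly = (K.adjMatrix ℤ).charpoly) (f : V ≃ W) :
    Cospec G (K.comap f) := by
  have hK : (K.comap f).rel 0 1 0 = (K.adjMatrix ℝ).submatrix f f := by
    ext x y
    rw [← rel_zero_one_zero, rel_apply, typ_comap f.injective]; rfl
  have hH : (K.comap f).rel 0 1 0 = Matrix.reindex f.symm f.symm (K.adjMatrix ℝ) := by
    rw [hK]; rfl
  refine Matrix.IsHermitian.exists_orthogonal_conj ?_ ?_ ?_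
  · rw [IsHermitian, conjTranspose_eq_transpose_of_trivial, rel_transpose]
  · rw [IsHermitian, conjTranspose_eq_transpose_of_trivial, rel_transpose]
  · rw [hH, Matrix.charpoly_reindex, rel_zero_one_zero, charpoly_adjMatrix_real, h,
      charpoly_adjMatrix_real]

end Spectrum

end SimpleGraph

namespace SimpleGraph

section Combinatorics

variable {V : Type*} {G : SimpleGraph V}

/-- Adjacency is transitive: the graph is a disjoint union of cliques. -/
def Cluster (G : SimpleGraph V) : Prop :=
  ∀ ⦃x y z⦄, G.Adj x y → G.Adj y z → x ≠ z → G.Adj x z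

/-- Neither the graph nor its complement is a disjoint union of cliques. -/
def Prim (G : SimpleGraph V) : Prop := ¬ G.Cluster ∧ ¬ Gᶜ.Cluster

/-- No triangles. -/
def TriFree (G : SimpleGraph V) : Prop := ∀ ⦃x y z⦄, G.Adj x y → G.Adj y z → ¬ G.Adj x z

/-- All local graphs are disjoint unions of cliques. -/
def LocCluster (G : SimpleGraph V) : Prop :=
  ∀ ⦃x u v w⦄, G.Adj x u → G.Adj x v → G.Adj x w → G.Adj u v → G.Adj v w → u ≠ w → G.Adj u w

/-- All local graphs are complete multipartite. -/
def LocMulti (G : SimpleGraph V) : Prop :=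
  ∀ ⦃x u v w⦄, G.Adj x u → G.Adj x v → G.Adj x w → Gᶜ.Adj u v → Gᶜ.Adj v w → ¬ G.Adj u w

theorem Prim.compl (h : G.Prim) : Gᶜ.Prim := ⟨h.2, by simpa using h.1⟩

theorem not_adj_of_compl {x y : V} (h : Gᶜ.Adj x y) : ¬ G.Adj x y := ((compl_adj _ _ _).1 h).2

theorem compl_of_not_adj {x y : V} (h : x ≠ y) (h' : ¬ G.Adj x y) : Gᶜ.Adj x y :=
  (compl_adj _ _ _).2 ⟨h, h'⟩

variable [Fintype V]

theorem exists_iff_sum_ne_zero (p : V → Prop) [DecidablePred p] :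
    (∃ v, p v) ↔ ∑ v, (if p v then (1 : ℝ) else 0) ≠ 0 := by
  rw [Finset.sum_boole, Nat.cast_ne_zero, Finset.card_ne_zero]
  simp [Finset.filter_nonempty_iff]

theorem IsTupleRegular.transfer_one (h : G.IsTupleRegular 1) {i : Fin 3} {x x' : V}
    (hv : ∃ v, G.typ v x = i) : ∃ v, G.typ v x' = i := by
  obtain ⟨c, hc⟩ := h.exists_typ_one le_rfl fun a => if a = i then 1 else 0
  rw [exists_iff_sum_ne_zero] at hv ⊢
  rwa [hc] at hv ⊢

theorem IsTupleRegular.transfer_two (h : G.IsTupleRegular 2) {i j : Fin 3} {x y x' y' : V}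
    (hxy : G.typ x y = G.typ x' y') (hv : ∃ v, G.typ v x = i ∧ G.typ v y = j) :
    ∃ v, G.typ v x' = i ∧ G.typ v y' = j := by
  obtain ⟨c, hc⟩ := h.exists_typ_two le_rfl fun a b => if a = i ∧ b = j then 1 else 0
  rw [exists_iff_sum_ne_zero] at hv ⊢
  rwa [hc, ← hxy, ← hc]

theorem IsTupleRegular.transfer_three (h : G.IsTupleRegular 3) {i j k : Fin 3}
    {x y z x' y' z' : V} (hxy : G.typ x y = G.typ x' y') (hxz : G.typ x z = G.typ x' z')
    (hyz : G.typ y z = G.typ y' z') (hv : ∃ v, G.typ v x = i ∧ G.typ v y = j ∧ G.typ v z = k) :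
    ∃ v, G.typ v x' = i ∧ G.typ v y' = j ∧ G.typ v z' = k := by
  obtain ⟨c, hc⟩ := h.exists_typ_three le_rfl fun a b d =>
    if a = i ∧ b = j ∧ d = k then 1 else 0
  rw [exists_iff_sum_ne_zero] at hv ⊢
  rwa [hc, ← hxy, ← hxz, ← hyz, ← hc]

theorem Prim.exists_path (h : G.Prim) : ∃ x y z, G.Adj x y ∧ G.Adj y z ∧ Gᶜ.Adj x z := by
  have := h.1
  unfold Cluster at this
  push Not at this
  obtain ⟨x, y, z, h1, h2, h3, h4⟩ := this
  exact ⟨x, y, z, h1, h2, compl_of_not_adj h3 h4⟩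

variable (h2 : G.IsTupleRegular 2) (hp : G.Prim)
include h2 hp

theorem Prim.exists_common {x y : V} (hxy : Gᶜ.Adj x y) : ∃ v, G.Adj x v ∧ G.Adj y v := by
  obtain ⟨a, b, c, h1, h3, h4⟩ := hp.exists_path
  obtain ⟨v, hv1, hv2⟩ := h2.transfer_two ((typ_eq_two'.2 h4).trans (typ_eq_two'.2 hxy).symm)
    ⟨b, typ_eq_one.2 h1.symm, typ_eq_one.2 h3⟩
  exact ⟨v, (typ_eq_one.1 hv1).symm, (typ_eq_one.1 hv2).symm⟩

theorem Prim.exists_noncommon {x y : V} (hxy : G.Adj x y) : ∃ v, Gᶜ.Adj x v ∧ Gᶜ.Adj y v :=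
  hp.compl.exists_common h2.compl (by simpa using hxy)

theorem Prim.exists_sep {x y : V} (hxy : x ≠ y) : ∃ v, G.Adj x v ∧ Gᶜ.Adj y v := by
  rcases typ_cases (G := G) x y with h | h | h
  · exact absurd h.1 hxy
  · obtain ⟨a, b, c, h1, h3, h4⟩ := hp.exists_path
    obtain ⟨v, hv1, hv2⟩ := h2.transfer_two ((typ_eq_one.2 h3).trans h.2.symm)
      (x := b) (y := c) (x' := x) (y' := y) (i := 1) (j := 2)
      ⟨a, typ_eq_one.2 h1, typ_eq_two'.2 h4⟩
    exact ⟨v, (typ_eq_one.1 hv1).symm, (typ_eq_two'.1 hv2).symm⟩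
  · obtain ⟨a, b, c, h1, h3, h4⟩ := hp.compl.exists_path
    rw [compl_compl] at h4
    obtain ⟨v, hv1, hv2⟩ := h2.transfer_two ((typ_eq_two'.2 h3.symm).trans h.2.symm)
      (x := c) (y := b) (x' := x) (y' := y) (i := 1) (j := 2)
      ⟨a, typ_eq_one.2 h4, typ_eq_two'.2 h1⟩
    exact ⟨v, (typ_eq_one.1 hv1).symm, (typ_eq_two'.1 hv2).symm⟩

theorem Prim.exists_adj (x : V) : ∃ v, G.Adj x v := by
  obtain ⟨a, b, c, h1, h3, h4⟩ := hp.exists_path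
  obtain ⟨v, hv⟩ := (h2.mono (by norm_num : 1 ≤ 2)).transfer_one (x' := x)
    ⟨b, typ_eq_one.2 h1.symm⟩
  exact ⟨v, (typ_eq_one.1 hv).symm⟩

theorem Prim.exists_nonadj (x : V) : ∃ v, Gᶜ.Adj x v := hp.compl.exists_adj h2.compl x

omit hp in
theorem IsTupleRegular.exists_triangle (ht : ¬ G.TriFree) {x y : V} (hxy : G.Adj x y) :
    ∃ v, G.Adj x v ∧ G.Adj y v := by
  unfold TriFree at ht
  push Not at ht
  obtain ⟨a, b, c, h1, h3, h4⟩ := ht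
  obtain ⟨v, hv1, hv2⟩ := h2.transfer_two ((typ_eq_one.2 h4).trans (typ_eq_one.2 hxy).symm)
    ⟨b, typ_eq_one.2 h1.symm, typ_eq_one.2 h3⟩
  exact ⟨v, (typ_eq_one.1 hv1).symm, (typ_eq_one.1 hv2).symm⟩

theorem LocMulti.triFree (hm : G.LocMulti) : G.TriFree := by
  by_contra ht
  obtain ⟨x, -, y, -, -, hxy⟩ := hp.exists_path
  have hc : ∀ z w, G.Adj x z → G.Adj y z → G.Adj x w → G.Adj z w → G.Adj y w := by
    intro z w hxz hyz hxw hzw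
    by_contra hyw
    refine hm hzw hyz.symm hxz.symm (compl_of_not_adj ?_ fun h => hyw h.symm) hxy.symm hxw.symm
    rintro rfl
    exact not_adj_of_compl hxy hxw
  obtain ⟨z, hxz, hyz⟩ := hp.exists_common h2 hxy
  obtain ⟨w, hxw, hzw⟩ := h2.exists_triangle ht hxz
  have hyw := hc z w hxz hyz hxw hzw
  obtain ⟨v, hxv, hyv⟩ := hp.exists_sep h2 hxy.ne
  have hyv := not_adj_of_compl hyv
  refine hm hxz hxv hxw (compl_of_not_adj ?_ ?_) (compl_of_not_adj ?_ ?_) hzw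
  · rintro rfl; exact hyv hyz
  · intro h; exact hyv (hc z v hxz hyz hxv h)
  · rintro rfl; exact hyv hyw
  · intro h; exact hyv (hc w v hxw hyw hxv h.symm)

theorem triFree_of_nonadj_never (h : ∀ x y z w, Gᶜ.Adj x y → G.Adj x z → G.Adj y z → G.Adj x w →
    Gᶜ.Adj y w → ¬ G.Adj z w) : G.TriFree := by
  refine LocMulti.triFree h2 hp fun x u v w hu hv hw huv hvw huw => ?_
  exact h w v x u hvw.symm hw.symm hv.symm huw.symm huv.symm hu

theorem triFree_of_adj_always (h : ∀ x y z w, G.Adj x y → G.Adj x z → G.Adj y z → G.Adj x w →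
    Gᶜ.Adj y w → G.Adj z w) : G.TriFree := by
  refine LocMulti.triFree h2 hp fun x u v w hu hv hw huv hvw huw => ?_
  exact not_adj_of_compl hvw (h x u w v hu hw huw hv huv).symm

omit h2 hp [Fintype V] in
theorem locCluster_of_adj_never (h : ∀ x y z w, G.Adj x y → G.Adj x z → G.Adj y z → G.Adj x w →
    Gᶜ.Adj y w → ¬ G.Adj z w) : G.LocCluster := by
  intro x u v w hu hv hw huv hvw huw
  by_contra hc
  exact h x u v w hu hv huv hw (compl_of_not_adj huw hc) hvw

omit h2 in
theorem triFree_of_nonadj_always (h3 : G.IsTupleRegular 3)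
    (h : ∀ x y z w, Gᶜ.Adj x y → G.Adj x z → G.Adj y z → G.Adj x w → Gᶜ.Adj y w → G.Adj z w) :
    G.TriFree := by
  have h2 := h3.mono (by norm_num : 2 ≤ 3)
  by_cases hm : G.LocMulti
  · exact hm.triFree h2 hp
  exfalso
  unfold LocMulti at hm
  push Not at hm
  obtain ⟨x, u, v, w, hu, hv, hw, huv, hvw, huw⟩ := hm
  have key : ∀ a b y, G.Adj x a → G.Adj x b → Gᶜ.Adj a b → Gᶜ.Adj x y → G.Adj y a →
      G.Adj y b := by
    intro a b y ha hb hab hxy hya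
    by_contra hyb
    refine not_adj_of_compl hab (h x y a b hxy ha hya hb (compl_of_not_adj ?_ hyb))
    rintro rfl
    exact not_adj_of_compl hxy hb
  obtain ⟨y, hxy⟩ := hp.exists_nonadj h2 x
  obtain ⟨a, hxa, hya⟩ := hp.exists_common h2 hxy
  obtain ⟨b, hxb, hyb⟩ := hp.exists_sep h2 hxy.ne
  have hab : G.Adj a b := h x y a b hxy hxa hya hxb hyb
  obtain ⟨d, hd1, hd2, hd3⟩ := h3.transfer_three (x := x) (y := u) (z := w) (x' := x) (y' := a)
    (z' := b) ((typ_eq_one.2 hu).trans (typ_eq_one.2 hxa).symm)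
    ((typ_eq_one.2 hw).trans (typ_eq_one.2 hxb).symm)
    ((typ_eq_one.2 huw).trans (typ_eq_one.2 hab).symm)
    ⟨v, typ_eq_one.2 hv.symm, typ_eq_two'.2 huv.symm, typ_eq_two'.2 hvw⟩
  rw [typ_eq_one] at hd1
  rw [typ_eq_two'] at hd2 hd3
  exact not_adj_of_compl hyb
    (key d b y hd1.symm hxb hd3 hxy (key a d y hxa hd1.symm hd2.symm hxy hya))

end Combinatorics

end SimpleGraph

namespace SimpleGraph

section Parameters

variable {V : Type*} [Fintype V] [DecidableEq V] {G : SimpleGraph V}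

theorem mul_rel_eq_ite (x y : V) : (G.rel 0 1 0 * G.rel 0 1 0) x y =
    ∑ v, (if G.typ x v = 1 ∧ G.typ y v = 1 then (1 : ℝ) else 0) := by
  rw [Matrix.mul_apply]
  refine Finset.sum_congr rfl fun v _ => ?_
  rw [rel_apply, rel_apply, typ_comm v y]
  generalize G.typ x v = i
  generalize G.typ y v = j
  fin_cases i <;> fin_cases j <;> simp

theorem exists_nat_mul_rel (x y : V) : ∃ N : ℕ, (G.rel 0 1 0 * G.rel 0 1 0) x y = N := by
  rw [mul_rel_eq_ite]
  exact ⟨_, Finset.sum_boole _ _⟩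

theorem mul_rel_pos {x y v : V} (hx : G.Adj x v) (hy : G.Adj y v) :
    0 < (G.rel 0 1 0 * G.rel 0 1 0) x y := by
  rw [mul_rel_eq_ite, Finset.sum_boole, Nat.cast_pos, Finset.card_pos]
  exact ⟨v, by simp [typ_eq_one, hx, hy]⟩

theorem mul_rel_eq_one {x y v : V} (hx : G.Adj x v) (hy : G.Adj y v)
    (h : ∀ w, G.Adj x w → G.Adj y w → w = v) : (G.rel 0 1 0 * G.rel 0 1 0) x y = 1 := by
  rw [mul_rel_eq_ite, Finset.sum_boole]
  norm_cast
  rw [Finset.card_eq_one]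
  refine ⟨v, ?_⟩
  ext w
  simp only [Finset.mem_filter, Finset.mem_univ, true_and, Finset.mem_singleton, typ_eq_one]
  exact ⟨fun hw => h w hw.1 hw.2, fun hw => hw ▸ ⟨hx, hy⟩⟩

variable {k l m : ℝ}

theorem Reg.sum_rel (h : G.Reg k) (e a b : ℝ) (x : V) :
    ∑ v, G.rel e a b x v = e + k * a + (Fintype.card V - 1 - k) * b := by
  rw [rel_eq]
  have h1 := h x
  simp only [Matrix.add_apply, Matrix.smul_apply, rel_const, smul_eq_mul, Finset.sum_add_distrib,
    ← Finset.mul_sum, h1, Matrix.one_apply, Finset.sum_ite_eq, Finset.mem_univ, if_true]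
  simp
  ring

theorem SR.param_eq (h : G.SR k l m) (x : V) :
    k * k = k + k * l + (Fintype.card V - 1 - k) * m := by
  rw [← h.reg.sum_rel k l m x, ← show G.rel 0 1 0 * G.rel 0 1 0 = G.rel k l m from h]
  have h1 : (G.rel 0 1 0 * G.rel 0 1 0 * G.rel 1 1 1) x x = k * k := by
    rw [Matrix.mul_assoc, h.reg.mul_const, Matrix.mul_smul, h.reg.mul_const]
    simp
  rw [← h1, Matrix.mul_apply]
  simp [rel_const]

theorem SR.apply_adj (h : G.SR k l m) {x y : V} (hxy : G.Adj x y) :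
    (G.rel 0 1 0 * G.rel 0 1 0) x y = l := by
  rw [show G.rel 0 1 0 * G.rel 0 1 0 = G.rel k l m from h, rel_adj _ _ _ hxy]

theorem SR.apply_nonadj (h : G.SR k l m) {x y : V} (hxy : Gᶜ.Adj x y) :
    (G.rel 0 1 0 * G.rel 0 1 0) x y = m := by
  rw [show G.rel 0 1 0 * G.rel 0 1 0 = G.rel k l m from h, rel_nonadj _ _ _ hxy]

theorem SR.apply_self (h : G.SR k l m) (x : V) : (G.rel 0 1 0 * G.rel 0 1 0) x x = k := by
  rw [show G.rel 0 1 0 * G.rel 0 1 0 = G.rel k l m from h, rel_self]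

theorem SR.sub_nonadj (h : G.SR k l m) {x y : V} (hxy : Gᶜ.Adj x y) :
    k - m = ∑ v, if G.typ x v = 1 ∧ G.typ y v ≠ 1 then (1 : ℝ) else 0 := by
  rw [← h.apply_nonadj hxy, ← h.apply_self x, mul_rel_eq_ite, mul_rel_eq_ite,
    ← Finset.sum_sub_distrib]
  refine Finset.sum_congr rfl fun v _ => ?_
  split_ifs <;> simp_all

theorem SR.m_pos (h : G.SR k l m) (hp : G.Prim) : 0 < m := by
  obtain ⟨x, y, z, h1, h2, h3⟩ := hp.exists_path
  rw [← h.apply_nonadj h3]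
  exact mul_rel_pos h1 h2.symm

theorem SR.m_lt (h : G.SR k l m) (hp : G.Prim) : m < k := by
  obtain ⟨x, y, z, h1, h2, h3⟩ := hp.exists_path
  obtain ⟨v, hv1, hv2⟩ := hp.exists_sep h.isTupleRegular h3.ne
  rw [← sub_pos, h.sub_nonadj h3, Finset.sum_boole, Nat.cast_pos, Finset.card_pos]
  exact ⟨v, by simp [typ_eq_one, hv1, not_adj_of_compl hv2]⟩

theorem SR.l_pos (h : G.SR k l m) (ht : ¬ G.TriFree) : 0 < l := by
  unfold TriFree at ht
  push Not at ht
  obtain ⟨x, y, z, h1, h2, h3⟩ := ht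
  rw [← h.apply_adj h3]
  exact mul_rel_pos h1 h2.symm

theorem SR.exists_nat (h : G.SR k l m) (hp : G.Prim) :
    ∃ k' l' m' : ℕ, k = k' ∧ l = l' ∧ m = m' := by
  obtain ⟨x, y, z, h1, h2, h3⟩ := hp.exists_path
  obtain ⟨a, ha⟩ := exists_nat_mul_rel (G := G) x x
  obtain ⟨b, hb⟩ := exists_nat_mul_rel (G := G) x y
  obtain ⟨c, hc⟩ := exists_nat_mul_rel (G := G) x z
  exact ⟨a, b, c, by rw [← ha, h.apply_self], by rw [← hb, h.apply_adj h1],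
    by rw [← hc, h.apply_nonadj h3]⟩

theorem LocCluster.l_eq_one (h : G.SR k l m) (hp : G.Prim) (ht : ¬ G.TriFree)
    (hl : G.LocCluster) (hl' : Gᶜ.LocCluster) : l = 1 := by
  have h2 := h.isTupleRegular
  obtain ⟨x, -, y, -, -, hxy⟩ := hp.exists_path
  obtain ⟨z, hxz, hyz⟩ := hp.exists_common h2 hxy
  have hco : ∀ u v, G.Adj x u → G.Adj y u → G.Adj x v → G.Adj y v → ¬ G.Adj u v :=
    fun u v hxu hyu hxv hyv huv => not_adj_of_compl hxy
      (hl hxu.symm huv hyu.symm hxv hyv.symm hxy.ne)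
  have hmate : ∀ u v, G.Adj x u → G.Adj y u → G.Adj y v → G.Adj u v → Gᶜ.Adj x v := by
    intro u v hxu hyu hyv huv
    refine compl_of_not_adj ?_ fun hxv => hco u v hxu hyu hxv hyv huv
    rintro rfl
    exact not_adj_of_compl hxy hyv.symm
  obtain ⟨w, hyw, hzw⟩ := h2.exists_triangle ht hyz
  have hxw := hmate z w hxz hyz hyw hzw
  rw [← h.apply_adj hyz]
  refine mul_rel_eq_one hyw hzw fun w' hyw' hzw' => ?_
  by_contra hne
  have hxw' := hmate z w' hxz hyz hyw' hzw'
  have hww : G.Adj w w' := hl hyw hyz hyw' hzw.symm hzw' (Ne.symm hne)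
  have hcl : ∀ u, G.Adj y u → Gᶜ.Adj x u → u ≠ w → G.Adj u w := by
    intro u hyu hxu huw
    by_contra hn
    by_cases huw' : G.Adj u w'
    · exact hn (hl hyu hyw' hyw huw' hww.symm huw)
    · have hu' : u ≠ w' := by rintro rfl; exact hn hww.symm
      exact not_adj_of_compl (hl' hxw hxu hxw' (compl_of_not_adj huw hn).symm
        (compl_of_not_adj hu' huw') hww.ne) hww
  have hcz : ∀ u, G.Adj y u → Gᶜ.Adj x u → u ≠ z → G.Adj u z := by
    intro u hyu hxu huz
    by_cases huw : u = w
    · exact huw ▸ hzw.symm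
    · exact hl hyu hyw hyz (hcl u hyu hxu huw) hzw.symm huz
  obtain ⟨v, hyv, hzv⟩ := hp.exists_sep h2 hyz.ne
  have hxv : G.Adj x v := by
    by_contra hn
    refine not_adj_of_compl hzv (hcz v hyv (compl_of_not_adj ?_ hn) hzv.ne.symm).symm
    rintro rfl
    exact not_adj_of_compl hxy hyv.symm
  obtain ⟨u, hyu, hvu⟩ := h2.exists_triangle ht hyv
  have hxu := hmate v u hxv hyv hyu hvu
  have huz : G.Adj u z := hcz u hyu hxu fun h => not_adj_of_compl hxu (h ▸ hxz)
  exact not_adj_of_compl hzv (hl hyv hyu hyz hvu huz hzv.ne.symm).symm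

/-- The parameters of the `3 × 3` lattice graph. -/
def LatticeParams (n k l m : ℝ) : Prop := n = 9 ∧ k = 4 ∧ l = 1 ∧ m = 2

theorem latticeParams_of_locCluster (h : G.SR k l m) (hp : G.Prim)
    (ht : ¬ G.TriFree) (ht' : ¬ Gᶜ.TriFree)
    (hl : G.LocCluster) (hl' : Gᶜ.LocCluster) : LatticeParams (Fintype.card V) k l m := by
  have e1 := hl.l_eq_one h hp ht hl'
  have e2 := hl'.l_eq_one h.compl hp.compl ht' (by simpa using hl)
  have hm := h.m_pos hp
  have hk := h.m_lt hp
  obtain ⟨x, -⟩ := hp.exists_path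
  have e3 := h.param_eq x
  obtain ⟨k', l', m', hk', hl', hm'⟩ := h.exists_nat hp
  have e4 : (Fintype.card V : ℝ) = 2 * k + 3 - m := by linarith
  rw [e4, e1] at e3
  rw [hk', hm'] at e3 hk
  rw [hm'] at hm
  have e5 : (k' * k' + m' * m' : ℤ) = (2 + m') * k' + 2 * m' := by
    have : ((k' * k' + m' * m' : ℤ) : ℝ) = ((2 + m') * k' + 2 * m' : ℤ) := by
      push_cast; linarith
    exact_mod_cast this
  have hm0 : 0 < m' := by exact_mod_cast hm
  have hk0 : m' < k' := by exact_mod_cast hk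
  have hm4 : m' ≤ 4 := by
    by_contra! hc
    have : (5 : ℤ) ≤ m' := by exact_mod_cast hc
    nlinarith [sq_nonneg (2 * (k' : ℤ) - (2 + m'))]
  have hkm : k' ≤ 8 := by
    by_contra! hc
    have h1 : (9 : ℤ) ≤ k' := by exact_mod_cast hc
    have h2 : (m' : ℤ) ≤ 4 := by exact_mod_cast hm4
    have h3 : (0 : ℤ) < m' := by exact_mod_cast hm0
    nlinarith
  have : k' = 4 ∧ m' = 2 := by
    interval_cases m' <;> interval_cases k' <;> simp_all
  obtain ⟨rfl, rfl⟩ := this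
  refine ⟨?_, ?_, e1, ?_⟩
  · rw [e4, hk', hm']; norm_num
  · rw [hk']; norm_num
  · rw [hm']; norm_num

end Parameters

end SimpleGraph

namespace SimpleGraph

section TriangleFree

variable {V : Type*} [Fintype V] [DecidableEq V] {G : SimpleGraph V} {k l m : ℝ}

theorem fin_three_cases (i : Fin 3) : i = 0 ∨ i = 1 ∨ i = 2 := by
  fin_cases i <;> simp

theorem one_ne_two_fin : (1 : Fin 3) ≠ 2 := by decide

theorem TriFree.typ_eq_two_of_adj (ht : G.TriFree) {v u w : V} (hu : G.Adj v u) (hw : G.Adj v w)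
    (h : u ≠ w) : G.typ u w = 2 :=
  typ_eq_two.2 ⟨h, ht hu.symm hw⟩

theorem SR.sum_adj_adj (h : G.SR k l m) (x y : V) :
    ∑ v, G.rel 0 1 0 v x * G.rel 0 1 0 v y = G.rel k l m x y := by
  rw [← show G.rel 0 1 0 * G.rel 0 1 0 = G.rel k l m from h, Matrix.mul_apply]
  exact Finset.sum_congr rfl fun v _ => by rw [rel_comm 0 1 0 v x]

theorem rel_mul_sq (x y : V) : G.rel 0 1 0 x y * G.rel 0 1 0 x y = G.rel 0 1 0 x y := by
  rw [rel_apply]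
  generalize G.typ x y = i
  fin_cases i <;> simp

theorem TriFree.mul_rel_eq_zero (ht : G.TriFree) {x z : V} (h : G.Adj z x) (v : V) :
    G.rel 0 1 0 v x * G.rel 0 1 0 v z = 0 := by
  rcases typ_cases (G := G) v x with h1 | h1 | h1 <;>
  rcases typ_cases (G := G) v z with h2 | h2 | h2 <;> simp [rel_apply, h1.2, h2.2]
  exact absurd h (ht h2.1.symm h1.1)

/-- Counting the pairs `(v, z)` with `v` weighted by a function supported on the common
neighbours of a coclique. -/
theorem TriFree.sum_coclique (ht : G.TriFree) (S : Finset V)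
    (q : V → ℝ)
    (hq : ∀ x ∈ S, ∀ v, q v * G.rel 0 1 0 v x = q v) {d : ℝ}
    (hd : ∀ z, (∀ x ∈ S, G.typ z x = 2) → ∑ v, q v * G.rel 0 1 0 v z = d) (g : V → ℝ) :
    ∑ v, q v * ∑ z, G.rel 0 1 0 v z * g z = (∑ v, q v) * ∑ x ∈ S, g x +
      d * ∑ z, if ∀ x ∈ S, G.typ z x = 2 then g z else 0 := by
  calc _ = ∑ z, (∑ v, q v * G.rel 0 1 0 v z) * g z := by
        simp only [Finset.sum_mul, Finset.mul_sum]
        rw [Finset.sum_comm]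
        exact Finset.sum_congr rfl fun z _ => Finset.sum_congr rfl fun v _ => by ring
    _ = ∑ z, ((∑ v, q v) * (if z ∈ S then g z else 0) +
          d * if ∀ x ∈ S, G.typ z x = 2 then g z else 0) := by
        refine Finset.sum_congr rfl fun z _ => ?_
        by_cases hz : z ∈ S
        · rw [if_pos hz, if_neg fun h => by simpa [typ_self] using h z hz, mul_zero, add_zero]
          congr 1
          exact Finset.sum_congr rfl fun v _ => hq z hz v
        · rw [if_neg hz, mul_zero, zero_add]
          split_ifs with h
          · rw [hd z h]
          · push Not at h
            obtain ⟨x, hx, hzx⟩ := h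
            have hzx : G.Adj z x := by
              rcases typ_cases (G := G) z x with h1 | h1 | h1
              · exact absurd hx (h1.1 ▸ hz)
              · exact h1.1
              · exact absurd h1.2 hzx
            rw [mul_zero, Finset.sum_eq_zero, zero_mul]
            intro v _
            rw [← hq x hx v, mul_assoc, ht.mul_rel_eq_zero hzx, mul_zero]
    _ = _ := by
        rw [Finset.sum_add_distrib, ← Finset.mul_sum, ← Finset.mul_sum]
        simp

theorem SR.coclique_count (h : G.SR k l m) (ht : G.TriFree) (S : Finset V)
    (q : V → ℝ)
    (hq : ∀ x ∈ S, ∀ v, q v * G.rel 0 1 0 v x = q v) {d : ℝ}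
    (hd : ∀ z, (∀ x ∈ S, G.typ z x = 2) → ∑ v, q v * G.rel 0 1 0 v z = d) :
    (∑ v, q v) * k = (∑ v, q v) * S.card +
      d * ∑ z, if ∀ x ∈ S, G.typ z x = 2 then (1 : ℝ) else 0 := by
  have := ht.sum_coclique S q hq hd 1
  have hk : ∀ v, ∑ z, G.rel 0 1 0 v z = k := h.reg
  simpa only [Pi.one_apply, mul_one, hk, ← Finset.sum_mul, Finset.sum_const, nsmul_eq_mul]
    using this

theorem SR.coclique_count_path (h : G.SR k l m) (ht : G.TriFree) (S : Finset V) {u : V}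
    (hu : ∀ x ∈ S, G.Adj x u) (hne : S.Nonempty) (q : V → ℝ)
    (hq : ∀ x ∈ S, ∀ v, q v * G.rel 0 1 0 v x = q v) (hqu : q u = 1) {d : ℝ}
    (hd : ∀ z, (∀ x ∈ S, G.typ z x = 2) → ∑ v, q v * G.rel 0 1 0 v z = d) :
    m * (∑ v, q v) + (k - m) = (∑ v, q v) * S.card + d * (k - S.card) := by
  have key := ht.sum_coclique S q hq hd fun z => G.rel 0 1 0 z u
  have h1 : ∀ v, q v * ∑ z, G.rel 0 1 0 v z * G.rel 0 1 0 z u =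
      m * q v + (if v = u then k - m else 0) := by
    intro v
    rw [← Matrix.mul_apply, show G.rel 0 1 0 * G.rel 0 1 0 = G.rel k l m from h]
    by_cases hv : q v = 0
    · have : v ≠ u := by rintro rfl; simp [hqu] at hv
      simp [hv, this]
    · by_cases hvu : v = u
      · subst hvu; simp [hqu]
      · obtain ⟨x, hx⟩ := hne
        have hvx : G.Adj v x := by
          rw [← hq x hx] at hv
          rcases typ_cases (G := G) v x with h1 | h1 | h1
          · simp [rel_apply, h1.2] at hv
          · exact h1.1
          · simp [rel_apply, h1.2] at hv
        rw [rel_apply, ht.typ_eq_two_of_adj hvx.symm (hu x hx) hvu]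
        simp [hvu, mul_comm]
  have h2 : ∑ x ∈ S, G.rel 0 1 0 x u = S.card := by
    rw [Finset.sum_congr rfl fun x hx => rel_adj 0 1 0 (hu x hx)]
    simp
  have h3 : ∑ z, (if ∀ x ∈ S, G.typ z x = 2 then G.rel 0 1 0 z u else 0) = k - S.card := by
    have hk : ∑ z, G.rel 0 1 0 u z = k := h.reg u
    rw [← hk, ← h2, eq_sub_iff_add_eq, ← Finset.sum_filter_add_sum_filter_not Finset.univ
      (fun z => ∀ x ∈ S, G.typ z x = 2) (fun z => G.rel 0 1 0 u z), ← Finset.sum_filter]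
    congr 1
    · exact Finset.sum_congr rfl fun z _ => rel_comm _ _ _ _ _
    · refine (Finset.sum_subset_zero_on_sdiff ?_ ?_ ?_)
      · intro x hx
        simp only [Finset.mem_filter, Finset.mem_univ, true_and]
        exact fun h => by simpa [typ_self] using h x hx
      · intro z hz
        simp only [Finset.mem_sdiff, Finset.mem_filter, Finset.mem_univ, true_and] at hz
        rcases typ_cases (G := G) u z with h1 | h1 | h1
        · simp [rel_apply, h1.2]
        · refine absurd (fun x hx => ?_) hz.1
          exact ht.typ_eq_two_of_adj h1.1 (hu x hx).symm fun h => hz.2 (h ▸ hx)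
        · simp [rel_apply, h1.2]
      · exact fun x _ => rel_comm _ _ _ _ _
  rw [h2, h3] at key
  rw [← key, Finset.sum_congr rfl fun v _ => h1 v, Finset.sum_add_distrib, ← Finset.mul_sum]
  simp

theorem triFree_arith {k m c d n : ℤ} (h1 : k * m = 2 * m + c * (n - 2 - 2 * k + m))
    (h2 : m * m + (k - m) = 2 * m + c * (k - 2)) (h3 : k * k = k + (n - 1 - k) * m)
    (hk : k ≠ 2) (hm : 0 < m) (hmk : m < k) (hc : 0 < c)
    (h4 : c * k = 3 * c + d * (n - 3 - 3 * k + 3 * m - c))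
    (h5 : m * c + (k - m) = 3 * c + d * (k - 3)) : False := by
  have hj : k - 2 ≠ 0 := sub_ne_zero.2 hk
  have e1 : c * k = m * m + c * m - c * c := by
    refine mul_left_cancel₀ hj ?_
    linear_combination (-m) * h1 - c * h2 + c * h3
  have e2 : (m - c) * (m - c * c - c) = 0 := by
    linear_combination c * h2 - e1 + c * e1
  rcases mul_eq_zero.1 e2 with e | e
  · have : c * (k - c) = 0 := by
      have : m = c := by linarith
      subst this; linarith
    rcases mul_eq_zero.1 this with h | h <;> omega
  · have hm' : m = c * c + c := by linarith
    subst hm'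
    have hk' : k = c * c * c + 3 * (c * c) + c := by
      refine mul_left_cancel₀ hc.ne' ?_
      linarith
    subst hk'
    have e3 : (d - 1) * (c * c * c + 3 * (c * c) + c - 3) = (c - 1) * (c * c + c - 3) := by
      linarith
    rcases (show c = 1 ∨ 2 ≤ c by omega) with rfl | hc2
    · norm_num at *
      have : d = 1 := by omega
      subst this
      omega
    · have : 0 < (c - 1) * (c * c + c - 3) := by nlinarith
      have hK : 0 < c * c * c + 3 * (c * c) + c - 3 := by nlinarith [mul_pos hc hc]
      rw [← e3] at this
      have hd : 1 ≤ d - 1 := (pos_iff_pos_of_mul_pos this).2 hK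
      nlinarith [mul_pos hc hc]

theorem TriFree.valency_eq_two (h4 : G.IsTupleRegular 4) (h : G.SR k l m) (hp : G.Prim)
    (ht : G.TriFree) : k = 2 := by
  obtain ⟨x₀, w₀, y₀, hxw, hwy, hxy⟩ := hp.exists_path
  have hl : l = 0 := by
    rw [← h.apply_adj hxw, Matrix.mul_apply]
    exact Finset.sum_eq_zero fun v _ => by 
      rw [rel_comm 0 1 0 x₀ v]
      exact ht.mul_rel_eq_zero hxw.symm v
  subst hl
  by_contra hk2
  have hm := h.m_pos hp
  have hmk := h.m_lt hp
  have hpar := h.param_eq x₀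
  obtain ⟨k', -, m', hk', -, hm'⟩ := h.exists_nat hp
  have hsum : ∀ v, ∑ z, G.rel 0 1 0 v z = k := h.reg
  obtain ⟨f, hf⟩ := h4.exists_typ_three (by norm_num)
    fun i j k => sel 0 1 0 i * sel 0 1 0 j * sel 0 1 0 k
  simp only [← rel_apply] at hf
  have hm0 : ∑ v, G.rel 0 1 0 v x₀ * G.rel 0 1 0 v y₀ = m := by
    rw [h.sum_adj_adj, rel_nonadj _ _ _ hxy]
  have hq2 : ∀ x ∈ ({x₀, y₀} : Finset V), ∀ v, G.rel 0 1 0 v x₀ * G.rel 0 1 0 v y₀ *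
      G.rel 0 1 0 v x = G.rel 0 1 0 v x₀ * G.rel 0 1 0 v y₀ := by
    intro x hx v
    simp only [Finset.mem_insert, Finset.mem_singleton] at hx
    rcases hx with rfl | rfl
    · rw [mul_right_comm, rel_mul_sq]
    · rw [mul_assoc, rel_mul_sq]
  have hd2 : ∀ z, (∀ x ∈ ({x₀, y₀} : Finset V), G.typ z x = 2) →
      ∑ v, G.rel 0 1 0 v x₀ * G.rel 0 1 0 v y₀ * G.rel 0 1 0 v z = f 2 2 2 := by
    intro z hz
    rw [hf, typ_comm x₀ z, typ_comm y₀ z, hz x₀ (by simp), hz y₀ (by simp), typ_eq_two'.2 hxy]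
  have e1 := h.coclique_count ht {x₀, y₀} _ hq2 hd2
  have e2 := h.coclique_count_path ht {x₀, y₀} (u := w₀) (by simp [hxw, hwy.symm]) (by simp) _ hq2
    (by rw [rel_adj _ _ _ hxw.symm, rel_adj _ _ _ hwy, mul_one]) hd2
  rw [hm0, Finset.card_pair hxy.ne] at e1 e2
  have hL2 : (∑ z, if ∀ x ∈ ({x₀, y₀} : Finset V), G.typ z x = 2 then (1 : ℝ) else 0) =
      Fintype.card V - 2 - 2 * k + m := by
    have := h.compl.sum_adj_adj x₀ y₀
    rw [rel_adj _ _ _ hxy] at this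
    rw [← this]
    refine Finset.sum_congr rfl fun z _ => ?_
    rw [rel_compl, rel_apply, rel_apply]
    simp only [Finset.mem_insert, Finset.mem_singleton, forall_eq_or_imp, forall_eq]
    generalize G.typ z x₀ = i
    generalize G.typ z y₀ = j
    fin_cases i <;> fin_cases j <;> simp
  have hmk2 : m * (k - 2) ≠ 0 := mul_ne_zero hm.ne' (sub_ne_zero.2 hk2)
  obtain ⟨z₀, hz₀⟩ : ∃ z, ∀ x ∈ ({x₀, y₀} : Finset V), G.typ z x = 2 := by
    rw [exists_iff_sum_ne_zero]
    intro h0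
    rw [h0] at e1
    apply hmk2
    push_cast at e1
    linarith
  have hzx := hz₀ x₀ (by simp)
  have hzy := hz₀ y₀ (by simp)
  have hc := hd2 z₀ hz₀
  have hc0 : f 2 2 2 ≠ 0 := by
    intro h0
    rw [h0] at e1
    apply hmk2
    push_cast at e1
    linarith
  obtain ⟨u, -, hu⟩ := Finset.exists_ne_zero_of_sum_ne_zero (hc ▸ hc0)
  have hAdj : ∀ x, G.rel 0 1 0 u x ≠ 0 → G.Adj u x := by
    intro x hx
    rcases typ_cases (G := G) u x with h1 | h1 | h1
    · simp [rel_apply, h1.2] at hx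
    · exact h1.1
    · simp [rel_apply, h1.2] at hx
  have hux := hAdj _ (left_ne_zero_of_mul (left_ne_zero_of_mul hu))
  have huy := hAdj _ (right_ne_zero_of_mul (left_ne_zero_of_mul hu))
  have huz := hAdj _ (right_ne_zero_of_mul hu)
  have hnat : ∀ g : V → ℝ, (∀ v, g v * g v = g v) → ∃ N : ℕ, ∑ v, g v = N := by
    intro g hg
    refine ⟨(Finset.univ.filter fun v => g v = 1).card, ?_⟩
    rw [← Finset.sum_boole]
    refine Finset.sum_congr rfl fun v _ => ?_
    have : g v * (g v - 1) = 0 := by linarith [hg v]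
    split_ifs with h1
    · exact h1
    · exact (mul_eq_zero.1 this).resolve_right (sub_ne_zero.2 h1)
  obtain ⟨c', hc'⟩ := hnat (fun v => G.rel 0 1 0 v x₀ * G.rel 0 1 0 v y₀ * G.rel 0 1 0 v z₀)
    fun v => by rw [mul_mul_mul_comm, mul_mul_mul_comm (G.rel 0 1 0 v x₀)]; simp only [rel_mul_sq]
  have hq3 : ∀ x ∈ ({x₀, y₀, z₀} : Finset V), ∀ v, G.rel 0 1 0 v x₀ * G.rel 0 1 0 v y₀ *
      G.rel 0 1 0 v z₀ * G.rel 0 1 0 v x =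
      G.rel 0 1 0 v x₀ * G.rel 0 1 0 v y₀ * G.rel 0 1 0 v z₀ := by
    intro x hx v
    simp only [Finset.mem_insert, Finset.mem_singleton] at hx
    rcases hx with rfl | rfl | rfl
    · rw [mul_right_comm, hq2 _ (by simp)]
    · rw [mul_right_comm, hq2 _ (by simp)]
    · rw [mul_assoc, rel_mul_sq]
  obtain ⟨f4, hf4⟩ := h4.exists_typ_four le_rfl
    fun i j k l => sel 0 1 0 i * sel 0 1 0 j * sel 0 1 0 k * sel 0 1 0 l
  simp only [← rel_apply] at hf4
  obtain ⟨d', hd3⟩ : ∃ d : ℕ, ∀ z, (∀ x ∈ ({x₀, y₀, z₀} : Finset V), G.typ z x = 2) →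
      ∑ v, G.rel 0 1 0 v x₀ * G.rel 0 1 0 v y₀ * G.rel 0 1 0 v z₀ * G.rel 0 1 0 v z = (d : ℝ) := by
    by_cases hex : ∃ z, ∀ x ∈ ({x₀, y₀, z₀} : Finset V), G.typ z x = 2
    · obtain ⟨w, hw⟩ := hex
      obtain ⟨d, hd⟩ := hnat
        (fun v => G.rel 0 1 0 v x₀ * G.rel 0 1 0 v y₀ * G.rel 0 1 0 v z₀ * G.rel 0 1 0 v w)
        fun v => by
          rw [mul_mul_mul_comm, mul_mul_mul_comm (G.rel 0 1 0 v x₀ * G.rel 0 1 0 v y₀),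
            mul_mul_mul_comm (G.rel 0 1 0 v x₀)]
          simp only [rel_mul_sq]
      refine ⟨d, fun z hz => ?_⟩
      rw [← hd, hf4, hf4]
      simp only [Finset.mem_insert, Finset.mem_singleton, forall_eq_or_imp, forall_eq] at hz hw
      rw [typ_comm x₀ z, typ_comm y₀ z, typ_comm z₀ z, typ_comm x₀ w, typ_comm y₀ w,
        typ_comm z₀ w, hz.1, hz.2.1, hz.2.2, hw.1, hw.2.1, hw.2.2]
    · exact ⟨0, fun z hz => absurd ⟨z, hz⟩ hex⟩
  have hcard : ({x₀, y₀, z₀} : Finset V).card = 3 := by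
    refine Finset.card_eq_three.2 ⟨x₀, y₀, z₀, hxy.ne, ?_, ?_, rfl⟩
    · exact (typ_eq_two.1 hzx).1.symm
    · exact (typ_eq_two.1 hzy).1.symm
  have e3 := h.coclique_count ht {x₀, y₀, z₀} _ hq3 hd3
  have e4 := h.coclique_count_path ht {x₀, y₀, z₀} (u := u) (by simp [hux.symm, huy.symm, huz.symm])
    (by simp) _ hq3
    (by rw [rel_adj _ _ _ hux, rel_adj _ _ _ huy, rel_adj _ _ _ huz, mul_one, mul_one]) hd3
  have hL3 : (∑ z, if ∀ x ∈ ({x₀, y₀, z₀} : Finset V), G.typ z x = 2 then (1 : ℝ) else 0) =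
      Fintype.card V - 3 - 3 * k + 3 * m - f 2 2 2 := by
    have hB : ∀ w, (if ∀ x ∈ ({x₀, y₀, z₀} : Finset V), G.typ w x = 2 then (1 : ℝ) else 0) =
        1 - (if w = x₀ then 1 else 0) - (if w = y₀ then 1 else 0) - (if w = z₀ then 1 else 0)
        - G.rel 0 1 0 w x₀ - G.rel 0 1 0 w y₀ - G.rel 0 1 0 w z₀
        + G.rel 0 1 0 w x₀ * G.rel 0 1 0 w y₀ + G.rel 0 1 0 w x₀ * G.rel 0 1 0 w z₀
        + G.rel 0 1 0 w y₀ * G.rel 0 1 0 w z₀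
        - G.rel 0 1 0 w x₀ * G.rel 0 1 0 w y₀ * G.rel 0 1 0 w z₀ := by
      intro w
      have hyx' : G.typ y₀ x₀ = 2 := typ_eq_two'.2 hxy.symm
      have hxy' : G.typ x₀ y₀ = 2 := typ_eq_two'.2 hxy
      have hxz' : G.typ x₀ z₀ = 2 := by rw [typ_comm]; exact hzx
      have hyz' : G.typ y₀ z₀ = 2 := by rw [typ_comm]; exact hzy
      simp only [Finset.mem_insert, Finset.mem_singleton, forall_eq_or_imp, forall_eq, rel_apply]
      by_cases w1 : w = x₀
      · subst w1
        simp [typ_self, hxy', hxz', (typ_eq_two.1 hxy').1, (typ_eq_two.1 hxz').1]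
      by_cases w2 : w = y₀
      · subst w2
        simp [typ_self, hyx', hyz', (typ_eq_two.1 hyx').1, (typ_eq_two.1 hyz').1]
      by_cases w3 : w = z₀
      · subst w3
        simp [typ_self, hzx, hzy, (typ_eq_two.1 hzx).1, (typ_eq_two.1 hzy).1]
      rw [if_neg w1, if_neg w2, if_neg w3]
      rw [← typ_eq_zero (G := G)] at w1 w2 w3
      revert w1 w2 w3
      generalize G.typ w x₀ = i
      generalize G.typ w y₀ = j
      generalize G.typ w z₀ = l
      rcases fin_three_cases i with rfl | rfl | rfl <;>
      rcases fin_three_cases j with rfl | rfl | rfl <;>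
      rcases fin_three_cases l with rfl | rfl | rfl <;> norm_num [one_ne_two_fin]
    have hk : ∀ x, ∑ w, G.rel 0 1 0 w x = k := fun x => by
      rw [← h.reg x]; exact Finset.sum_congr rfl fun v _ => rel_comm _ _ _ _ _
    rw [Finset.sum_congr rfl fun w _ => hB w]
    simp only [Finset.sum_add_distrib, Finset.sum_sub_distrib, hk, h.sum_adj_adj, hc]
    rw [rel_nonadj _ _ _ hxy, rel_comm _ _ _ x₀ z₀, rel_comm _ _ _ y₀ z₀, rel_apply, rel_apply,
      hzx, hzy]
    simp
    ring
  have hcc : f 2 2 2 = c' := hc.symm.trans hc'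
  rw [hL2, hcc, hk', hm'] at e1
  rw [hcc, hk', hm'] at e2
  rw [hL3, hcard, hc', hcc, hk', hm'] at e3
  rw [hcard, hc', hk', hm'] at e4
  rw [hk', hm'] at hpar
  rw [hk'] at hk2
  rw [hk', hm'] at hmk
  rw [hm'] at hm
  rw [hcc] at hc0
  refine triFree_arith (k := k') (m := m') (c := c') (d := d') (n := Fintype.card V)
    ?_ ?_ ?_ (by exact_mod_cast hk2) (by exact_mod_cast hm) (by exact_mod_cast hmk)
    (by have : c' ≠ 0 := by exact_mod_cast hc0
        omega) ?_ ?_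
  all_goals
    refine (Int.cast_inj (α := ℝ)).1 ?_
    push_cast at *
    linarith

end TriangleFree

end SimpleGraph

namespace SimpleGraph

section Homogeneous

variable {V : Type*} [Fintype V] [DecidableEq V] {G : SimpleGraph V} {k l m : ℝ}

theorem prod_sel_eq_one {s : ℕ} {x : Fin s → V} {v : V} (h : ∀ i, G.Adj v (x i)) :
    ∏ i, sel 0 1 0 (G.typ v (x i)) = 1 :=
  Finset.prod_eq_one fun i _ => by simp [typ_eq_one.2 (h i)]

theorem prod_sel_eq_zero {s : ℕ} {x : Fin s → V} {v : V} (h : ¬ ∀ i, G.Adj v (x i)) :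
    ∏ i, sel 0 1 0 (G.typ v (x i)) = 0 := by
  push Not at h
  obtain ⟨i, hi⟩ := h
  refine Finset.prod_eq_zero (Finset.mem_univ i) ?_
  rcases typ_cases (G := G) v (x i) with h | h | h
  · simp [h.2]
  · exact absurd h.1 hi
  · simp [h.2]

theorem Cluster.isTupleRegular (hc : G.Cluster) (h : G.Reg k) (t : ℕ) : G.IsTupleRegular t := by
  refine isTupleRegular_of_sum fun s _ x y hx hxy => ?_
  have hy : y.Injective := fun i j hij => hx <| by
    rw [← typ_eq_zero (G := G)] at hij ⊢
    rw [hxy, hij]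
  rcases Nat.eq_zero_or_pos s with rfl | hs
  · simp
  have key : ∀ z : Fin s → V, z.Injective → (∀ i j, i ≠ j → G.Adj (z i) (z j)) →
      ∑ v, ∏ i, sel 0 1 0 (G.typ v (z i)) = k + 1 - s := by
    intro z hz hcl
    have h1 : ∀ v, ∏ i, sel 0 1 0 (G.typ v (z i)) =
        G.rel 0 1 0 v (z ⟨0, hs⟩) + (if v = z ⟨0, hs⟩ then 1 else 0)
        - ∑ i, if v = z i then 1 else 0 := by
      intro v
      by_cases hv : ∃ i, v = z i
      · obtain ⟨i, rfl⟩ := hv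
        rw [prod_sel_eq_zero fun h => (h i).ne rfl]
        simp only [hz.eq_iff, Finset.sum_ite_eq, Finset.mem_univ, if_true]
        by_cases hi : i = ⟨0, hs⟩
        · simp [hi, rel_self]
        · simp [hi, rel_adj _ _ _ (hcl i _ hi)]
      · push Not at hv
        simp only [hv, if_false, Finset.sum_const_zero, sub_zero, add_zero]
        by_cases h0 : G.Adj v (z ⟨0, hs⟩)
        · rw [prod_sel_eq_one, rel_adj _ _ _ h0]
          intro i
          by_cases hi : i = ⟨0, hs⟩
          · rw [hi]; exact h0
          · exact hc h0 (hcl _ i (Ne.symm hi)) (hv i)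
        · rw [prod_sel_eq_zero fun h => h0 (h _), rel_nonadj _ _ _ (compl_of_not_adj (hv _) h0)]
    have hk : ∑ v, G.rel 0 1 0 v (z ⟨0, hs⟩) = k := by
      rw [← h (z ⟨0, hs⟩)]; exact Finset.sum_congr rfl fun v _ => rel_comm _ _ _ _ _
    rw [Finset.sum_congr rfl fun v _ => h1 v, Finset.sum_sub_distrib, Finset.sum_add_distrib, hk,
      Finset.sum_comm]
    simp
  by_cases hcl : ∀ i j, i ≠ j → G.Adj (x i) (x j)
  · rw [key x hx hcl, key y hy fun i j hij => by
      have := hcl i j hij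
      rw [← typ_eq_one] at this ⊢
      rwa [← hxy]]
  · push Not at hcl
    obtain ⟨i, j, hij, hn⟩ := hcl
    have hn' : ¬ G.Adj (y i) (y j) := by rwa [← typ_eq_one, ← hxy, typ_eq_one]
    rw [Finset.sum_eq_zero fun v _ => prod_sel_eq_zero fun h =>
        hn (hc (h i).symm (h j) (hx.ne hij)),
      Finset.sum_eq_zero fun v _ => prod_sel_eq_zero fun h =>
        hn' (hc (h i).symm (h j) (hy.ne hij))]

theorem sum_rel_zero_one_zero (x : V) (S : Finset V) (hS : ∀ v ∈ S, G.Adj x v) :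
    (S.card : ℝ) ≤ ∑ v, G.rel 0 1 0 x v := by
  calc (S.card : ℝ) = ∑ v ∈ S, G.rel 0 1 0 x v := by
        rw [Finset.sum_congr rfl fun v hv => rel_adj _ _ _ (hS v hv)]; simp
    _ ≤ _ := Finset.sum_le_sum_of_subset_of_nonneg (Finset.subset_univ _) fun v _ _ => by
        rw [rel_apply]
        rcases fin_three_cases (G.typ x v) with h | h | h <;> simp [h]

theorem SR.isTupleRegular_of_valency_two (h : G.SR 2 l m) (t : ℕ) : G.IsTupleRegular t := by
  refine isTupleRegular_of_sum fun s _ x y hx hxy => ?_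
  have hy : y.Injective := fun i j hij => hx <| by
    rw [← typ_eq_zero (G := G)] at hij ⊢
    rw [hxy, hij]
  rcases Nat.lt_or_ge 2 s with hs | hs
  · have key : ∀ z : Fin s → V, z.Injective → ∑ v, ∏ i, sel 0 1 0 (G.typ v (z i)) = 0 := by
      refine fun z hz => Finset.sum_eq_zero fun v _ => prod_sel_eq_zero fun hv => ?_
      have := sum_rel_zero_one_zero v (Finset.univ.image z) (by simpa using hv)
      rw [h.reg v, Finset.card_image_of_injective _ hz, Finset.card_univ, Fintype.card_fin] at this
      have : s ≤ 2 := by exact_mod_cast this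
      omega
    rw [key x hx, key y hy]
  · exact h.isTupleRegular.sum_prod_eq (by simpa using hs) hx hxy

theorem SR.lattice_triangle (h : G.SR 4 1 2) (hn : Fintype.card V = 9) {a b c : V}
    (hab : G.Adj a b) (hac : G.Adj a c) (hbc : G.Adj b c) (w : V) :
    G.rel (-1) 1 0 w a + G.rel (-1) 1 0 w b + G.rel (-1) 1 0 w c = 1 := by
  have hsum : ∀ x, ∑ w, G.rel (-1) 1 0 w x = 3 := by
    intro x
    rw [Finset.sum_congr rfl fun v _ => rel_comm (-1) 1 0 v x, h.reg.sum_rel]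
    norm_num
  have hprod : ∀ x y, ∑ w, G.rel (-1) 1 0 w x * G.rel (-1) 1 0 w y =
      (G.rel (-1) 1 0 * G.rel (-1) 1 0) x y := by
    intro x y
    rw [Matrix.mul_apply]
    exact Finset.sum_congr rfl fun v _ => by rw [rel_comm (-1) 1 0 v x]
  have hself : ∀ x, ∑ w, G.rel (-1) 1 0 w x * G.rel (-1) 1 0 w x = 5 := by
    intro x
    rw [hprod, h.mul_rel, rel_self]
    norm_num
  have hadj : ∀ x y, G.Adj x y → ∑ w, G.rel (-1) 1 0 w x * G.rel (-1) 1 0 w y = -1 := by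
    intro x y hxy
    rw [hprod, h.mul_rel, rel_adj _ _ _ hxy]
    norm_num
  have h0 : ∑ w, (G.rel (-1) 1 0 w a + G.rel (-1) 1 0 w b + G.rel (-1) 1 0 w c - 1) ^ 2 = 0 := by
    calc _ = ∑ w, G.rel (-1) 1 0 w a * G.rel (-1) 1 0 w a +
          ∑ w, G.rel (-1) 1 0 w b * G.rel (-1) 1 0 w b +
          ∑ w, G.rel (-1) 1 0 w c * G.rel (-1) 1 0 w c +
          2 * ∑ w, G.rel (-1) 1 0 w a * G.rel (-1) 1 0 w b +
          2 * ∑ w, G.rel (-1) 1 0 w a * G.rel (-1) 1 0 w c +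
          2 * ∑ w, G.rel (-1) 1 0 w b * G.rel (-1) 1 0 w c +
          (-2) * ∑ w, G.rel (-1) 1 0 w a + (-2) * ∑ w, G.rel (-1) 1 0 w b +
          (-2) * ∑ w, G.rel (-1) 1 0 w c + ∑ w : V, (1 : ℝ) := by
          simp only [Finset.mul_sum, ← Finset.sum_add_distrib]
          exact Finset.sum_congr rfl fun w _ => by ring
      _ = 0 := by
          rw [hself, hself, hself, hadj _ _ hab, hadj _ _ hac, hadj _ _ hbc, hsum, hsum, hsum]
          simp [hn]
          norm_num
  have := (Finset.sum_eq_zero_iff_of_nonneg fun w _ => sq_nonneg _).1 h0 w (Finset.mem_univ w)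
  linarith [pow_eq_zero_iff (two_ne_zero) |>.1 this]

theorem SR.card_common_le (h : G.SR k l m) {v w : V} (S : Finset V)
    (hv : ∀ u ∈ S, G.Adj v u) (hw : ∀ u ∈ S, G.Adj w u) :
    (S.card : ℝ) ≤ G.rel k l m v w := by
  rw [← h.sum_adj_adj]
  calc (S.card : ℝ) = ∑ u ∈ S, G.rel 0 1 0 u v * G.rel 0 1 0 u w := by
        rw [Finset.sum_congr rfl fun u hu => by
          rw [rel_adj _ _ _ (hv u hu).symm, rel_adj _ _ _ (hw u hu).symm]]
        simp
    _ ≤ _ := Finset.sum_le_sum_of_subset_of_nonneg (Finset.subset_univ _) fun u _ _ => by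
        rw [rel_apply, rel_apply]
        rcases fin_three_cases (G.typ u v) with h | h | h <;>
        rcases fin_three_cases (G.typ u w) with h' | h' | h' <;> simp [h, h']

theorem SR.exists_common_nbr (h : G.SR k l m) {v w : V} (hvw : G.rel k l m v w ≠ 0) :
    ∃ u, G.Adj v u ∧ G.Adj w u := by
  rw [← h.sum_adj_adj] at hvw
  obtain ⟨u, -, hu⟩ := Finset.exists_ne_zero_of_sum_ne_zero hvw
  have hAdj : ∀ x, G.rel 0 1 0 u x ≠ 0 → G.Adj u x := by
    intro x hx
    rcases typ_cases (G := G) u x with h1 | h1 | h1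
    · simp [rel_apply, h1.2] at hx
    · exact h1.1
    · simp [rel_apply, h1.2] at hx
  exact ⟨u, (hAdj _ (left_ne_zero_of_mul hu)).symm, (hAdj _ (right_ne_zero_of_mul hu)).symm⟩

theorem SR.lattice_exists_common (h : G.SR 4 1 2) (hn : Fintype.card V = 9) {s : ℕ} (hs : 2 < s)
    {x y : Fin s → V} (hx : x.Injective) (hxy : ∀ i j, G.typ (x i) (x j) = G.typ (y i) (y j))
    (hz : ∃ z, ∀ i, G.Adj z (x i)) : ∃ z, ∀ i, G.Adj z (y i) := by
  obtain ⟨z, hz⟩ := hz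
  have hone : ∀ u v w, G.Adj z u → G.Adj z v → G.Adj z w → G.Adj u v → G.Adj u w → v = w := by
    intro u v w hu hv hw huv huw
    by_contra hne
    have := h.card_common_le (v := z) (w := u) {v, w} (by simp [hv, hw]) (by simp [huv, huw])
    rw [Finset.card_pair hne, rel_adj _ _ _ hu] at this
    norm_num at this
  obtain ⟨i, j, hij⟩ : ∃ i j, G.Adj (x i) (x j) := by
    by_contra! hno
    have hmate : ∀ i, ∃ u, G.Adj z u ∧ G.Adj (x i) u := fun i =>
      h.exists_common_nbr (by rw [rel_adj _ _ _ (hz i)]; norm_num)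
    choose u hzu hxu using hmate
    let e : Fin 3 → Fin s := fun i => ⟨i, by omega⟩
    have he : Function.Injective e := fun i j hij => by
      simpa [e, Fin.ext_iff] using hij
    have hu_inj : Function.Injective u := by
      intro i j hij
      refine hx (hone (u i) (x i) (x j) (hzu i) (hz i) (hz j) (hxu i).symm ?_)
      rw [hij]; exact (hxu j).symm
    have hdisj : ∀ i j, x i ≠ u j := fun i j hij => hno j i (hij ▸ hxu j)
    have := sum_rel_zero_one_zero z (Finset.univ.image x ∪ Finset.univ.image u) (by
      intro v hv
      simp only [Finset.mem_union, Finset.mem_image, Finset.mem_univ, true_and] at hv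
      rcases hv with ⟨i, rfl⟩ | ⟨i, rfl⟩
      exacts [hz i, hzu i])
    rw [h.reg z, Finset.card_union_of_disjoint, Finset.card_image_of_injective _ hx,
      Finset.card_image_of_injective _ hu_inj, Finset.card_univ, Fintype.card_fin] at this
    · have : s + s ≤ 4 := by exact_mod_cast this
      omega
    · rw [Finset.disjoint_left]
      simp only [Finset.mem_image, Finset.mem_univ, true_and, not_exists]
      rintro _ ⟨i, rfl⟩ j hj
      exact hdisj i j hj.symm
  have hyij : G.Adj (y i) (y j) := by rwa [← typ_eq_one, ← hxy, typ_eq_one]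
  obtain ⟨z', hz1, hz2⟩ := h.exists_common_nbr (v := y i) (w := y j)
    (by rw [rel_adj _ _ _ hyij]; norm_num)
  refine ⟨z', fun r => ?_⟩
  by_cases hri : r = i
  · rw [hri]; exact hz1.symm
  by_cases hrj : r = j
  · rw [hrj]; exact hz2.symm
  have h1 : G.typ (y r) (y i) = 2 := by
    rw [← hxy, typ_eq_two]
    exact ⟨hx.ne hri, fun h => hrj (hx (hone (x i) (x r) (x j) (hz i) (hz r) (hz j) h.symm hij))⟩
  have h2 : G.typ (y r) (y j) = 2 := by
    rw [← hxy, typ_eq_two]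
    exact ⟨hx.ne hrj, fun h => hri (hx (hone (x j) (x r) (x i) (hz j) (hz r) (hz i) h.symm
      hij.symm))⟩
  have key := h.lattice_triangle hn hyij hz1 hz2 (y r)
  rw [rel_apply, rel_apply, rel_apply, h1, h2] at key
  rcases typ_cases (G := G) (y r) z' with h3 | h3 | h3
  · rw [h3.2] at key; norm_num at key
  · exact h3.1.symm
  · rw [h3.2] at key; norm_num at key

theorem SR.lattice_isTupleRegular (h : G.SR 4 1 2) (hn : Fintype.card V = 9) (t : ℕ) :
    G.IsTupleRegular t := by
  refine isTupleRegular_of_sum fun s _ x y hx hxy => ?_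
  have hy : y.Injective := fun i j hij => hx <| by
    rw [← typ_eq_zero (G := G)] at hij ⊢
    rw [hxy, hij]
  rcases Nat.lt_or_ge 2 s with hs | hs
  · have key : ∀ z : Fin s → V, z.Injective → (∃ v, ∀ i, G.Adj v (z i)) →
        ∑ v, ∏ i, sel 0 1 0 (G.typ v (z i)) = 1 := by
      rintro z hz ⟨v, hv⟩
      rw [Finset.sum_eq_single v, prod_sel_eq_one hv]
      · intro w _ hwv
        refine prod_sel_eq_zero fun hw => ?_
        have := h.card_common_le (v := v) (w := w) (Finset.univ.image z) (by simpa using hv)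
          (by simpa using hw)
        rw [Finset.card_image_of_injective _ hz, Finset.card_univ, Fintype.card_fin] at this
        have h3 : (3 : ℝ) ≤ s := by exact_mod_cast hs
        rcases typ_cases (G := G) v w with h1 | h1 | h1
        · exact hwv h1.1.symm
        · rw [rel_adj _ _ _ h1.1] at this; linarith
        · rw [rel_nonadj _ _ _ h1.1] at this; linarith
      · simp
    by_cases hex : ∃ v, ∀ i, G.Adj v (x i)
    · rw [key x hx hex, key y hy (h.lattice_exists_common hn hs hx hxy hex)]
    · have hex' : ¬ ∃ v, ∀ i, G.Adj v (y i) := fun h' =>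
        hex (h.lattice_exists_common hn hs hy (fun i j => (hxy i j).symm) h')
      rw [Finset.sum_eq_zero fun v _ => prod_sel_eq_zero (not_exists.1 hex v),
        Finset.sum_eq_zero fun v _ => prod_sel_eq_zero (not_exists.1 hex' v)]
  · exact h.isTupleRegular.sum_prod_eq (by simpa using hs) hx hxy

end Homogeneous

end SimpleGraph

namespace SimpleGraph

open Matrix

section Eigenspace

variable {V : Type*} [Fintype V] [DecidableEq V] {G : SimpleGraph V} {e a b : ℝ}

/-- `G.rel e a b` is an orthogonal projection killing the constants and distinguishing adjacent
from nonadjacent pairs. -/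
structure Eig (G : SimpleGraph V) (e a b : ℝ) : Prop where
  idem : G.rel e a b * G.rel e a b = G.rel e a b
  row : ∀ x, ∑ v, G.rel e a b x v = 0
  ne : a ≠ b

namespace Eig

theorem compl (h : G.Eig e a b) : Gᶜ.Eig e b a where
  idem := by rw [rel_compl]; exact h.idem
  row := by rw [rel_compl]; exact h.row
  ne := h.ne.symm

theorem row' (h : G.Eig e a b) (x : V) : ∑ v, G.rel e a b v x = 0 := by
  rw [← h.row x]; exact Finset.sum_congr rfl fun v _ => rel_comm _ _ _ _ _

theorem sum_mul (h : G.Eig e a b) (x y : V) :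
    ∑ v, G.rel e a b x v * G.rel e a b y v = G.rel e a b x y := by
  conv_rhs => rw [← h.idem, Matrix.mul_apply]
  exact Finset.sum_congr rfl fun v _ => by rw [rel_comm e a b y v]

theorem mul_rel_const (h : G.Eig e a b) (c : ℝ) : G.rel e a b * G.rel c c c = 0 := by
  ext x y
  simp only [Matrix.mul_apply, rel_const, ← Finset.sum_mul, h.row, zero_mul, Matrix.zero_apply]

theorem const_mul_rel (h : G.Eig e a b) (c : ℝ) : G.rel c c c * G.rel e a b = 0 := by
  ext x y
  simp only [Matrix.mul_apply, rel_const, ← Finset.mul_sum, h.row', mul_zero, Matrix.zero_apply]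

theorem dual (h : G.Eig e a b) : G.Eig (1 - 1 / Fintype.card V - e) (-(1 / Fintype.card V) - a)
    (-(1 / Fintype.card V) - b) := by
  rcases isEmpty_or_nonempty V with hV | hV
  · exact ⟨by ext x; exact isEmptyElim x, fun x => isEmptyElim x, fun h' => h.ne (by linarith)⟩
  have hn : (Fintype.card V : ℝ) ≠ 0 := Nat.cast_ne_zero.2 Fintype.card_ne_zero
  set c : ℝ := 1 / Fintype.card V
  have e1 : G.rel (1 - c - e) (-c - a) (-c - b) = 1 - G.rel c c c - G.rel e a b := by
    rw [← rel_one_zero_zero (G := G), rel_sub, rel_sub]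
    congr 1 <;> ring
  have e2 : G.rel c c c * G.rel c c c = G.rel c c c := by
    ext x y
    simp only [Matrix.mul_apply, rel_const, Finset.sum_const, nsmul_eq_mul, c]
    simp only [Finset.card_univ]
    field_simp
  refine ⟨?_, fun x => ?_, fun h' => h.ne (by linarith)⟩
  · rw [e1]
    simp only [sub_mul, mul_sub, one_mul, mul_one, e2, h.mul_rel_const, h.const_mul_rel, h.idem]
    abel
  · rw [e1]
    simp only [Matrix.sub_apply, Finset.sum_sub_distrib, h.row, rel_const, Matrix.one_apply]
    simp only [Finset.sum_ite_eq, Finset.mem_univ, if_true, Finset.sum_const, nsmul_eq_mul, c]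
    simp only [Finset.card_univ]
    field_simp
    ring

theorem ne_zero (h : G.Eig e a b) (hp : G.Prim) : e ≠ 0 := by
  rintro rfl
  obtain ⟨x, y, z, hxy, hyz, hxz⟩ := hp.exists_path
  have h0 := h.sum_mul x x
  rw [rel_self] at h0
  have h1 := (Finset.sum_eq_zero_iff_of_nonneg fun v _ => mul_self_nonneg _).1 h0
  have ha := h1 y (Finset.mem_univ _)
  have hb := h1 z (Finset.mem_univ _)
  rw [mul_self_eq_zero] at ha hb
  rw [rel_adj _ _ _ hxy] at ha
  rw [rel_nonadj _ _ _ hxz] at hb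
  exact h.ne (ha.trans hb.symm)

theorem mulVec_rel (h : G.Eig e a b) (x : V) : G.rel e a b *ᵥ G.rel e a b x = G.rel e a b x := by
  ext y
  rw [rel_comm e a b x y, ← h.sum_mul]
  rfl

theorem mulVec_one (h : G.Eig e a b) : G.rel e a b *ᵥ 1 = 0 := by
  ext y
  simpa [Matrix.mulVec, dotProduct] using h.row y

theorem adj_eq (h : G.Eig e a b) (x v : V) : G.rel 0 1 0 x v =
    (a - b)⁻¹ * (G.rel e a b x v - (e - b) * (Pi.single x 1 : V → ℝ) v - b) := by
  have := sub_ne_zero.2 h.ne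
  rcases typ_cases (G := G) x v with h1 | h1 | h1
  · rw [← h1.1]; simp
  · rw [rel_adj _ _ _ h1.1, rel_adj _ _ _ h1.1, Pi.single_eq_of_ne h1.1.ne.symm]
    field_simp
    ring
  · rw [rel_nonadj _ _ _ h1.1, rel_nonadj _ _ _ h1.1, Pi.single_eq_of_ne h1.1.ne.symm]
    ring

end Eig

/-- The projection `G.rel e a b` followed by the projection off its row at `x`. -/
noncomputable def proj (G : SimpleGraph V) (e a b : ℝ) (x : V) : Matrix V V ℝ :=
  G.rel e a b - e⁻¹ • vecMulVec (G.rel e a b x) (G.rel e a b x)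

theorem proj_apply (x z w : V) : G.proj e a b x z w =
    G.rel e a b z w - e⁻¹ * (G.rel e a b x z * G.rel e a b x w) := by
  simp [proj, vecMulVec_apply]

theorem proj_transpose (x : V) : (G.proj e a b x)ᵀ = G.proj e a b x := by
  ext z w
  rw [transpose_apply, proj_apply, proj_apply, rel_comm e a b w z]
  ring

theorem proj_compl (x : V) : Gᶜ.proj e b a x = G.proj e a b x := by
  simp only [proj, rel_compl]

variable (h : G.Eig e a b) (he : e ≠ 0)
include h he

theorem Eig.rel_mul_proj (x : V) : G.rel e a b * G.proj e a b x = G.proj e a b x := by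
  rw [proj, mul_sub, h.idem, Matrix.mul_smul, mul_vecMulVec, h.mulVec_rel]

theorem Eig.proj_mulVec_rel (x : V) : G.proj e a b x *ᵥ G.rel e a b x = 0 := by
  ext z
  simp only [Matrix.mulVec, dotProduct, proj_apply, sub_mul, Finset.sum_sub_distrib, h.sum_mul]
  simp only [mul_assoc, ← Finset.mul_sum, h.sum_mul, rel_self]
  rw [rel_comm e a b z x]
  simp
  field_simp
  ring

theorem Eig.proj_mulVec_single (x : V) : G.proj e a b x *ᵥ Pi.single x 1 = 0 := by
  ext z
  rw [Matrix.mulVec_single_one]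
  simp only [col_apply, proj_apply, rel_self, Pi.zero_apply]
  rw [rel_comm e a b z x]
  field_simp
  ring

theorem Eig.proj_mulVec_one (x : V) : G.proj e a b x *ᵥ 1 = 0 := by
  ext z
  simp only [Matrix.mulVec, dotProduct, proj_apply, Pi.one_apply, mul_one,
    Finset.sum_sub_distrib, h.row, ← Finset.mul_sum]
  simp

theorem Eig.proj_mul_proj (x : V) : G.proj e a b x * G.proj e a b x = G.proj e a b x := by
  conv_lhs => rhs; rw [proj]
  rw [mul_sub, Matrix.mul_smul, mul_vecMulVec, h.proj_mulVec_rel he, zero_vecMulVec, smul_zero, sub_zero,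
    ← transpose_inj, transpose_mul, proj_transpose, rel_transpose, h.rel_mul_proj he]

theorem Eig.proj_mulVec_adj (x : V) : G.proj e a b x *ᵥ G.rel 0 1 0 x = 0 := by
  have : G.rel 0 1 0 x = (a - b)⁻¹ • (G.rel e a b x - (e - b) • Pi.single x 1 - b • 1) := by
    ext v
    rw [h.adj_eq]
    simp
  rw [this, mulVec_smul, mulVec_sub, mulVec_sub, mulVec_smul, mulVec_smul, h.proj_mulVec_rel he,
    h.proj_mulVec_single he, h.proj_mulVec_one he]
  simp

end Eigenspace

section RankTwo

variable {V : Type*} [Fintype V] [DecidableEq V]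

theorem mul_diagonal_mul_apply (P Q : Matrix V V ℝ) (d : V → ℝ) (z w : V) :
    (P * diagonal d * Q) z w = ∑ v, P z v * d v * Q v w := by
  simp only [Matrix.mul_apply (M := P * diagonal d), mul_diagonal]

theorem diagonal_mul_mul_diagonal_apply (P : Matrix V V ℝ) (c c' : V → ℝ) (z w : V) :
    (diagonal c * P * diagonal c') z w = c z * P z w * c' w := by
  rw [mul_diagonal, diagonal_mul]

/-- If two blocks of symmetric matrices agree up to scaling and a constant, and the columns of both
sum to zero, the constant vanishes. -/
theorem rank_two {P : Matrix V V ℝ} {c c' d : V → ℝ} {ε j : ℝ}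
    (h : ∀ z w, c z ≠ 0 → c' w ≠ 0 → (P * diagonal d * P) z w = ε * P z w + j)
    (hc : ∀ w, ∑ z, c z * P z w = 0) (hs : ∑ z, c z ≠ 0) :
    diagonal c * (P * diagonal d * P) * diagonal c' = ε • (diagonal c * P * diagonal c') := by
  ext z w
  rw [Matrix.smul_apply, smul_eq_mul, diagonal_mul_mul_diagonal_apply, diagonal_mul_mul_diagonal_apply]
  by_cases hz : c z = 0
  · simp [hz]
  by_cases hw : c' w = 0
  · simp [hw]
  have h1 : ∑ z, c z * (P * diagonal d * P) z w = 0 := by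
    calc _ = ∑ v, (∑ z, c z * P z v) * (d v * P v w) := by
          simp only [mul_diagonal_mul_apply, Finset.mul_sum, Finset.sum_mul]
          rw [Finset.sum_comm]
          exact Finset.sum_congr rfl fun v _ => Finset.sum_congr rfl fun z _ => by ring
      _ = 0 := by simp [hc]
  have h2 : ∑ z, c z * (P * diagonal d * P) z w = ε * ∑ z, c z * P z w + j * ∑ z, c z := by
    rw [Finset.mul_sum, Finset.mul_sum, ← Finset.sum_add_distrib]
    refine Finset.sum_congr rfl fun z _ => ?_
    by_cases hz : c z = 0
    · simp [hz]
    · rw [h z w hz hw]; ring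
  rw [h1, hc, mul_zero, zero_add, eq_comm, mul_eq_zero] at h2
  rw [h z w hz hw, h2.resolve_right hs]
  ring

end RankTwo

end SimpleGraph

namespace SimpleGraph

open Matrix

section OneVertex

variable {V : Type*} [Fintype V] [DecidableEq V] {G : SimpleGraph V} {e a b ε : ℝ}

/-- The compression to the range of `G.proj e a b x` of the projection onto the neighbours of `x`. -/
noncomputable def comp (G : SimpleGraph V) (e a b : ℝ) (x : V) : Matrix V V ℝ :=
  G.proj e a b x * diagonal (G.rel 0 1 0 x) * G.proj e a b x

/-- A nonzero vector fixed by `M` cannot vanish off the support of `c`. -/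
def NoFix (M : Matrix V V ℝ) (c : V → ℝ) : Prop :=
  ∀ ψ : V → ℝ, M *ᵥ ψ = ψ → (∀ v, c v = 0 → ψ v = 0) → ψ = 0

/-- The block of `comp` between neighbours and non-neighbours is `ε` times that of `proj`. -/
def OffBlock (G : SimpleGraph V) (e a b ε : ℝ) : Prop := ∀ x,
  diagonal (G.rel 0 1 0 x) * G.comp e a b x * diagonal (G.rel 0 0 1 x) =
    ε • (diagonal (G.rel 0 1 0 x) * G.proj e a b x * diagonal (G.rel 0 0 1 x))

theorem comp_transpose (x : V) : (G.comp e a b x)ᵀ = G.comp e a b x := by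
  simp only [comp, transpose_mul, proj_transpose, diagonal_transpose, Matrix.mul_assoc]

theorem sum_symm_mul_eq_zero {P : Matrix V V ℝ} (hP : Pᵀ = P) {c : V → ℝ} (h : P *ᵥ c = 0) (w : V) :
    ∑ z, c z * P z w = 0 := by
  have := congrFun h w
  rw [Pi.zero_apply] at this
  rw [← this]
  refine Finset.sum_congr rfl fun z _ => ?_
  rw [← hP, transpose_apply, hP, mul_comm]

theorem Prim.sum_rel_ne_zero (hp : G.Prim) (h2 : G.IsTupleRegular 2) (x : V) :
    ∑ z, G.rel 0 1 0 x z ≠ 0 := by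
  obtain ⟨v, hv⟩ := hp.exists_adj h2 x
  intro h0
  have h1 := (Finset.sum_eq_zero_iff_of_nonneg fun z _ => ?_).1 h0 v (Finset.mem_univ _)
  · rw [rel_adj _ _ _ hv] at h1
    exact one_ne_zero h1
  · rw [rel_apply]
    rcases fin_three_cases (G.typ x z) with h | h | h <;> rw [h] <;> simp

theorem exists_offBlock (h3 : G.IsTupleRegular 3) (hp : G.Prim) (h : G.Eig e a b) (he : e ≠ 0) :
    ∃ ε, G.OffBlock e a b ε := by
  obtain ⟨f, hf⟩ := h3.exists_typ_three le_rfl fun i j k => sel 0 1 0 i *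
    (sel e a b j - e⁻¹ * (a * sel e a b i)) * (sel e a b k - e⁻¹ * (b * sel e a b i))
  have hab := sub_ne_zero.2 h.ne
  refine ⟨(f 1 2 1 - f 1 2 2) / (a - b), fun x => rank_two
    (j := f 1 2 2 - (f 1 2 1 - f 1 2 2) / (a - b) * (b - e⁻¹ * (a * b))) ?_
    (sum_symm_mul_eq_zero (proj_transpose x) (h.proj_mulVec_adj he x))
    (hp.sum_rel_ne_zero (h3.mono (by norm_num)) x)⟩
  intro z w hz hw
  have hz' : G.typ x z = 1 := by
    rw [rel_apply] at hz
    rcases fin_three_cases (G.typ x z) with h | h | h <;> rw [h] at hz ⊢ <;> simp at hz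
  have hw' : G.typ x w = 2 := by
    rw [rel_apply] at hw
    rcases fin_three_cases (G.typ x w) with h | h | h <;> rw [h] at hw ⊢ <;> simp at hw
  have key : (G.proj e a b x * diagonal (G.rel 0 1 0 x) * G.proj e a b x) z w =
      f 1 2 (G.typ z w) := by
    rw [← hz', ← hw', ← hf, mul_diagonal_mul_apply]
    refine Finset.sum_congr rfl fun v _ => ?_
    rw [proj_apply, proj_apply, rel_comm _ _ _ z v, rel_comm _ _ _ x v, rel_comm _ _ _ x v]
    have e1 : G.rel e a b x z = a := by rw [rel_apply, hz', sel_one]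
    have e2 : G.rel e a b x w = b := by rw [rel_apply, hw', sel_two]
    rw [e1, e2]
    simp only [rel_apply]
    ring
  rw [key, proj_apply]
  have e1 : G.rel e a b x z = a := by rw [rel_apply, hz', sel_one]
  have e2 : G.rel e a b x w = b := by rw [rel_apply, hw', sel_two]
  rw [e1, e2]
  rcases typ_cases (G := G) z w with h1 | h1 | h1
  · rw [h1.1, hw'] at hz'
    exact absurd hz'.symm (by decide)
  · rw [h1.2, rel_adj _ _ _ h1.1]
    field_simp
    ring
  · rw [h1.2, rel_nonadj _ _ _ h1.1]
    ring

theorem diagonal_rel_add (x : V) :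
    diagonal (G.rel 0 1 0 x) + diagonal (G.rel 0 0 1 x) + diagonal (Pi.single x 1) = 1 := by
  rw [diagonal_add, diagonal_add, ← diagonal_one]
  congr 1
  ext v
  rcases typ_cases (G := G) x v with h1 | h1 | h1
  · rw [← h1.1]; simp
  · rw [rel_adj _ _ _ h1.1, rel_adj _ _ _ h1.1, Pi.single_eq_of_ne h1.1.ne.symm]; norm_num
  · rw [rel_nonadj _ _ _ h1.1, rel_nonadj _ _ _ h1.1, Pi.single_eq_of_ne h1.1.ne.symm]; norm_num

theorem mul_diagonal_single_mul {P Q : Matrix V V ℝ} {x : V} (h : P *ᵥ Pi.single x 1 = 0) :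
    P * diagonal (Pi.single x 1) * Q = 0 := by
  ext z w
  rw [mul_diagonal_mul_apply, Finset.sum_eq_single x]
  · have := congrFun h z
    rw [Matrix.mulVec_single_one, col_apply] at this
    simp [this]
  · intro v _ hv
    rw [Pi.single_eq_of_ne hv]
    ring
  · simp

variable (h : G.Eig e a b) (he : e ≠ 0)
include h he

theorem Eig.comp_compl (x : V) : Gᶜ.comp e b a x = G.proj e a b x - G.comp e a b x := by
  have h1 : G.proj e a b x * (diagonal (G.rel 0 1 0 x) + diagonal (G.rel 0 0 1 x) +
      diagonal (Pi.single x 1)) * G.proj e a b x = G.proj e a b x := by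
    rw [diagonal_rel_add, mul_one, h.proj_mul_proj he]
  rw [mul_add, mul_add, add_mul, add_mul, mul_diagonal_single_mul (h.proj_mulVec_single he x),
    add_zero] at h1
  rw [comp, comp, proj_compl, rel_compl, eq_sub_iff_add_eq, add_comm]
  exact h1

theorem Eig.proj_mul_comp (x : V) : G.proj e a b x * G.comp e a b x = G.comp e a b x := by
  simp only [comp, ← Matrix.mul_assoc, h.proj_mul_proj he]

theorem Eig.comp_mul_proj (x : V) : G.comp e a b x * G.proj e a b x = G.comp e a b x := by
  simp only [comp, Matrix.mul_assoc, h.proj_mul_proj he]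

theorem OffBlock.compl (ho : G.OffBlock e a b ε) : Gᶜ.OffBlock e b a (1 - ε) := by
  intro x
  have h1 := congrArg transpose (ho x)
  simp only [transpose_mul, transpose_smul, diagonal_transpose, proj_transpose, comp_transpose,
    ← Matrix.mul_assoc] at h1
  rw [h.comp_compl he, proj_compl, rel_compl, rel_compl, mul_sub, sub_mul, h1, sub_smul, one_smul]

theorem OffBlock.mul_eq_zero (ho : G.OffBlock e a b ε) (x : V) :
    G.comp e a b x * ((G.comp e a b x - ε • G.proj e a b x) * (G.comp e a b x - G.proj e a b x)) =
      0 := by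
  have h1 : G.comp e a b x * G.comp e a b x * Gᶜ.comp e b a x =
      ε • (G.comp e a b x * Gᶜ.comp e b a x) := by
    have h2 := congrArg (fun M => G.proj e a b x * M * G.proj e a b x) (ho x)
    simp only [Matrix.mul_smul, Matrix.smul_mul] at h2
    calc _ = G.proj e a b x * (diagonal (G.rel 0 1 0 x) * G.comp e a b x *
          diagonal (G.rel 0 0 1 x)) * G.proj e a b x := by
          conv_lhs =>
            rw [comp, comp, proj_compl, rel_compl]
          rw [comp]
          have := h.proj_mul_proj he x
          simp only [Matrix.mul_assoc]
          rw [← Matrix.mul_assoc (G.proj e a b x) (G.proj e a b x), this,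
            ← Matrix.mul_assoc (G.proj e a b x) (G.proj e a b x), this]
      _ = ε • (G.proj e a b x * (diagonal (G.rel 0 1 0 x) * G.proj e a b x *
          diagonal (G.rel 0 0 1 x)) * G.proj e a b x) := h2
      _ = _ := by
          rw [comp, comp, proj_compl, rel_compl]
          have := h.proj_mul_proj he x
          simp only [Matrix.mul_assoc]
          rw [← Matrix.mul_assoc (G.proj e a b x) (G.proj e a b x), this]
  rw [h.comp_compl he] at h1
  simp only [mul_sub, sub_mul, Matrix.smul_mul, Matrix.mul_smul, h.proj_mul_proj he,
    h.comp_mul_proj he, h.proj_mul_comp he, ← Matrix.mul_assoc] at h1 ⊢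
  rw [Matrix.mul_assoc _ _ (G.proj e a b x), h.comp_mul_proj he] at h1
  rw [← sub_eq_iff_eq_add.2 (sub_eq_iff_eq_add'.1 h1), smul_sub]
  abel

theorem Eig.fixed_of_proj {x : V} {ψ : V → ℝ} (hψ : G.proj e a b x *ᵥ ψ = ψ) :
    G.rel e a b *ᵥ ψ = ψ ∧ ψ x = 0 := by
  constructor
  · rw [← hψ, mulVec_mulVec, h.rel_mul_proj he]
  · rw [← hψ]
    simp only [Matrix.mulVec, dotProduct]
    refine Finset.sum_eq_zero fun v _ => ?_
    have := congrFun (h.proj_mulVec_single he x) v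
    rw [Matrix.mulVec_single_one, col_apply, Pi.zero_apply] at this
    rw [← proj_transpose, transpose_apply, this, zero_mul]

theorem NoFix.comp_mulVec {x : V} (hn : NoFix (G.rel e a b) (G.rel 0 0 1 x)) {ψ : V → ℝ}
    (hψ : G.proj e a b x *ᵥ ψ = ψ) (h0 : G.comp e a b x *ᵥ ψ = 0) : ψ = 0 := by
  obtain ⟨h1, h2⟩ := h.fixed_of_proj he hψ
  refine hn ψ h1 fun v hv => ?_
  have h4 : ∑ v, G.rel 0 1 0 x v * (ψ v * ψ v) = 0 := by
    have h5 : ψ ⬝ᵥ (G.comp e a b x *ᵥ ψ) = 0 := by rw [h0, dotProduct_zero]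
    rw [comp, Matrix.mul_assoc, ← mulVec_mulVec, ← mulVec_mulVec, hψ, dotProduct_mulVec,
      ← mulVec_transpose, proj_transpose, hψ] at h5
    refine Eq.trans ?_ h5
    simp only [dotProduct, mulVec_diagonal]
    exact Finset.sum_congr rfl fun v _ => by ring
  rw [Finset.sum_eq_zero_iff_of_nonneg] at h4
  · rcases typ_cases (G := G) x v with h6 | h6 | h6
    · rw [← h6.1, h2]
    · have := h4 v (Finset.mem_univ _)
      rw [rel_adj _ _ _ h6.1, one_mul, mul_self_eq_zero] at this
      exact this
    · rw [rel_nonadj _ _ _ h6.1] at hv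
      exact absurd hv one_ne_zero
  · intro v _
    refine mul_nonneg ?_ (mul_self_nonneg _)
    rw [rel_apply]
    rcases fin_three_cases (G.typ x v) with h | h | h <;> rw [h] <;> simp

theorem NoFix.eq_zero_of_comp_mul {x : V} (hn : NoFix (G.rel e a b) (G.rel 0 0 1 x))
    {M : Matrix V V ℝ} (hM : G.proj e a b x * M = M) (h0 : G.comp e a b x * M = 0) : M = 0 := by
  ext i j
  have := hn.comp_mulVec h he (ψ := M.col j)
    (by rw [← Matrix.mulVec_single_one, mulVec_mulVec, hM])
    (by rw [← Matrix.mulVec_single_one, mulVec_mulVec, h0, zero_mulVec])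
  exact congrFun this i

theorem OffBlock.of_noFix_compl (ho : G.OffBlock e a b ε) {x : V}
    (hn : NoFix (G.rel e a b) (G.rel 0 0 1 x)) :
    (G.comp e a b x - ε • G.proj e a b x) * (G.comp e a b x - G.proj e a b x) = 0 := by
  refine hn.eq_zero_of_comp_mul h he ?_ (ho.mul_eq_zero h he x)
  rw [← Matrix.mul_assoc, mul_sub (G.proj e a b x), Matrix.mul_smul, h.proj_mul_comp he,
    h.proj_mul_proj he]

theorem OffBlock.of_noFix (ho : G.OffBlock e a b ε) {x : V}
    (hn : NoFix (G.rel e a b) (G.rel 0 1 0 x)) :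
    (G.comp e a b x - ε • G.proj e a b x) * G.comp e a b x = 0 := by
  have h1 := (ho.compl h he).of_noFix_compl h.compl he (x := x) (by rwa [rel_compl, rel_compl])
  rw [h.comp_compl he, proj_compl] at h1
  rw [← h1]
  have : G.proj e a b x - G.comp e a b x - (1 - ε) • G.proj e a b x =
      -(G.comp e a b x - ε • G.proj e a b x) := by
    rw [sub_smul, one_smul]; abel
  rw [this]
  have : G.proj e a b x - G.comp e a b x - G.proj e a b x = - G.comp e a b x := by abel
  rw [this, neg_mul_neg]

omit he h in
theorem exists_trace_proj (h1 : G.IsTupleRegular 1) : ∃ c, ∀ x, trace (G.proj e a b x) = c := by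
  obtain ⟨c, hc⟩ := h1.exists_typ_one le_rfl fun i => e - e⁻¹ * (sel e a b i * sel e a b i)
  refine ⟨c, fun x => ?_⟩
  rw [← hc x, trace]
  refine Finset.sum_congr rfl fun v _ => ?_
  rw [diag_apply, proj_apply, rel_self, rel_comm, rel_apply]

theorem Eig.exists_trace_comp (h1 : G.IsTupleRegular 1) : ∃ c, ∀ x, trace (G.comp e a b x) = c := by
  obtain ⟨c, hc⟩ := h1.exists_typ_one le_rfl fun i =>
    (e - e⁻¹ * (sel e a b i * sel e a b i)) * sel 0 1 0 i
  refine ⟨c, fun x => ?_⟩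
  rw [← hc x, comp, trace_mul_comm, ← Matrix.mul_assoc, h.proj_mul_proj he, trace]
  refine Finset.sum_congr rfl fun v _ => ?_
  rw [diag_apply, mul_diagonal, proj_apply, rel_self, rel_comm e a b, rel_comm 0 1 0, rel_apply,
    rel_apply]

theorem Eig.exists_trace_comp_sq (h2 : G.IsTupleRegular 2) :
    ∃ c, ∀ x, trace (G.comp e a b x * G.comp e a b x) = c := by
  obtain ⟨f, hf⟩ := h2.exists_typ_two le_rfl fun i j => sel 0 1 0 i *
    (sel e a b j - e⁻¹ * (a * a)) ^ 2
  obtain ⟨c, hc⟩ := h2.exists_typ_one (by norm_num) fun i => sel 0 1 0 i * f i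
  refine ⟨c, fun x => ?_⟩
  have e1 : trace (G.comp e a b x * G.comp e a b x) = trace (G.proj e a b x *
      diagonal (G.rel 0 1 0 x) * (G.proj e a b x * diagonal (G.rel 0 1 0 x))) := by
    rw [comp, ← Matrix.mul_assoc, trace_mul_comm]
    have := h.proj_mul_proj he x
    simp only [← Matrix.mul_assoc, this]
    rw [Matrix.mul_assoc _ (G.proj e a b x) (G.proj e a b x), this]
  rw [e1, ← hc x, trace]
  refine Finset.sum_congr rfl fun z _ => ?_
  rw [diag_apply, Matrix.mul_apply]
  simp only [mul_diagonal]
  rcases typ_cases (G := G) z x with h1 | h1 | h1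
  · rw [h1.1]; simp [typ_self]
  · rw [h1.2, sel_one, one_mul, ← h1.2, typ_comm, ← hf]
    refine Finset.sum_congr rfl fun v _ => ?_
    rw [rel_adj _ _ _ h1.1.symm, rel_comm, ← rel_apply, ← rel_apply, rel_comm e a b v z]
    rcases typ_cases (G := G) v x with h2 | h2 | h2
    · rw [h2.1]; simp
    · rw [rel_adj _ _ _ h2.1, ← proj_transpose, transpose_apply, proj_transpose, proj_apply,
        rel_adj _ _ _ h1.1.symm, rel_adj _ _ _ h2.1.symm, rel_comm e a b v z]
      ring
    · rw [rel_nonadj _ _ _ h2.1]; simp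
  · rw [h1.2, rel_nonadj _ _ _ h1.1.symm]; simp

/-- The compressions are multiples of the projections, unless every vertex carries a fixed vector
of `G.rel e a b` supported on its neighbours, or every vertex one on its non-neighbours. -/
theorem Eig.trichotomy (h3 : G.IsTupleRegular 3) (hp : G.Prim) :
    (∃ ε : ℝ, ∀ x, G.comp e a b x = ε • G.proj e a b x) ∨
    (∀ x, ¬ NoFix (G.rel e a b) (G.rel 0 1 0 x)) ∨
    ∀ x, ¬ NoFix (G.rel e a b) (G.rel 0 0 1 x) := by
  by_contra! hcon
  obtain ⟨hS, ⟨y, hy⟩, x, hx⟩ := hcon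
  obtain ⟨ε, ho⟩ := exists_offBlock h3 hp h he
  obtain ⟨t0, ht0⟩ := exists_trace_proj (e := e) (a := a) (b := b) (h3.mono (by norm_num))
  obtain ⟨t1, ht1⟩ := h.exists_trace_comp he (h3.mono (by norm_num))
  obtain ⟨t2, ht2⟩ := h.exists_trace_comp_sq he (h3.mono (by norm_num))
  have e1 := congrArg trace (ho.of_noFix_compl h he hx)
  have e2 := congrArg trace (ho.of_noFix h he hy)
  simp only [mul_sub, sub_mul, Matrix.smul_mul, h.proj_mul_proj he, h.comp_mul_proj he,
    h.proj_mul_comp he, trace_sub, trace_smul, ht0, ht1, ht2, trace_zero, smul_eq_mul] at e1 e2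
  obtain ⟨z, hz⟩ := hS ε
  refine hz (sub_eq_zero.1 (eq_zero_of_trace_sq ?_ ?_))
  · rw [transpose_sub, transpose_smul, comp_transpose, proj_transpose]
  · simp only [mul_sub, sub_mul, Matrix.smul_mul, Matrix.mul_smul, h.proj_mul_proj he,
      h.comp_mul_proj he, h.proj_mul_comp he, trace_sub, trace_smul, ht0, ht1, ht2, smul_eq_mul]
    have e3 : t1 = ε * t0 := by linarith
    have e4 : t2 = ε * t1 := by linarith
    rw [e4, e3]
    ring

end OneVertex

end SimpleGraph

namespace SimpleGraph

open Matrix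

section OneVertex

variable {V : Type*} [Fintype V] [DecidableEq V] {G : SimpleGraph V} {e a b ε : ℝ}

theorem sum_rel_one_zero_zero (x : V) (f : V → ℝ) : ∑ v, G.rel 1 0 0 x v * f v = f x := by
  simp [rel_one_zero_zero, one_apply]

theorem sum_typ_mul (g : Fin 3 → ℝ) (ψ : V → ℝ) (z : V) : ∑ w, g (G.typ z w) * ψ w =
    (g 0 - g 2) * ψ z + (g 1 - g 2) * ∑ w, G.rel 0 1 0 z w * ψ w + g 2 * ∑ w, ψ w := by
  rw [← sum_rel_one_zero_zero (G := G) z ψ, Finset.mul_sum, Finset.mul_sum, Finset.mul_sum, ← Finset.sum_add_distrib,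
    ← Finset.sum_add_distrib]
  refine Finset.sum_congr rfl fun w _ => ?_
  simp only [rel_apply]
  rcases fin_three_cases (G.typ z w) with h | h | h <;> rw [h] <;> simp <;> ring

theorem eq_zero_of_local_eigenvector {x : V} {g : Fin 3 → ℝ} {ψ : V → ℝ} {θ : ℝ}
    (hg : ∀ z w, G.Adj x z → G.Adj x w →
      ∑ v, G.rel 0 0 1 v x * G.rel 0 1 0 v z * G.rel 0 1 0 v w = g (G.typ z w))
    (h0 : ψ ≠ 0) (hs : ∀ v, G.rel 0 1 0 x v = 0 → ψ v = 0) (hθ : G.rel 0 1 0 *ᵥ ψ = θ • ψ)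
    (h1 : ∑ v, ψ v = 0) : (g 0 - g 2) + (g 1 - g 2) * θ = 0 := by
  obtain ⟨z, hz⟩ := Function.ne_iff.1 h0
  rw [Pi.zero_apply] at hz
  have hz' : G.rel 0 1 0 x z ≠ 0 := fun h => hz (hs z h)
  have hadj : ∀ w, G.rel 0 1 0 x w ≠ 0 → G.Adj x w := by
    intro w hw
    rw [rel_apply] at hw
    rw [← typ_eq_one]
    rcases fin_three_cases (G.typ x w) with h | h | h <;> rw [h] at hw ⊢ <;> simp at hw
  have h2 : ∑ w, g (G.typ z w) * ψ w = 0 := by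
    calc _ = ∑ w, (∑ v, G.rel 0 0 1 v x * G.rel 0 1 0 v z * G.rel 0 1 0 v w) * ψ w := by
          refine Finset.sum_congr rfl fun w _ => ?_
          by_cases hw : G.rel 0 1 0 x w = 0
          · rw [hs w hw, mul_zero, mul_zero]
          · rw [hg z w (hadj z hz') (hadj w hw)]
      _ = ∑ v, G.rel 0 0 1 v x * G.rel 0 1 0 v z * (G.rel 0 1 0 *ᵥ ψ) v := by
          simp only [Finset.sum_mul, Matrix.mulVec, dotProduct, Finset.mul_sum]
          rw [Finset.sum_comm]
          exact Finset.sum_congr rfl fun v _ => Finset.sum_congr rfl fun w _ => by ring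
      _ = 0 := by
          refine Finset.sum_eq_zero fun v _ => ?_
          rw [hθ, Pi.smul_apply, smul_eq_mul]
          rcases typ_cases (G := G) v x with h | h | h
          · rw [h.1]; simp
          · rw [rel_adj 0 0 1 h.1]; ring
          · rw [hs v (rel_nonadj _ _ _ h.1.symm)]; ring
  have h3 : ∑ w, G.rel 0 1 0 z w * ψ w = θ * ψ z := congrFun hθ z
  rw [sum_typ_mul, h1, h3] at h2
  have h4 : ((g 0 - g 2) + (g 1 - g 2) * θ) * ψ z = 0 := by linarith
  exact (mul_eq_zero.1 h4).resolve_right hz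

theorem Eig.adj_mulVec (h : G.Eig e a b) {ψ : V → ℝ} (h1 : ∑ v, ψ v = 0) :
    G.rel 0 1 0 *ᵥ ψ = (a - b)⁻¹ • (G.rel e a b *ᵥ ψ - (e - b) • ψ) := by
  have : G.rel 0 1 0 = (a - b)⁻¹ • (G.rel e a b - (e - b) • (1 : Matrix V V ℝ) - G.rel b b b) := by
    ext x v
    rw [h.adj_eq]
    simp [one_apply, Pi.single_apply, rel_const, eq_comm]
  rw [this, smul_mulVec, sub_mulVec, sub_mulVec, smul_mulVec, one_mulVec]
  have : G.rel b b b *ᵥ ψ = 0 := by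
    ext v
    simp [Matrix.mulVec, dotProduct, rel_const, ← Finset.mul_sum, h1]
  rw [this, sub_zero]

theorem Eig.sum_eq_zero_of_fixed (h : G.Eig e a b) {ψ : V → ℝ} (hψ : G.rel e a b *ᵥ ψ = ψ) :
    ∑ v, ψ v = 0 := by
  rw [← hψ]
  simp only [Matrix.mulVec, dotProduct]
  rw [Finset.sum_comm]
  simp [← Finset.sum_mul, h.row']

/-- Distinct eigenspaces cannot both carry vectors supported on the neighbours of a vertex. -/
theorem Eig.false_of_local_eigenvectors (h : G.Eig e a b) (h3 : G.IsTupleRegular 3) (hp : G.Prim)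
    {x : V} {ψ φ : V → ℝ} (hψ0 : ψ ≠ 0) (hφ0 : φ ≠ 0)
    (hψs : ∀ v, G.rel 0 1 0 x v = 0 → ψ v = 0) (hφs : ∀ v, G.rel 0 1 0 x v = 0 → φ v = 0)
    (hψ : G.rel e a b *ᵥ ψ = ψ) (hφ : G.rel e a b *ᵥ φ = 0) (hφ1 : ∑ v, φ v = 0) : False := by
  have h2 := h3.mono (by norm_num : 2 ≤ 3)
  have hab := sub_ne_zero.2 h.ne
  obtain ⟨f, hf⟩ := h3.exists_typ_three le_rfl fun i j k => sel 0 0 1 i * sel 0 1 0 j * sel 0 1 0 k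
  have hg : ∀ z w, G.Adj x z → G.Adj x w →
      ∑ v, G.rel 0 0 1 v x * G.rel 0 1 0 v z * G.rel 0 1 0 v w = f 1 1 (G.typ z w) := by
    intro z w hz hw
    rw [← typ_eq_one] at hz hw
    nth_rewrite 1 [← hz]
    rw [← hw, ← hf]
    rfl
  have hψ1 := h.sum_eq_zero_of_fixed hψ
  have e1 := eq_zero_of_local_eigenvector (θ := (a - b)⁻¹ * (1 - (e - b))) hg hψ0 hψs
    (by rw [h.adj_mulVec hψ1, hψ]; module) hψ1
  have e2 := eq_zero_of_local_eigenvector (θ := (a - b)⁻¹ * (- (e - b))) hg hφ0 hφs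
    (by rw [h.adj_mulVec hφ1, hφ]; module) hφ1
  have e3 : f 1 1 1 - f 1 1 2 = 0 := by
    have : (f 1 1 1 - f 1 1 2) * (a - b)⁻¹ = 0 := by linear_combination e1 - e2
    exact (mul_eq_zero.1 this).resolve_right (inv_ne_zero hab)
  have e4 : f 1 1 0 - f 1 1 2 = 0 := by rw [e3] at e1; linarith
  have key : ∀ z w, G.Adj x z → G.Adj x w → ∀ v, Gᶜ.Adj x v →
      G.rel 0 1 0 v z = G.rel 0 1 0 v w := by
    intro z w hz hw v hv
    have e5 : ∑ v, G.rel 0 0 1 v x * (G.rel 0 1 0 v z - G.rel 0 1 0 v w) ^ 2 = 0 := by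
      calc _ = (∑ v, G.rel 0 0 1 v x * G.rel 0 1 0 v z * G.rel 0 1 0 v z) +
            (∑ v, G.rel 0 0 1 v x * G.rel 0 1 0 v w * G.rel 0 1 0 v w) -
            2 * ∑ v, G.rel 0 0 1 v x * G.rel 0 1 0 v z * G.rel 0 1 0 v w := by
            rw [Finset.mul_sum, ← Finset.sum_add_distrib, ← Finset.sum_sub_distrib]
            exact Finset.sum_congr rfl fun v _ => by ring
        _ = 0 := by
            rw [hg z z hz hz, hg w w hw hw, hg z w hz hw, typ_self, typ_self]
            have : f 1 1 (G.typ z w) = f 1 1 0 := by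
              rcases fin_three_cases (G.typ z w) with h | h | h <;> rw [h] <;> linarith
            rw [this]; ring
    rw [Finset.sum_eq_zero_iff_of_nonneg] at e5
    · have := e5 v (Finset.mem_univ _)
      rw [rel_nonadj 0 0 1 hv.symm, one_mul, sq_eq_zero_iff, sub_eq_zero] at this
      exact this
    · intro v _
      refine mul_nonneg ?_ (sq_nonneg _)
      rw [rel_apply]
      rcases fin_three_cases (G.typ v x) with h | h | h <;> rw [h] <;> simp
  obtain ⟨v, hv⟩ := hp.exists_nonadj h2 x
  obtain ⟨z, hxz, hvz⟩ := hp.exists_common h2 hv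
  obtain ⟨w, hxw, hvw⟩ := hp.exists_sep h2 hv.ne
  have := key z w hxz hxw v hv
  rw [rel_adj _ _ _ hvz, rel_nonadj _ _ _ hvw] at this
  exact one_ne_zero this

/-- Neither `G.rel e a b` has fixed vectors supported on the non-neighbours of a vertex, nor the
complementary eigenprojection has any supported on the neighbours. -/
structure Latin (G : SimpleGraph V) (e a b : ℝ) : Prop where
  noFix : ∀ x, NoFix (G.rel e a b) (G.rel 0 0 1 x)
  noFix_dual : ∀ x, NoFix (G.rel (1 - 1 / Fintype.card V - e) (-(1 / Fintype.card V) - a)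
    (-(1 / Fintype.card V) - b)) (G.rel 0 1 0 x)

theorem Eig.rel_mul_dual (h : G.Eig e a b) : G.rel e a b *
    G.rel (1 - 1 / Fintype.card V - e) (-(1 / Fintype.card V) - a) (-(1 / Fintype.card V) - b)
      = 0 := by
  have e1 : G.rel (1 - 1 / Fintype.card V - e) (-(1 / Fintype.card V) - a)
    (-(1 / Fintype.card V) - b) = 1 - G.rel (1 / Fintype.card V) (1 / Fintype.card V)
      (1 / Fintype.card V) - G.rel e a b := by
    rw [← rel_one_zero_zero (G := G), rel_sub, rel_sub]
    congr 1 <;> ring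
  rw [e1, mul_sub, mul_sub, mul_one, h.mul_rel_const, h.idem, sub_zero, sub_self]

theorem Eig.mulVec_eq_zero_of_dual (h : G.Eig e a b) {φ : V → ℝ}
    (hφ : G.rel (1 - 1 / Fintype.card V - e) (-(1 / Fintype.card V) - a)
    (-(1 / Fintype.card V) - b) *ᵥ φ = φ) : G.rel e a b *ᵥ φ = 0 := by
  rw [← hφ, mulVec_mulVec, h.rel_mul_dual, zero_mulVec]

theorem Eig.noFix_or (h : G.Eig e a b) (h3 : G.IsTupleRegular 3) (hp : G.Prim) (x : V) :
    NoFix (G.rel e a b) (G.rel 0 1 0 x) ∨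
    NoFix (G.rel (1 - 1 / Fintype.card V - e) (-(1 / Fintype.card V) - a)
    (-(1 / Fintype.card V) - b)) (G.rel 0 1 0 x) := by
  by_contra! hcon
  unfold NoFix at hcon
  push Not at hcon
  obtain ⟨⟨ψ, h1, h2, h4⟩, φ, h5, h6, h7⟩ := hcon
  exact h.false_of_local_eigenvectors h3 hp h4 h7 h2 h6 h1 (h.mulVec_eq_zero_of_dual h5)
    (h.dual.sum_eq_zero_of_fixed h5)

theorem Eig.noFix_or_compl (h : G.Eig e a b) (h3 : G.IsTupleRegular 3) (hp : G.Prim) (x : V) :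
    NoFix (G.rel e a b) (G.rel 0 0 1 x) ∨
    NoFix (G.rel (1 - 1 / Fintype.card V - e) (-(1 / Fintype.card V) - a)
    (-(1 / Fintype.card V) - b)) (G.rel 0 0 1 x) := by
  have := h.compl.noFix_or h3.compl hp.compl x
  simpa only [rel_compl] using this

theorem Eig.smith_or_latin (h : G.Eig e a b) (h3 : G.IsTupleRegular 3) (hp : G.Prim) :
    (∃ e' a' b', G.Eig e' a' b' ∧ ∃ ε : ℝ, ∀ x, G.comp e' a' b' x = ε • G.proj e' a' b' x) ∨
    ∃ e' a' b', G.Eig e' a' b' ∧ G.Latin e' a' b' := by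
  rcases h.trichotomy (h.ne_zero hp) h3 hp with h1 | h1
  · exact Or.inl ⟨_, _, _, h, h1⟩
  rcases h.dual.trichotomy (h.dual.ne_zero hp) h3 hp with h2 | h2
  · exact Or.inl ⟨_, _, _, h.dual, h2⟩
  obtain ⟨x₀, -⟩ := hp.exists_path
  refine Or.inr ?_
  have n1 := h.noFix_or h3 hp
  have n2 := h.noFix_or_compl h3 hp
  rcases h1 with h1 | h1
  · have h3 := fun x => (n1 x).resolve_left (h1 x)
    have h4 := h2.resolve_left fun h5 => h5 x₀ (h3 x₀)
    exact ⟨_, _, _, h, fun x => (n2 x).resolve_right (h4 x), h3⟩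
  · have h3 := fun x => (n2 x).resolve_left (h1 x)
    have h4 := h2.resolve_right fun h5 => h5 x₀ (h3 x₀)
    refine ⟨_, _, _, h.dual, h3, fun x => ?_⟩
    have h5 := (n1 x).resolve_right (h4 x)
    convert h5 using 2 <;> ring

end OneVertex

section Smith

variable {V : Type*} [Fintype V] [DecidableEq V] {G : SimpleGraph V} {e a b ε : ℝ}

/-- The triple intersection numbers of the eigenprojection vanish. -/
def TripleZero (G : SimpleGraph V) (e a b : ℝ) : Prop :=
  ∀ x y z, ∑ v, G.rel e a b x v * G.rel e a b y v * G.rel e a b z v = 0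

theorem rel_sq (x v : V) : G.rel e a b x v * G.rel e a b x v =
    (a + b) * G.rel e a b x v - a * b + (e - a) * (e - b) * G.rel 1 0 0 x v := by
  simp only [rel_apply]
  rcases fin_three_cases (G.typ x v) with h | h | h <;> rw [h] <;> simp <;> ring

theorem Eig.sum_sq_mul (h : G.Eig e a b) (x z : V) :
    ∑ v, G.rel e a b x v * G.rel e a b x v * G.rel e a b z v =
      ((a + b) + (e - a) * (e - b)) * G.rel e a b x z := by
  calc _ = (a + b) * (∑ v, G.rel e a b x v * G.rel e a b z v) - a * b * (∑ v, G.rel e a b z v) +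
        (e - a) * (e - b) * ∑ v, G.rel 1 0 0 x v * G.rel e a b z v := by
        rw [Finset.mul_sum, Finset.mul_sum, Finset.mul_sum, ← Finset.sum_sub_distrib,
          ← Finset.sum_add_distrib]
        exact Finset.sum_congr rfl fun v _ => by rw [rel_sq]; ring
    _ = _ := by
        rw [h.sum_mul, h.row, sum_rel_one_zero_zero (f := G.rel e a b z), rel_comm e a b z x]
        ring

theorem sum_triple_sq (f : V → V → ℝ) :
    ∑ p : V × V × V, (∑ v, f p.1 v * f p.2.1 v * f p.2.2 v) ^ 2 =
      ∑ v, ∑ w, (∑ x, f x v * f x w) ^ 3 := by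
  simp only [sq, Finset.sum_mul_sum]
  rw [Finset.sum_comm]
  refine Finset.sum_congr rfl fun v _ => ?_
  rw [Finset.sum_comm]
  refine Finset.sum_congr rfl fun w _ => ?_
  rw [pow_three, Finset.sum_mul_sum, Finset.sum_mul_sum]
  simp only [Fintype.sum_prod_type, Finset.mul_sum]
  exact Finset.sum_congr rfl fun x _ => Finset.sum_congr rfl fun y _ =>
    Finset.sum_congr rfl fun z _ => by ring

theorem Eig.tripleZero_of_eq (h : G.Eig e a b) (hi : (e - a) * (e - b) = -(a + b)) :
    G.TripleZero e a b := by
  have h1 : ∑ p : V × V × V, (∑ v, G.rel e a b p.1 v * G.rel e a b p.2.1 v *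
      G.rel e a b p.2.2 v) ^ 2 = 0 := by
    calc _ = ∑ v, ∑ w, (∑ x, G.rel e a b x v * G.rel e a b x w) ^ 3 := sum_triple_sq _
      _ = ∑ v, ∑ w, (∑ x, G.rel e a b v x * G.rel e a b w x) ^ 3 := by
          simp only [rel_comm e a b]
      _ = ∑ v, ∑ w, G.rel e a b v w * G.rel e a b v w * G.rel e a b v w := by
          simp only [h.sum_mul, pow_three, mul_assoc]
      _ = 0 := by
          refine Finset.sum_eq_zero fun v _ => ?_
          rw [h.sum_sq_mul, hi]
          ring
  intro x y z
  have h2 := (Finset.sum_eq_zero_iff_of_nonneg fun p _ => sq_nonneg _).1 h1 (x, y, z)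
    (Finset.mem_univ _)
  exact sq_eq_zero_iff.1 h2

theorem Eig.proj_mulVec_rel_sq (h : G.Eig e a b) (he : e ≠ 0) (x : V) :
    G.proj e a b x *ᵥ (fun v => G.rel e a b x v * G.rel e a b x v) = 0 := by
  have : (fun v => G.rel e a b x v * G.rel e a b x v) = (a + b) • G.rel e a b x - (a * b) • 1 +
      ((e - a) * (e - b)) • Pi.single x 1 := by
    ext v
    rw [rel_sq, rel_one_zero_zero]
    simp [one_apply, Pi.single_apply, eq_comm]
  rw [this, mulVec_add, mulVec_sub, mulVec_smul, mulVec_smul, mulVec_smul, h.proj_mulVec_rel he,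
    h.proj_mulVec_one he, h.proj_mulVec_single he]
  simp

theorem diagonal_rel (x : V) : diagonal (G.rel e a b x) = a • diagonal (G.rel 0 1 0 x) +
    b • diagonal (G.rel 0 0 1 x) + e • diagonal (Pi.single x 1) := by
  rw [← diagonal_smul, ← diagonal_smul, ← diagonal_smul, diagonal_add, diagonal_add]
  congr 1
  ext v
  rcases typ_cases (G := G) x v with h1 | h1 | h1
  · rw [← h1.1]; simp
  · simp [rel_adj _ _ _ h1.1, Pi.single_eq_of_ne h1.1.ne.symm]
  · simp [rel_nonadj _ _ _ h1.1, Pi.single_eq_of_ne h1.1.ne.symm]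

theorem Eig.exists_triple_of_smith (h : G.Eig e a b) (he : e ≠ 0) (h1 : G.IsTupleRegular 1)
    (hs : ∀ x, G.comp e a b x = ε • G.proj e a b x) : ∃ κ κ' : ℝ, ∀ x y z,
    ∑ v, G.rel e a b x v * G.rel e a b y v * G.rel e a b z v =
      κ * G.rel e a b y z + κ' * (G.rel e a b x y * G.rel e a b x z) := by
  obtain ⟨c, hc⟩ := h1.exists_typ_one le_rfl fun i => sel e a b i ^ 3
  set κ := a * ε + b * (1 - ε) with hκ
  refine ⟨κ, e⁻¹ * e⁻¹ * c - κ * e⁻¹, fun x y z => ?_⟩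
  have h4 : G.proj e a b x * diagonal (G.rel e a b x) * G.proj e a b x = κ • G.proj e a b x := by
    have h2 := h.comp_compl he x
    rw [comp, proj_compl, rel_compl, hs] at h2
    have h3 := hs x
    rw [comp] at h3
    rw [diagonal_rel, mul_add, mul_add, add_mul, add_mul, Matrix.mul_smul, Matrix.mul_smul,
      Matrix.mul_smul, Matrix.smul_mul, Matrix.smul_mul, Matrix.smul_mul, h2, h3,
      mul_diagonal_single_mul (h.proj_mulVec_single he x)]
    module
  have h5 := congrFun (congrFun h4 y) z
  rw [mul_diagonal_mul_apply, Matrix.smul_apply, smul_eq_mul] at h5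
  have h6 := fun w => congrFun (h.proj_mulVec_rel_sq he x) w
  simp only [Matrix.mulVec, dotProduct, Pi.zero_apply] at h6
  have h7 : ∑ v, G.rel e a b x v ^ 3 = c := by
    rw [← hc x]
    exact Finset.sum_congr rfl fun v _ => by rw [rel_comm, rel_apply]
  have h8 : ∀ w v, G.rel e a b w v =
      G.proj e a b x w v + e⁻¹ * (G.rel e a b x w * G.rel e a b x v) := by
    intro w v; rw [proj_apply]; ring
  calc _ = (∑ v, G.proj e a b x y v * G.rel e a b x v * G.proj e a b x v z) +
        e⁻¹ * G.rel e a b x z * (∑ v, G.proj e a b x y v * (G.rel e a b x v * G.rel e a b x v)) +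
        e⁻¹ * G.rel e a b x y * (∑ v, G.proj e a b x z v * (G.rel e a b x v * G.rel e a b x v)) +
        e⁻¹ * e⁻¹ * G.rel e a b x y * G.rel e a b x z * ∑ v, G.rel e a b x v ^ 3 := by
        rw [Finset.mul_sum, Finset.mul_sum, Finset.mul_sum, ← Finset.sum_add_distrib,
          ← Finset.sum_add_distrib, ← Finset.sum_add_distrib]
        refine Finset.sum_congr rfl fun v _ => ?_
        have : G.proj e a b x v z = G.proj e a b x z v := by
          rw [← proj_transpose, transpose_apply, proj_transpose]
        rw [h8 y v, h8 z v, this]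
        ring
    _ = _ := by
        rw [h5, h6, h6, h7, proj_apply]
        ring

theorem Eig.eq_of_smith (h : G.Eig e a b) (hp : G.Prim) (h2 : G.IsTupleRegular 2)
    (hs : ∀ x, G.comp e a b x = ε • G.proj e a b x) : (e - a) * (e - b) = -(a + b) := by
  have he := h.ne_zero hp
  obtain ⟨κ, κ', hT⟩ := h.exists_triple_of_smith he (h2.mono (by norm_num)) hs
  have key : ∀ x y, x ≠ y → κ = κ' * G.rel e a b x y := by
    intro x y hxy
    obtain ⟨z, hz1, hz2⟩ := hp.exists_sep h2 hxy
    have h3 := hT x y z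
    have h4 := hT y x z
    rw [rel_adj _ _ _ hz1, rel_nonadj _ _ _ hz2] at h3 h4
    have h5 : ∑ v, G.rel e a b x v * G.rel e a b y v * G.rel e a b z v =
      ∑ v, G.rel e a b y v * G.rel e a b x v * G.rel e a b z v :=
      Finset.sum_congr rfl fun v _ => by ring
    rw [h3, h4, rel_comm e a b y x] at h5
    have h6 : (κ - κ' * G.rel e a b x y) * (a - b) = 0 := by linear_combination -h5
    linarith [(mul_eq_zero.1 h6).resolve_right (sub_ne_zero.2 h.ne)]
  obtain ⟨x, y, z, hxy, -, hxz⟩ := hp.exists_path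
  have k1 := key x y hxy.ne
  have k2 := key x z hxz.ne
  rw [rel_adj _ _ _ hxy] at k1
  rw [rel_nonadj _ _ _ hxz] at k2
  have k3 : κ' * (a - b) = 0 := by linarith
  have k4 := (mul_eq_zero.1 k3).resolve_right (sub_ne_zero.2 h.ne)
  rw [k4, zero_mul] at k1
  have h3 := hT x x x
  rw [k1, k4, h.sum_sq_mul, rel_self] at h3
  have h4 : (a + b + (e - a) * (e - b)) * e = 0 := by linarith
  linarith [(mul_eq_zero.1 h4).resolve_right he]

theorem Eig.smith_eq_or_latin (h : G.Eig e a b) (h3 : G.IsTupleRegular 3) (hp : G.Prim) :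
    (∃ e' a' b', G.Eig e' a' b' ∧ (e' - a') * (e' - b') = -(a' + b')) ∨
    ∃ e' a' b', G.Eig e' a' b' ∧ G.Latin e' a' b' := by
  refine (h.smith_or_latin h3 hp).imp_left ?_
  rintro ⟨e', a', b', h', ε, hε⟩
  exact ⟨e', a', b', h', h'.eq_of_smith hp (h3.mono (by norm_num)) hε⟩

/-- Rows of the eigenprojection at adjacent vertices are not parallel. -/
theorem Eig.sq_ne_sq (h : G.Eig e a b) (hp : G.Prim) (h2 : G.IsTupleRegular 2) (ht : ¬ G.TriFree) :
    e * e - a * a ≠ 0 := by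
  have he := h.ne_zero hp
  obtain ⟨x, y, -, hxy, -, -⟩ := hp.exists_path
  have key : ∀ c : ℝ, ∑ v, (G.rel e a b x v + c * G.rel e a b y v) ^ 2 =
      e + 2 * c * a + c ^ 2 * e := by
    intro c
    calc _ = (∑ v, G.rel e a b x v * G.rel e a b x v) + 2 * c * (∑ v, G.rel e a b x v *
          G.rel e a b y v) + c ^ 2 * ∑ v, G.rel e a b y v * G.rel e a b y v := by
          rw [Finset.mul_sum, Finset.mul_sum, ← Finset.sum_add_distrib, ← Finset.sum_add_distrib]
          exact Finset.sum_congr rfl fun v _ => by ring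
      _ = _ := by rw [h.sum_mul, h.sum_mul, h.sum_mul, rel_self, rel_self, rel_adj _ _ _ hxy]
  intro h0
  have h1 : (e - a) * (e + a) = 0 := by linear_combination h0
  rcases mul_eq_zero.1 h1 with h1 | h1
  · have h3 := key (-1)
    have h4 : e + 2 * (-1) * a + (-1) ^ 2 * e = 0 := by linarith
    rw [h4, Finset.sum_eq_zero_iff_of_nonneg fun v _ => sq_nonneg _] at h3
    obtain ⟨z, hz1, hz2⟩ := hp.exists_sep h2 hxy.ne
    have h5 := sq_eq_zero_iff.1 (h3 z (Finset.mem_univ _))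
    rw [rel_adj _ _ _ hz1, rel_nonadj _ _ _ hz2] at h5
    exact h.ne (by linarith)
  · have h3 := key 1
    have h4 : e + 2 * 1 * a + 1 ^ 2 * e = 0 := by linarith
    rw [h4, Finset.sum_eq_zero_iff_of_nonneg fun v _ => sq_nonneg _] at h3
    obtain ⟨z, hz1, hz2⟩ := h2.exists_triangle ht hxy
    have h5 := sq_eq_zero_iff.1 (h3 z (Finset.mem_univ _))
    rw [rel_adj _ _ _ hz1, rel_adj _ _ _ hz2] at h5
    exact he (by linarith)

/-- The multiplicity relation for an eigenprojection with vanishing triple intersection numbers. -/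
theorem Eig.card_mul (h : G.Eig e a b) (hi : (e - a) * (e - b) = -(a + b)) (x : V) :
    Fintype.card V * (a * b) = -(a + b + e) := by
  have h1 := h.sum_mul x x
  simp only [rel_sq, Finset.sum_add_distrib, Finset.sum_sub_distrib, ← Finset.mul_sum, h.row,
    rel_self, hi] at h1
  have h2 := sum_rel_one_zero_zero (G := G) x 1
  simp only [Pi.one_apply, mul_one] at h2
  rw [h2] at h1
  simp at h1
  linarith

end Smith

end SimpleGraph

namespace SimpleGraph

open Matrix

section Algebra

variable {V : Type*} [Fintype V] [DecidableEq V]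

theorem sq_eq_smul_of_cube {X : Matrix V V ℝ} {t : ℝ} (hX : Xᵀ = X)
    (h : X * (X * X) = t • (X * X)) : X * X = t • X := by
  rw [← sub_eq_zero]
  refine eq_zero_of_trace_sq ?_ ?_
  · rw [transpose_sub, transpose_mul, transpose_smul, hX]
  · have : (X * X - t • X) * (X * X - t • X) = 0 := by
      simp only [sub_mul, mul_sub, Matrix.smul_mul, Matrix.mul_smul, Matrix.mul_assoc, h]
      simp
    rw [this, trace_zero]

/-- An operator with two eigenvalues satisfying a cubic relation. -/
theorem scalar_or_annihilates {P X : Matrix V V ℝ} {c c' t ε : ℝ} (hc : c ≠ 0) (hc' : c' ≠ 0)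
    (hPP : P * P = P) (hPX : P * X = X) (hXP : X * P = X) (hXX : X * X = t • X)
    (h : (c • P - X) * ((c • P - X) * (c' • P - X)) = ε • ((c • P - X) * (c' • P - X))) :
    (∃ θ : ℝ, X = θ • P) ∨ (c • P - X) * X = 0 ∨ (c' • P - X) * X = 0 := by
  by_cases hs : ∃ θ : ℝ, X = θ • P
  · exact Or.inl hs
  right
  have h1 : (c * c' * (c - ε)) • P +
      (c' * (t - 2 * c + ε) - c * (c - ε) - t * (t - 2 * c + ε)) • X = 0 := by
    simp only [sub_mul, mul_sub, Matrix.smul_mul, Matrix.mul_smul, hPP, hPX, hXP, hXX] at h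
    rw [← sub_eq_zero] at h
    rw [← h]
    module
  have h2 : c' * (t - 2 * c + ε) - c * (c - ε) - t * (t - 2 * c + ε) = 0 := by
    by_contra h2
    refine hs ⟨-((c' * (t - 2 * c + ε) - c * (c - ε) - t * (t - 2 * c + ε))⁻¹ *
      (c * c' * (c - ε))), ?_⟩
    rw [neg_smul, mul_smul, ← smul_neg, eq_inv_smul_iff₀ h2, eq_neg_iff_add_eq_zero, add_comm]
    exact h1
  rw [h2, zero_smul, add_zero, smul_eq_zero] at h1
  have h3 : c * c' * (c - ε) = 0 := h1.resolve_right fun h0 => hs ⟨0, by rw [← hPX, h0]; simp⟩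
  have h4 : ε = c := by
    have := (mul_eq_zero.1 h3).resolve_left (mul_ne_zero hc hc')
    linarith
  have h5 : (c' - t) * (t - c) = 0 := by rw [h4] at h2; linarith
  rcases mul_eq_zero.1 h5 with h6 | h6
  · right
    rw [sub_mul, Matrix.smul_mul, hPX, hXX, ← sub_smul, h6, zero_smul]
  · left
    rw [sub_mul, Matrix.smul_mul, hPX, hXX, ← sub_smul]
    rw [show c - t = 0 by linarith, zero_smul]

end Algebra

section Edge

variable {V : Type*} [Fintype V] [DecidableEq V] {G : SimpleGraph V} {e a b : ℝ}

/-- The vertices in prescribed relation to `x` and `y`. -/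
noncomputable def cell (G : SimpleGraph V) (x y : V) (p q : Fin 3) : V → ℝ :=
  fun v => if G.typ x v = p ∧ G.typ y v = q then 1 else 0

theorem cell_apply (x y : V) (p q : Fin 3) (v : V) :
    G.cell x y p q v = if G.typ x v = p ∧ G.typ y v = q then 1 else 0 := rfl

theorem cell_ne_zero {x y : V} {p q : Fin 3} {v : V} (h : G.cell x y p q v ≠ 0) :
    G.typ x v = p ∧ G.typ y v = q := by
  by_contra h'
  exact h (if_neg h')

theorem cell_cases {x y : V} (hxy : G.Adj x y) (v : V) :
    (G.typ x v = 0 ∧ G.typ y v = 1 ∧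
      (Pi.single x 1 : V → ℝ) v = 1 ∧ (Pi.single y 1 : V → ℝ) v = 0) ∨
    (G.typ x v = 1 ∧ G.typ y v = 0 ∧
      (Pi.single x 1 : V → ℝ) v = 0 ∧ (Pi.single y 1 : V → ℝ) v = 1) ∨
    ((G.typ x v = 1 ∨ G.typ x v = 2) ∧ (G.typ y v = 1 ∨ G.typ y v = 2) ∧
      (Pi.single x 1 : V → ℝ) v = 0 ∧ (Pi.single y 1 : V → ℝ) v = 0) := by
  rcases eq_or_ne v x with rfl | h1
  · exact Or.inl ⟨typ_self _, typ_eq_one.2 hxy.symm, Pi.single_eq_same _ _,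
      Pi.single_eq_of_ne hxy.ne _⟩
  rcases eq_or_ne v y with rfl | h2
  · exact Or.inr (Or.inl ⟨typ_eq_one.2 hxy, typ_self _, Pi.single_eq_of_ne hxy.ne.symm _,
      Pi.single_eq_same _ _⟩)
  refine Or.inr (Or.inr ⟨?_, ?_, Pi.single_eq_of_ne h1 _, Pi.single_eq_of_ne h2 _⟩)
  · exact (fin_three_cases (G.typ x v)).resolve_left fun h => h1 (typ_eq_zero.1 h).symm
  · exact (fin_three_cases (G.typ y v)).resolve_left fun h => h2 (typ_eq_zero.1 h).symm

theorem cell_one_two {x y : V} (hxy : G.Adj x y) :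
    G.cell x y 1 2 = G.rel 0 1 0 x - G.cell x y 1 1 - Pi.single y 1 := by
  ext v
  simp only [Pi.sub_apply, cell_apply, rel_apply]
  rcases cell_cases hxy v with ⟨h1, h2, h3, h4⟩ | ⟨h1, h2, h3, h4⟩ | ⟨h1 | h1, h2 | h2, h3, h4⟩
  all_goals simp [h1, h2, h4, one_ne_two_fin]

theorem cell_two_one {x y : V} (hxy : G.Adj x y) :
    G.cell x y 2 1 = G.rel 0 1 0 y - G.cell x y 1 1 - Pi.single x 1 := by
  ext v
  simp only [Pi.sub_apply, cell_apply, rel_apply]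
  rcases cell_cases hxy v with ⟨h1, h2, h3, h4⟩ | ⟨h1, h2, h3, h4⟩ | ⟨h1 | h1, h2 | h2, h3, h4⟩
  all_goals simp [h1, h2, h3, one_ne_two_fin]

theorem cell_two_two {x y : V} (hxy : G.Adj x y) :
    G.cell x y 2 2 = 1 - G.rel 0 1 0 x - G.rel 0 1 0 y + G.cell x y 1 1 := by
  ext v
  simp only [Pi.sub_apply, Pi.add_apply, Pi.one_apply, cell_apply, rel_apply]
  rcases cell_cases hxy v with ⟨h1, h2, h3, h4⟩ | ⟨h1, h2, h3, h4⟩ | ⟨h1 | h1, h2 | h2, h3, h4⟩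
  all_goals simp [h1, h2, one_ne_two_fin]

theorem rel_mul_rel_eq_cell {x y : V} (hxy : G.Adj x y) :
    (fun v => G.rel e a b x v * G.rel e a b y v) =
      (a * a) • G.cell x y 1 1 + (a * b) • (G.cell x y 1 2 + G.cell x y 2 1) +
      (b * b) • G.cell x y 2 2 + (e * a) • (Pi.single x 1 + Pi.single y 1) := by
  ext v
  simp only [Pi.add_apply, Pi.smul_apply, smul_eq_mul, cell_apply, rel_apply]
  rcases cell_cases hxy v with ⟨h1, h2, h3, h4⟩ | ⟨h1, h2, h3, h4⟩ | ⟨h1 | h1, h2 | h2, h3, h4⟩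
  all_goals simp [h1, h2, h3, h4, one_ne_two_fin, mul_comm]

/-- The eigenprojection followed by the projection off its rows at two adjacent vertices. -/
noncomputable def proj₂ (G : SimpleGraph V) (e a b : ℝ) (x y : V) : Matrix V V ℝ :=
  Matrix.of fun z v => G.rel e a b z v - (e * e - a * a)⁻¹ *
    ((e * G.rel e a b x z - a * G.rel e a b y z) * G.rel e a b x v +
      (e * G.rel e a b y z - a * G.rel e a b x z) * G.rel e a b y v)

theorem proj₂_apply (x y z v : V) : G.proj₂ e a b x y z v =
    G.rel e a b z v - (e * e - a * a)⁻¹ *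
    ((e * G.rel e a b x z - a * G.rel e a b y z) * G.rel e a b x v +
      (e * G.rel e a b y z - a * G.rel e a b x z) * G.rel e a b y v) := rfl

theorem proj₂_transpose (x y : V) : (G.proj₂ e a b x y)ᵀ = G.proj₂ e a b x y := by
  ext z w
  rw [transpose_apply, proj₂_apply, proj₂_apply, rel_comm e a b w z]
  ring

theorem proj₂_comm (x y : V) : G.proj₂ e a b x y = G.proj₂ e a b y x := by
  ext z w
  rw [proj₂_apply, proj₂_apply]
  ring

variable (h : G.Eig e a b) (hD : e * e - a * a ≠ 0) {x y : V} (hxy : G.Adj x y)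
include h

theorem Eig.proj₂_mulVec (ψ : V → ℝ) (x y z : V) : (G.proj₂ e a b x y *ᵥ ψ) z =
    (G.rel e a b *ᵥ ψ) z - (e * e - a * a)⁻¹ *
    ((e * G.rel e a b x z - a * G.rel e a b y z) * (G.rel e a b *ᵥ ψ) x +
      (e * G.rel e a b y z - a * G.rel e a b x z) * (G.rel e a b *ᵥ ψ) y) := by
  simp only [Matrix.mulVec, dotProduct, proj₂_apply, Finset.mul_sum, ← Finset.sum_add_distrib,
    ← Finset.sum_sub_distrib]
  exact Finset.sum_congr rfl fun v _ => by ring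

theorem Eig.proj₂_mul_rel (x y : V) : G.proj₂ e a b x y * G.rel e a b = G.proj₂ e a b x y := by
  ext z v
  have h1 := h.proj₂_mulVec ((G.rel e a b).col v) x y z
  have h2 : ∀ w, (G.rel e a b *ᵥ (G.rel e a b).col v) w = G.rel e a b w v := fun w => by
    conv_rhs => rw [← h.idem]
    rfl
  rw [h2, h2, h2] at h1
  rw [proj₂_apply, ← h1]
  rfl

theorem Eig.rel_mul_proj₂ (x y : V) : G.rel e a b * G.proj₂ e a b x y = G.proj₂ e a b x y := by
  rw [← transpose_inj, transpose_mul, proj₂_transpose, rel_transpose, h.proj₂_mul_rel]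

theorem Eig.proj₂_mulVec_of_rel {ψ : V → ℝ} (hψ : G.rel e a b *ᵥ ψ = 0) :
    G.proj₂ e a b x y *ᵥ ψ = 0 := by
  rw [← h.proj₂_mul_rel, ← mulVec_mulVec, hψ, mulVec_zero]

theorem Eig.proj₂_mulVec_one : G.proj₂ e a b x y *ᵥ 1 = 0 :=
  h.proj₂_mulVec_of_rel h.mulVec_one

include hD hxy

theorem Eig.proj₂_mulVec_rel : G.proj₂ e a b x y *ᵥ G.rel e a b x = 0 := by
  ext z
  rw [h.proj₂_mulVec, h.mulVec_rel, rel_self, rel_adj _ _ _ hxy, Pi.zero_apply]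
  linear_combination (-G.rel e a b x z) * inv_mul_cancel₀ hD

theorem Eig.proj₂_mulVec_rel' : G.proj₂ e a b x y *ᵥ G.rel e a b y = 0 := by
  rw [proj₂_comm]
  exact h.proj₂_mulVec_rel hD hxy.symm

theorem Eig.proj₂_mulVec_single : G.proj₂ e a b x y *ᵥ Pi.single x 1 = 0 := by
  have h1 : G.rel e a b *ᵥ Pi.single x 1 = G.rel e a b x := by
    ext v
    rw [Matrix.mulVec_single_one, rel_comm e a b x v]
    rfl
  rw [← h.proj₂_mulVec_rel hD hxy, ← h1, mulVec_mulVec, h.proj₂_mul_rel]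

theorem Eig.proj₂_mulVec_single' : G.proj₂ e a b x y *ᵥ Pi.single y 1 = 0 := by
  rw [proj₂_comm]
  exact h.proj₂_mulVec_single hD hxy.symm

theorem Eig.proj₂_mul_proj₂ : G.proj₂ e a b x y * G.proj₂ e a b x y = G.proj₂ e a b x y := by
  ext z v
  have h1 := h.proj₂_mulVec ((G.proj₂ e a b x y).col v) x y z
  have h2 : ∀ w, (G.rel e a b *ᵥ (G.proj₂ e a b x y).col v) w = G.proj₂ e a b x y w v := fun w => by
    conv_rhs => rw [← h.rel_mul_proj₂]
    rfl
  have h3 : G.proj₂ e a b x y x v = 0 := by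
    have := congrFun (h.proj₂_mulVec_single hD hxy) v
    rw [Matrix.mulVec_single_one, col_apply] at this
    rw [← proj₂_transpose, transpose_apply, this, Pi.zero_apply]
  have h4 : G.proj₂ e a b x y y v = 0 := by
    have := congrFun (h.proj₂_mulVec_single' hD hxy) v
    rw [Matrix.mulVec_single_one, col_apply] at this
    rw [← proj₂_transpose, transpose_apply, this, Pi.zero_apply]
  rw [h2, h2, h2, h3, h4, mul_zero, mul_zero, add_zero, mul_zero, sub_zero] at h1
  rw [← h1]
  rfl

theorem Eig.proj₂_mulVec_adj : G.proj₂ e a b x y *ᵥ G.rel 0 1 0 x = 0 := by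
  have : G.rel 0 1 0 x = (a - b)⁻¹ • (G.rel e a b x - (e - b) • Pi.single x 1 - b • 1) := by
    ext v
    rw [h.adj_eq]
    simp
  rw [this, mulVec_smul, mulVec_sub, mulVec_sub, mulVec_smul, mulVec_smul,
    h.proj₂_mulVec_rel hD hxy, h.proj₂_mulVec_single hD hxy, h.proj₂_mulVec_one]
  simp

theorem Eig.proj₂_mulVec_adj' : G.proj₂ e a b x y *ᵥ G.rel 0 1 0 y = 0 := by
  rw [proj₂_comm]
  exact h.proj₂_mulVec_adj hD hxy.symm

variable (hT : G.TripleZero e a b)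
include hT

theorem Eig.proj₂_mulVec_rel_mul :
    G.proj₂ e a b x y *ᵥ (fun v => G.rel e a b x v * G.rel e a b y v) = 0 := by
  refine h.proj₂_mulVec_of_rel ?_
  ext z
  rw [Pi.zero_apply, ← hT z x y]
  exact Finset.sum_congr rfl fun v _ => by ring

theorem Eig.proj₂_mulVec_cell_one_one : G.proj₂ e a b x y *ᵥ G.cell x y 1 1 = 0 := by
  have h1 := h.proj₂_mulVec_rel_mul hD hxy hT
  rw [rel_mul_rel_eq_cell hxy, cell_one_two hxy, cell_two_one hxy, cell_two_two hxy] at h1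
  simp only [mulVec_add, mulVec_sub, mulVec_smul, h.proj₂_mulVec_adj hD hxy,
    h.proj₂_mulVec_adj' hD hxy, h.proj₂_mulVec_single hD hxy, h.proj₂_mulVec_single' hD hxy,
    h.proj₂_mulVec_one] at h1
  have h2 : ((a - b) * (a - b)) • (G.proj₂ e a b x y *ᵥ G.cell x y 1 1) = 0 := by
    rw [← h1]; module
  have := sub_ne_zero.2 h.ne
  exact (smul_eq_zero.1 h2).resolve_left (mul_ne_zero this this)

theorem Eig.proj₂_mulVec_cell_one_two : G.proj₂ e a b x y *ᵥ G.cell x y 1 2 = 0 := by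
  rw [cell_one_two hxy, mulVec_sub, mulVec_sub, h.proj₂_mulVec_cell_one_one hD hxy hT,
    h.proj₂_mulVec_adj hD hxy, h.proj₂_mulVec_single' hD hxy]
  simp

theorem Eig.proj₂_mul_diagonal_adj : G.proj₂ e a b x y * diagonal (G.rel 0 1 0 x) *
    G.proj₂ e a b x y = (b / (b - a)) • G.proj₂ e a b x y := by
  have h0 : G.rel e a b * diagonal (G.rel e a b x) * G.rel e a b = 0 := by
    ext z w
    rw [mul_diagonal_mul_apply, Matrix.zero_apply, ← hT z x w]
    exact Finset.sum_congr rfl fun v _ => by rw [rel_comm e a b v w]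
  have h1 : G.proj₂ e a b x y * diagonal (G.rel e a b x) * G.proj₂ e a b x y = 0 := by
    calc _ = G.proj₂ e a b x y * (G.rel e a b * diagonal (G.rel e a b x) * G.rel e a b) *
          G.proj₂ e a b x y := by
          simp only [← Matrix.mul_assoc, h.proj₂_mul_rel]
          rw [Matrix.mul_assoc _ (G.rel e a b), h.rel_mul_proj₂]
      _ = 0 := by rw [h0]; simp
  have h2 : G.proj₂ e a b x y * (diagonal (G.rel 0 1 0 x) + diagonal (G.rel 0 0 1 x) +
      diagonal (Pi.single x 1)) * G.proj₂ e a b x y = G.proj₂ e a b x y := by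
    rw [diagonal_rel_add, mul_one, h.proj₂_mul_proj₂ hD hxy]
  rw [diagonal_rel] at h1
  have h3 := mul_diagonal_single_mul (Q := G.proj₂ e a b x y) (h.proj₂_mulVec_single hD hxy)
  simp only [mul_add, add_mul, Matrix.mul_smul, Matrix.smul_mul, h3, smul_zero, add_zero]
    at h1 h2
  have := sub_ne_zero.2 h.ne.symm
  have h5 : (b - a) • (G.proj₂ e a b x y * diagonal (G.rel 0 1 0 x) * G.proj₂ e a b x y) =
      b • G.proj₂ e a b x y := by
    generalize G.proj₂ e a b x y * diagonal (G.rel 0 1 0 x) * G.proj₂ e a b x y = N at *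
    generalize G.proj₂ e a b x y * diagonal (G.rel 0 0 1 x) * G.proj₂ e a b x y = N' at *
    calc (b - a) • N = b • (N + N') - (a • N + b • N') := by module
      _ = _ := by rw [h1, h2, sub_zero]
  rw [div_eq_inv_mul, mul_smul, ← h5, inv_smul_smul₀ this]

end Edge

end SimpleGraph

namespace SimpleGraph

open Matrix

section Blocks

variable {V : Type*} [Fintype V] [DecidableEq V] {P : Matrix V V ℝ}

theorem eq_zero_of_blocks_mul_eq_zero (hP : Pᵀ = P) (hPP : P * P = P) {d d' : V → ℝ}
    (hd : ∀ v, 0 ≤ d v) (hd' : ∀ v, 0 ≤ d' v)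
    (h : (P * diagonal d * P) * (P * diagonal d' * P) = 0) {z w : V} (hz : d z ≠ 0) (hw : d' w ≠ 0) :
    P z w = 0 := by
  have hs : ∀ u v, P u v = P v u := fun u v => by rw [← transpose_apply P v u, hP]
  have h1 : trace ((P * diagonal d * P) * diagonal d') = 0 := by
    rw [← trace_zero (n := V) (R := ℝ), ← h]
    calc _ = trace ((P * diagonal d * P) * diagonal d' * 1) := by rw [mul_one]
      _ = trace (((P * P) * diagonal d * (P * P)) * diagonal d') := by rw [hPP, mul_one]
      _ = trace (P * (P * diagonal d * P * (P * diagonal d'))) := by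
          simp only [Matrix.mul_assoc]
      _ = trace ((P * diagonal d * P * (P * diagonal d')) * P) := trace_mul_comm _ _
      _ = _ := by simp only [Matrix.mul_assoc]
  have h2 : ∑ u, ∑ v, P u v * d v * P v u * d' u = 0 := by
    rw [← h1, trace]
    refine Finset.sum_congr rfl fun u _ => ?_
    rw [diag_apply, mul_diagonal, mul_diagonal_mul_apply, Finset.sum_mul]
  have h3 : ∀ u v, 0 ≤ P u v * d v * P v u * d' u := fun u v => by
    rw [hs v u, show P u v * d v * P u v * d' u = (P u v) ^ 2 * (d v * d' u) by ring]
    exact mul_nonneg (sq_nonneg _) (mul_nonneg (hd v) (hd' u))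
  have h4 := (Finset.sum_eq_zero_iff_of_nonneg fun u _ => Finset.sum_nonneg fun v _ => h3 u v).1 h2
    w (Finset.mem_univ _)
  have h5 := (Finset.sum_eq_zero_iff_of_nonneg fun v _ => h3 w v).1 h4 z (Finset.mem_univ _)
  rw [hs w z] at h5
  simpa [hz, hw] using h5

theorem block_mul_block (hPP : P * P = P) {d d' : V → ℝ} {ε : ℝ}
    (h : diagonal d * (P * diagonal d * P) * diagonal d' = ε • (diagonal d * P * diagonal d')) :
    (P * diagonal d * P) * ((P * diagonal d * P) * (P * diagonal d' * P)) =
      ε • ((P * diagonal d * P) * (P * diagonal d' * P)) := by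
  have h1 : ∀ X : Matrix V V ℝ, P * (P * X) = P * X := fun X => by rw [← Matrix.mul_assoc, hPP]
  have h2 := congrArg (fun X => P * X * P) h
  simp only [Matrix.mul_smul, Matrix.smul_mul, Matrix.mul_assoc] at h2
  simp only [Matrix.mul_assoc, h1, h2]

end Blocks

section Edge

variable {V : Type*} [Fintype V] [DecidableEq V] {G : SimpleGraph V} {e a b : ℝ}

theorem cell_nonneg (x y : V) (p q : Fin 3) (v : V) : 0 ≤ G.cell x y p q v := by
  rw [cell_apply]; split_ifs <;> norm_num

theorem typ_uniform_of_edge (h3 : G.IsTupleRegular 3) {p q p' q' : Fin 3} {S : Fin 3 → Prop} {x y : V}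
    (hxy : G.Adj x y)
    (h : ∀ z w, G.typ x z = p → G.typ y z = q → G.typ x w = p' → G.typ y w = q' → S (G.typ z w)) :
    ∀ x y z w, G.Adj x y → G.typ x z = p → G.typ y z = q → G.typ x w = p' → G.typ y w = q' →
      S (G.typ z w) := by
  intro x' y' z' w' hxy' hz1 hz2 hw1 hw2
  have hE : G.typ x' y' = G.typ x y := (typ_eq_one.2 hxy').trans (typ_eq_one.2 hxy).symm
  obtain ⟨z, hz3, hz4⟩ := (h3.mono (by norm_num : 2 ≤ 3)).transfer_two hE
    ⟨z', (typ_comm _ _).trans hz1, (typ_comm _ _).trans hz2⟩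
  rw [typ_comm] at hz3 hz4
  obtain ⟨w, hw3, hw4, hw5⟩ := h3.transfer_three hE (hz1.trans hz3.symm) (hz2.trans hz4.symm)
    ⟨w', (typ_comm _ _).trans hw1, (typ_comm _ _).trans hw2, (typ_comm _ _)⟩
  rw [typ_comm] at hw3 hw4 hw5
  rw [← hw5]
  exact h z w hz3 hz4 hw3 hw4

theorem Eig.exists_typ_of_proj₂ (h : G.Eig e a b) {x y : V} {p q p' q' : Fin 3}
    (hne : p ≠ p' ∨ q ≠ q')
    (h0 : ∀ z w, G.cell x y p q z ≠ 0 → G.cell x y p' q' w ≠ 0 → G.proj₂ e a b x y z w = 0) :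
    ∃ i, ∀ z w, G.typ x z = p → G.typ y z = q → G.typ x w = p' → G.typ y w = q' → G.typ z w = i := by
  have key : ∀ z w z' w', G.typ x z = p → G.typ y z = q → G.typ x w = p' → G.typ y w = q' →
      G.typ x z' = p → G.typ y z' = q → G.typ x w' = p' → G.typ y w' = q' →
      G.typ z w = G.typ z' w' := by
    intro z w z' w' h1 h2 h3 h4 h5 h6 h7 h8
    have e1 := h0 z w (by simp [cell_apply, h1, h2]) (by simp [cell_apply, h3, h4])
    have e2 := h0 z' w' (by simp [cell_apply, h5, h6]) (by simp [cell_apply, h7, h8])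
    rw [proj₂_apply, sub_eq_zero] at e1 e2
    have e3 : G.rel e a b z w = G.rel e a b z' w' := by
      rw [e1, e2]
      simp only [rel_apply, h1, h2, h3, h4, h5, h6, h7, h8]
    have n1 : G.typ z w ≠ 0 := fun h' => by
      obtain rfl := typ_eq_zero.1 h'
      exact hne.elim (fun h'' => h'' (h1.symm.trans h3)) fun h'' => h'' (h2.symm.trans h4)
    have n2 : G.typ z' w' ≠ 0 := fun h' => by
      obtain rfl := typ_eq_zero.1 h'
      exact hne.elim (fun h'' => h'' (h5.symm.trans h7)) fun h'' => h'' (h6.symm.trans h8)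
    rw [rel_apply, rel_apply] at e3
    rcases (fin_three_cases (G.typ z w)).resolve_left n1 with t1 | t1 <;>
    rcases (fin_three_cases (G.typ z' w')).resolve_left n2 with t2 | t2 <;>
    rw [t1, t2] at e3 ⊢ <;> first | rfl | exact absurd e3 h.ne | exact absurd e3.symm h.ne
  by_cases hex : ∃ z w, G.typ x z = p ∧ G.typ y z = q ∧ G.typ x w = p' ∧ G.typ y w = q'
  · obtain ⟨z, w, h1, h2, h3, h4⟩ := hex
    exact ⟨G.typ z w, fun z' w' h1' h2' h3' h4' => key _ _ _ _ h1' h2' h3' h4' h1 h2 h3 h4⟩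
  · exact ⟨0, fun z w h1 h2 h3 h4 => absurd ⟨z, w, h1, h2, h3, h4⟩ hex⟩

theorem Eig.block_mul_block (h : G.Eig e a b) (h4 : G.IsTupleRegular 4) (hD : e * e - a * a ≠ 0)
    {x y : V} (hxy : G.Adj x y) {p q p' q' : Fin 3} (hne : p ≠ p' ∨ q ≠ q')
    (hc : G.proj₂ e a b x y *ᵥ G.cell x y p q = 0) :
    ∃ ε : ℝ, (G.proj₂ e a b x y * diagonal (G.cell x y p q) * G.proj₂ e a b x y) *
        ((G.proj₂ e a b x y * diagonal (G.cell x y p q) * G.proj₂ e a b x y) *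
        (G.proj₂ e a b x y * diagonal (G.cell x y p' q') * G.proj₂ e a b x y)) =
      ε • ((G.proj₂ e a b x y * diagonal (G.cell x y p q) * G.proj₂ e a b x y) *
        (G.proj₂ e a b x y * diagonal (G.cell x y p' q') * G.proj₂ e a b x y)) := by
  by_cases hs : ∑ z, G.cell x y p q z = 0
  · have : G.cell x y p q = 0 := by
      ext v
      exact (Finset.sum_eq_zero_iff_of_nonneg fun v _ => cell_nonneg x y p q v).1 hs v
        (Finset.mem_univ _)
    refine ⟨0, ?_⟩
    rw [this]
    simp
  obtain ⟨f, hf⟩ := h4.exists_typ_four le_rfl fun i j k l =>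
    (sel e a b k - (e * e - a * a)⁻¹ *
      ((e * sel e a b p - a * sel e a b q) * sel e a b i +
      (e * sel e a b q - a * sel e a b p) * sel e a b j)) *
    (if i = p ∧ j = q then 1 else 0) *
    (sel e a b l - (e * e - a * a)⁻¹ *
      ((e * sel e a b p' - a * sel e a b q') * sel e a b i +
      (e * sel e a b q' - a * sel e a b p') * sel e a b j))
  have key : ∀ z w, G.cell x y p q z ≠ 0 → G.cell x y p' q' w ≠ 0 →
      (G.proj₂ e a b x y * diagonal (G.cell x y p q) * G.proj₂ e a b x y) z w =
        f 1 p p' q q' (G.typ z w) := by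
    intro z w hz hw
    obtain ⟨z1, z2⟩ := cell_ne_zero hz
    obtain ⟨w1, w2⟩ := cell_ne_zero hw
    have := hf x y z w
    rw [typ_eq_one.2 hxy, z1, z2, w1, w2] at this
    rw [← this, mul_diagonal_mul_apply]
    refine Finset.sum_congr rfl fun v _ => ?_
    have ht : G.proj₂ e a b x y v w = G.proj₂ e a b x y w v := by
      conv_lhs => rw [← proj₂_transpose, transpose_apply]
    rw [ht, proj₂_apply, proj₂_apply, cell_apply]
    simp only [rel_apply, z1, z2, w1, w2, typ_comm x v, typ_comm y v, typ_comm z v, typ_comm w v]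
  have hab := sub_ne_zero.2 h.ne
  obtain ⟨κ, hκ⟩ : ∃ κ : ℝ, ∀ z w, G.cell x y p q z ≠ 0 → G.cell x y p' q' w ≠ 0 →
      G.proj₂ e a b x y z w = G.rel e a b z w - κ := by
    refine ⟨(e * e - a * a)⁻¹ *
      ((e * sel e a b p - a * sel e a b q) * sel e a b p' +
      (e * sel e a b q - a * sel e a b p) * sel e a b q'), fun z w hz hw => ?_⟩
    obtain ⟨z1, z2⟩ := cell_ne_zero hz
    obtain ⟨w1, w2⟩ := cell_ne_zero hw
    rw [proj₂_apply]
    simp only [rel_apply, z1, z2, w1, w2]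
  have hd : (f 1 p p' q q' 1 - f 1 p p' q q' 2) / (a - b) * (a - b) =
    f 1 p p' q q' 1 - f 1 p p' q q' 2 := div_mul_cancel₀ _ hab
  set r := (f 1 p p' q q' 1 - f 1 p p' q q' 2) / (a - b)
  refine ⟨r, SimpleGraph.block_mul_block (h.proj₂_mul_proj₂ hD hxy)
    (rank_two (j := f 1 p p' q q' 1 - r * (a - κ)) (fun z w hz hw => ?_)
      (sum_symm_mul_eq_zero (proj₂_transpose x y) hc) hs)⟩
  rw [key z w hz hw, hκ z w hz hw]
  have hzw : G.typ z w ≠ 0 := fun h' => by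
    obtain rfl := typ_eq_zero.1 h'
    obtain ⟨z1, z2⟩ := cell_ne_zero hz
    obtain ⟨w1, w2⟩ := cell_ne_zero hw
    exact hne.elim (fun h'' => h'' (z1.symm.trans w1)) fun h'' => h'' (z2.symm.trans w2)
  rw [rel_apply]
  rcases (fin_three_cases (G.typ z w)).resolve_left hzw with t | t
  all_goals
    rw [t]
    simp only [sel_one, sel_two]
    linarith

end Edge

end SimpleGraph

namespace SimpleGraph

open Matrix

variable {V : Type*} [Fintype V] [DecidableEq V] {G : SimpleGraph V} {e a b : ℝ}

/-- The numerical consequence of the edge operator being scalar. -/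
theorem extremal_of_scalar {κ : ℝ} (hab : a ≠ b) (hD : e * e - a * a ≠ 0)
    (hi : (e - a) * (e - b) = -(a + b))
    (h : ∀ u w l m : ℝ, l = (e * e - a * a)⁻¹ * (e * u - a * w) →
      m = (e * e - a * a)⁻¹ * (e * w - a * u) → (u = a ∧ w = a) ∨ (u = a ∧ w = b) ∨ (u = b ∧ w = b) →
      κ * (e - l * u - m * w) + (l * l + m * m) * (-(a * b) * a - (a + b) * e * a) +
        2 * l * m * (-(a * b) * e - (a + b) * (a * a)) = -(a * b) * a - (a + b) * (u * w)) :
    (a + b) * e = 2 * (a * b) := by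
  have e1 := h a a _ _ rfl rfl (Or.inl ⟨rfl, rfl⟩)
  have e2 := h a b _ _ rfl rfl (Or.inr (Or.inl ⟨rfl, rfl⟩))
  have e3 := h b b _ _ rfl rfl (Or.inr (Or.inr ⟨rfl, rfl⟩))
  have hd := inv_mul_cancel₀ hD
  set d := (e * e - a * a)⁻¹
  have hs : a + b ≠ 0 := fun hs => hD (by
    obtain rfl : b = -a := by linarith
    linear_combination hi)
  have hab' := sub_ne_zero.2 hab
  set c := d * d * ((-(a * b) * a - (a + b) * e * a) * (e * e + a * a) -
    2 * e * a * (-(a * b) * e - (a + b) * (a * a))) - κ * e * d with hc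
  set c' := d * d * ((-(a * b) * e - (a + b) * (a * a)) * (e * e + a * a) -
    2 * e * a * (-(a * b) * a - (a + b) * e * a)) + κ * a * d with hc'
  have f1 : (a - b) * (c * (a + b) + (2 * c' + (a + b)) * a) = 0 := by
    rw [hc, hc']
    linear_combination e1 - e2
  have f2 : (a - b) * (c * (a + b) + (2 * c' + (a + b)) * b) = 0 := by
    rw [hc, hc']
    linear_combination e2 - e3
  have g1 := (mul_eq_zero.1 f1).resolve_left hab'
  have g2 := (mul_eq_zero.1 f2).resolve_left hab'
  have g3 : 2 * c' + (a + b) = 0 := by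
    refine (mul_eq_zero.1 (?_ : (a - b) * (2 * c' + (a + b)) = 0)).resolve_left hab'
    linear_combination g1 - g2
  have g4 : c = 0 := by
    refine (mul_eq_zero.1 (?_ : (a + b) * c = 0)).resolve_left hs
    linear_combination g1 - a * g3
  have g5 : c' * e + c * a = -(a * b) := by
    rw [hc, hc']
    linear_combination (-(a * b) * (d * (e * e - a * a) + 1)) * hd
  rw [g4] at g5
  linear_combination e * g3 - 2 * g5

theorem rel_sq_mul (hi : (e - a) * (e - b) = -(a + b)) (x v : V) (c : ℝ) :
    G.rel e a b x v * G.rel e a b x v * c =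
    (a + b) * (G.rel e a b x v * c) - a * b * c - (a + b) * (G.rel 1 0 0 x v * c) := by
  rw [rel_sq, hi]
  ring

variable (h : G.Eig e a b) (hD : e * e - a * a ≠ 0) {x y : V} (hxy : G.Adj x y)
  (hi : (e - a) * (e - b) = -(a + b))
include h hD hxy hi

theorem Eig.proj₂_sum_rel_mul (z : V) : ∑ v, G.proj₂ e a b x y z v * (G.rel e a b x v * G.rel e a b y v)
    = 0 := congrFun (h.proj₂_mulVec_rel_mul hD hxy (h.tripleZero_of_eq hi)) z

theorem Eig.proj₂_sum_sq_mul (z : V) :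
    ∑ v, G.proj₂ e a b x y z v * (G.rel e a b x v * G.rel e a b x v * G.rel e a b y v) = 0 := by
  have h1 := h.proj₂_sum_rel_mul hD hxy hi z
  have h2 : ∑ v, G.proj₂ e a b x y z v * G.rel e a b y v = 0 :=
    congrFun (h.proj₂_mulVec_rel' hD hxy) z
  have h3 : G.proj₂ e a b x y z x = 0 := by
    simpa using congrFun (h.proj₂_mulVec_single hD hxy) z
  have h4 := sum_rel_one_zero_zero (G := G) x fun v => G.proj₂ e a b x y z v * G.rel e a b y v
  calc _ = (a + b) * ∑ v, G.proj₂ e a b x y z v * (G.rel e a b x v * G.rel e a b y v) -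
        a * b * ∑ v, G.proj₂ e a b x y z v * G.rel e a b y v -
        (a + b) * ∑ v, G.rel 1 0 0 x v * (G.proj₂ e a b x y z v * G.rel e a b y v) := by
        simp only [Finset.mul_sum, ← Finset.sum_sub_distrib]
        refine Finset.sum_congr rfl fun v _ => ?_
        rw [rel_sq_mul hi x v (G.rel e a b y v)]
        ring
    _ = 0 := by rw [h1, h2, h4, h3]; ring

theorem Eig.sum_cube_mul :
    ∑ v, G.rel e a b x v * G.rel e a b x v * (G.rel e a b x v * G.rel e a b y v) =
      -(a * b) * a - (a + b) * e * a := by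
  have hT := h.tripleZero_of_eq hi x x y
  have h4 := sum_rel_one_zero_zero (G := G) x fun v => G.rel e a b x v * G.rel e a b y v
  calc _ = (a + b) * ∑ v, G.rel e a b x v * G.rel e a b x v * G.rel e a b y v -
        a * b * ∑ v, G.rel e a b x v * G.rel e a b y v -
        (a + b) * ∑ v, G.rel 1 0 0 x v * (G.rel e a b x v * G.rel e a b y v) := by
        simp only [Finset.mul_sum, ← Finset.sum_sub_distrib]
        refine Finset.sum_congr rfl fun v _ => ?_
        linear_combination G.rel e a b x v * rel_sq_mul hi x v (G.rel e a b y v)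
    _ = _ := by
        rw [hT, h4, h.sum_mul, rel_self, rel_adj _ _ _ hxy, rel_adj _ _ _ hxy.symm]
        ring

theorem Eig.sum_sq_mul_sq :
    ∑ v, G.rel e a b x v * G.rel e a b x v * (G.rel e a b y v * G.rel e a b y v) =
      -(a * b) * e - (a + b) * (a * a) := by
  have hT := h.tripleZero_of_eq hi x y y
  have h4 := sum_rel_one_zero_zero (G := G) x fun v => G.rel e a b y v * G.rel e a b y v
  calc _ = (a + b) * ∑ v, G.rel e a b x v * G.rel e a b y v * G.rel e a b y v -
        a * b * ∑ v, G.rel e a b y v * G.rel e a b y v -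
        (a + b) * ∑ v, G.rel 1 0 0 x v * (G.rel e a b y v * G.rel e a b y v) := by
        simp only [Finset.mul_sum, ← Finset.sum_sub_distrib]
        refine Finset.sum_congr rfl fun v _ => ?_
        linear_combination G.rel e a b y v * rel_sq_mul hi x v (G.rel e a b y v)
    _ = _ := by
        rw [hT, h4, h.sum_mul, rel_self, rel_adj _ _ _ hxy.symm]
        ring

theorem Eig.sum_sq_mul_rel_mul (z : V) :
    ∑ v, G.rel e a b z v * G.rel e a b z v * (G.rel e a b x v * G.rel e a b y v) =
      -(a * b) * a - (a + b) * (G.rel e a b x z * G.rel e a b y z) := by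
  have hT := h.tripleZero_of_eq hi x y z
  have h4 := sum_rel_one_zero_zero (G := G) z fun v => G.rel e a b x v * G.rel e a b y v
  calc _ = (a + b) * ∑ v, G.rel e a b x v * G.rel e a b y v * G.rel e a b z v -
        a * b * ∑ v, G.rel e a b x v * G.rel e a b y v -
        (a + b) * ∑ v, G.rel 1 0 0 z v * (G.rel e a b x v * G.rel e a b y v) := by
        simp only [Finset.mul_sum, ← Finset.sum_sub_distrib]
        refine Finset.sum_congr rfl fun v _ => ?_
        rw [rel_sq, hi]
        ring
    _ = _ := by
        rw [hT, h4, h.sum_mul, rel_adj _ _ _ hxy]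
        ring

theorem Eig.scalar_equation {κ : ℝ} (hκ : G.proj₂ e a b x y *
      diagonal (fun v => G.rel e a b x v * G.rel e a b y v) * G.proj₂ e a b x y =
      κ • G.proj₂ e a b x y) (z : V) {l m : ℝ}
    (hl : l = (e * e - a * a)⁻¹ * (e * G.rel e a b x z - a * G.rel e a b y z))
    (hm : m = (e * e - a * a)⁻¹ * (e * G.rel e a b y z - a * G.rel e a b x z)) :
    κ * (e - l * G.rel e a b x z - m * G.rel e a b y z) +
        (l * l + m * m) * (-(a * b) * a - (a + b) * e * a) +
        2 * l * m * (-(a * b) * e - (a + b) * (a * a)) =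
      -(a * b) * a - (a + b) * (G.rel e a b x z * G.rel e a b y z) := by
  have h1 := congrFun (congrFun hκ z) z
  have hP : ∀ v, G.proj₂ e a b x y z v = G.rel e a b z v - (l * G.rel e a b x v + m * G.rel e a b y v) :=
    fun v => by rw [proj₂_apply, hl, hm]; ring
  have hs : ∀ v, G.proj₂ e a b x y v z = G.proj₂ e a b x y z v := fun v => by
    conv_lhs => rw [← proj₂_transpose, transpose_apply]
  rw [mul_diagonal_mul_apply, Matrix.smul_apply, smul_eq_mul] at h1
  simp only [hs] at h1
  have h2 := h.proj₂_sum_sq_mul hD hxy hi z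
  have h3 := h.proj₂_sum_sq_mul hD hxy.symm hi z
  rw [proj₂_comm] at h3
  rw [← h.sum_sq_mul_rel_mul hD hxy hi z]
  have h5 := h.sum_cube_mul hD hxy hi
  have h6 := h.sum_cube_mul hD hxy.symm hi
  have h7 := h.sum_sq_mul_sq hD hxy hi
  have h8 := hP z
  rw [rel_self] at h8
  calc _ = (∑ v, G.proj₂ e a b x y z v * (G.rel e a b x v * G.rel e a b y v) * G.proj₂ e a b x y z v) +
      2 * l * (∑ v, G.proj₂ e a b x y z v * (G.rel e a b x v * G.rel e a b x v * G.rel e a b y v)) +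
      2 * m * (∑ v, G.proj₂ e a b x y z v * (G.rel e a b y v * G.rel e a b y v * G.rel e a b x v)) +
      l * l * (∑ v, G.rel e a b x v * G.rel e a b x v * (G.rel e a b x v * G.rel e a b y v)) +
      m * m * (∑ v, G.rel e a b y v * G.rel e a b y v * (G.rel e a b y v * G.rel e a b x v)) +
      2 * l * m * ∑ v, G.rel e a b x v * G.rel e a b x v * (G.rel e a b y v * G.rel e a b y v) := by
        rw [h1, h2, h3, h5, h6, h7, h8]
        ring
    _ = _ := by
        simp only [Finset.mul_sum, ← Finset.sum_add_distrib]
        refine Finset.sum_congr rfl fun v _ => ?_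
        rw [hP v]
        ring

end SimpleGraph

namespace SimpleGraph

open Matrix

variable {V : Type*} [Fintype V] [DecidableEq V] {G : SimpleGraph V} {e a b : ℝ}

theorem Eig.smith_edge (h : G.Eig e a b) (hi : (e - a) * (e - b) = -(a + b))
    (h4 : G.IsTupleRegular 4) (hp : G.Prim) (ht : ¬ G.TriFree) (ht' : ¬ Gᶜ.TriFree) :
    (a + b) * e = 2 * (a * b) ∨ G.LocCluster := by
  have h2 := h4.mono (by norm_num : 2 ≤ 4)
  have h3 := h4.mono (by norm_num : 3 ≤ 4)
  have hD := h.sq_ne_sq hp h2 ht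
  have hD' := h.compl.sq_ne_sq hp.compl h2.compl ht'
  have hT := h.tripleZero_of_eq hi
  obtain ⟨x, y, -, hxy, -, -⟩ := hp.exists_path
  have hcard := h.card_mul hi x
  have hb : b ≠ 0 := fun hb => hD (by
    rw [hb] at hcard
    obtain rfl : e = -a := by linarith
    ring)
  have ha : a ≠ 0 := fun ha => hD' (by
    rw [ha] at hcard
    obtain rfl : e = -b := by linarith
    ring)
  have hba := sub_ne_zero.2 h.ne.symm
  have h11 := h.proj₂_mulVec_cell_one_one hD hxy hT
  have h12 := h.proj₂_mulVec_cell_one_two hD hxy hT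
  have hPP := h.proj₂_mul_proj₂ hD hxy
  have hPt := G.proj₂_transpose (e := e) (a := a) (b := b) x y
  have hadj := h.proj₂_mul_diagonal_adj hD hxy hT
  have hadj' := h.proj₂_mul_diagonal_adj hD hxy.symm hT
  rw [proj₂_comm] at hadj'
  have hsx := mul_diagonal_single_mul (Q := G.proj₂ e a b x y) (h.proj₂_mulVec_single hD hxy)
  have hsy := mul_diagonal_single_mul (Q := G.proj₂ e a b x y) (h.proj₂_mulVec_single' hD hxy)
  obtain ⟨ε, hε⟩ := h.block_mul_block h4 hD hxy (p := 1) (q := 2) (p' := 2) (q' := 1)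
    (Or.inl one_ne_two_fin) h12
  obtain ⟨δ, hδ⟩ := h.block_mul_block h4 hD hxy (p := 1) (q := 1) (p' := 2) (q' := 2)
    (Or.inl one_ne_two_fin) h11
  have hann : ∀ p q p' q', (p ≠ p' ∨ q ≠ q') →
      (G.proj₂ e a b x y * diagonal (G.cell x y p q) * G.proj₂ e a b x y) *
        (G.proj₂ e a b x y * diagonal (G.cell x y p' q') * G.proj₂ e a b x y) = 0 →
      ∃ i, ∀ x y z w, G.Adj x y → G.typ x z = p → G.typ y z = q → G.typ x w = p' →
        G.typ y w = q' → G.typ z w = i := by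
    intro p q p' q' hne h0
    obtain ⟨i, hi⟩ := h.exists_typ_of_proj₂ hne fun z w hz hw =>
      eq_zero_of_blocks_mul_eq_zero hPt hPP (cell_nonneg x y p q) (cell_nonneg x y p' q') h0 hz hw
    exact ⟨i, typ_uniform_of_edge h3 (S := fun j => j = i) hxy hi⟩
  have hann1 := hann 1 1 1 2 (Or.inr one_ne_two_fin)
  have hann2 := hann 2 2 1 2 (Or.inl one_ne_two_fin.symm)
  have hcross : diagonal (fun v => G.rel e a b x v * G.rel e a b y v) =
      (a * a) • diagonal (G.cell x y 1 1) + (a * b) • (diagonal (G.cell x y 1 2) +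
      diagonal (G.cell x y 2 1)) + (b * b) • diagonal (G.cell x y 2 2) +
      (e * a) • (diagonal (Pi.single x 1) + diagonal (Pi.single y 1)) := by
    rw [rel_mul_rel_eq_cell hxy]
    simp only [diagonal_add, ← diagonal_smul]
    rfl
  have hscal := fun κ => h.scalar_equation hD hxy hi (x := x) (y := y) (κ := κ)
  have d12 : diagonal (G.cell x y 1 2) = diagonal (G.rel 0 1 0 x) - diagonal (G.cell x y 1 1) -
      diagonal (Pi.single y 1) := by
    rw [cell_one_two hxy, diagonal_sub, diagonal_sub]; rfl
  have d21 : diagonal (G.cell x y 2 1) = diagonal (G.rel 0 1 0 y) - diagonal (G.cell x y 1 1) -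
      diagonal (Pi.single x 1) := by
    rw [cell_two_one hxy, diagonal_sub, diagonal_sub]; rfl
  have d22 : diagonal (G.cell x y 2 2) = 1 - diagonal (G.rel 0 1 0 x) - diagonal (G.rel 0 1 0 y) +
      diagonal (G.cell x y 1 1) := by
    rw [cell_two_two hxy, ← diagonal_one]
    simp only [diagonal_add, diagonal_sub]
    rfl
  set P := G.proj₂ e a b x y with hPdef
  set c := b / (b - a) with hc
  have hc0 : c ≠ 0 := div_ne_zero hb hba
  have hc1 : 1 - c ≠ 0 := by
    rw [hc, one_sub_div hba]
    exact div_ne_zero (by simpa using ha) hba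
  set X := P * diagonal (G.cell x y 1 2) * P with hX
  have m11 : P * diagonal (G.cell x y 1 1) * P = c • P - X := by
    rw [hX, d12]
    simp only [mul_sub, sub_mul, hadj, hsy]
    abel
  have m21 : P * diagonal (G.cell x y 2 1) * P = X := by
    rw [hX, d12, d21]
    simp only [mul_sub, sub_mul, hadj, hsy, hadj', hsx]
  have m22 : P * diagonal (G.cell x y 2 2) * P = (1 - c) • P - X := by
    rw [hX, d12, d22]
    simp only [mul_sub, sub_mul, mul_add, add_mul, mul_one, hadj, hsy, hadj', hPP]
    module
  rw [m21] at hε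
  rw [m11, m22] at hδ
  rw [m11] at hann1
  rw [m22] at hann2
  have hXt : Xᵀ = X := by
    rw [hX, transpose_mul, transpose_mul, hPt, diagonal_transpose, Matrix.mul_assoc]
  have hPX : P * X = X := by rw [hX, ← Matrix.mul_assoc, ← Matrix.mul_assoc, hPP]
  have hXP : X * P = X := by rw [hX, Matrix.mul_assoc, hPP]
  rcases scalar_or_annihilates hc0 hc1 hPP hPX hXP (sq_eq_smul_of_cube hXt hε) hδ with
    ⟨θ, hθ⟩ | h0 | h0
  · left
    obtain ⟨κ, hκ⟩ : ∃ κ : ℝ, P * diagonal (fun v => G.rel e a b x v * G.rel e a b y v) * P =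
        κ • P := by
      refine ⟨a * a * (c - θ) + a * b * (θ + θ) + b * b * (1 - c - θ), ?_⟩
      rw [hcross]
      simp only [mul_add, add_mul, Matrix.mul_smul, Matrix.smul_mul, m11, m21, m22, ← hX, hsx, hsy, hθ]
      module
    refine extremal_of_scalar (κ := κ) h.ne hD hi fun u w l m hl hm huw => ?_
    obtain ⟨z, hz1, hz2⟩ : ∃ z, G.rel e a b x z = u ∧ G.rel e a b y z = w := by
      rcases huw with ⟨rfl, rfl⟩ | ⟨rfl, rfl⟩ | ⟨rfl, rfl⟩
      · obtain ⟨z, z1, z2⟩ := h2.exists_triangle ht hxy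
        exact ⟨z, rel_adj _ _ _ z1, rel_adj _ _ _ z2⟩
      · obtain ⟨z, z1, z2⟩ := hp.exists_sep h2 hxy.ne
        exact ⟨z, rel_adj _ _ _ z1, rel_nonadj _ _ _ z2⟩
      · obtain ⟨z, z1, z2⟩ := hp.exists_noncommon h2 hxy
        exact ⟨z, rel_nonadj _ _ _ z1, rel_nonadj _ _ _ z2⟩
    rw [← hz1, ← hz2] at hl hm
    have := hscal _ hκ z hl hm
    rwa [hz1, hz2] at this
  · right
    obtain ⟨i, hi⟩ := hann1 h0
    by_cases h1 : i = 1
    · refine absurd (triFree_of_adj_always h2 hp fun x y z w e1 e2 e3 e4 e5 => ?_) ht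
      exact typ_eq_one.1 ((hi x y z w e1 (typ_eq_one.2 e2) (typ_eq_one.2 e3) (typ_eq_one.2 e4)
        (typ_eq_two'.2 e5)).trans h1)
    · refine locCluster_of_adj_never fun x y z w e1 e2 e3 e4 e5 e6 => h1 ?_
      rw [← hi x y z w e1 (typ_eq_one.2 e2) (typ_eq_one.2 e3) (typ_eq_one.2 e4) (typ_eq_two'.2 e5)]
      exact typ_eq_one.2 e6
  · exfalso
    obtain ⟨i, hi⟩ := hann2 h0
    have key : ∀ x y z w, Gᶜᶜ.Adj x y → Gᶜ.Adj x z → Gᶜ.Adj y z → Gᶜ.Adj x w → Gᶜᶜ.Adj y w →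
        G.typ z w = i := by
      intro x y z w e1 e2 e3 e4 e5
      rw [compl_compl] at e1 e5
      exact hi y x z w e1.symm (typ_eq_two'.2 e3) (typ_eq_two'.2 e2) (typ_eq_one.2 e5)
        (typ_eq_two'.2 e4)
    by_cases h1 : i = 2
    · exact ht' (triFree_of_nonadj_always hp.compl h3.compl fun x y z w e1 e2 e3 e4 e5 =>
        typ_eq_two'.1 ((key x y z w e1 e2 e3 e4 e5).trans h1))
    · exact ht' (triFree_of_nonadj_never h2.compl hp.compl fun x y z w e1 e2 e3 e4 e5 e6 =>
        h1 ((key x y z w e1 e2 e3 e4 e5).symm.trans (typ_eq_two'.2 e6)))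

theorem Eig.extremal_or_lattice {k l m : ℝ} (hS : G.SR k l m) (h : G.Eig e a b)
    (hi : (e - a) * (e - b) = -(a + b)) (h4 : G.IsTupleRegular 4) (hp : G.Prim) (ht : ¬ G.TriFree)
    (ht' : ¬ Gᶜ.TriFree) :
    (a + b) * e = 2 * (a * b) ∨ LatticeParams (Fintype.card V) k l m := by
  rcases h.smith_edge hi h4 hp ht ht' with h1 | h1
  · exact Or.inl h1
  rcases h.compl.smith_edge (by linear_combination hi) h4.compl hp.compl ht' (by simpa using ht)
    with h2 | h2
  · left; linear_combination h2
  · exact Or.inr (latticeParams_of_locCluster hS hp ht ht' h1 h2)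

end SimpleGraph

namespace SimpleGraph

open Matrix

variable {V : Type*} [Fintype V] [DecidableEq V] {G : SimpleGraph V} {e a b : ℝ}

theorem sum_typ_typ_mul {x y : V} {ψ : V → ℝ} (hψ : ∀ p q, ∑ v, G.cell x y p q v * ψ v = 0)
    (g : Fin 3 → Fin 3 → ℝ) : ∑ v, g (G.typ x v) (G.typ y v) * ψ v = 0 := by
  calc _ = ∑ v, ∑ p, ∑ q, g p q * (G.cell x y p q v * ψ v) := by
        refine Finset.sum_congr rfl fun v _ => ?_
        rw [Finset.sum_eq_single (G.typ x v), Finset.sum_eq_single (G.typ y v)]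
        · simp [cell_apply]
        · intro q _ hq
          simp [cell_apply, hq.symm]
        · simp
        · intro p _ hp
          simp [cell_apply, hp.symm]
        · simp
    _ = ∑ p, ∑ q, g p q * ∑ v, G.cell x y p q v * ψ v := by
        rw [Finset.sum_comm]
        refine Finset.sum_congr rfl fun p _ => ?_
        rw [Finset.sum_comm]
        simp only [Finset.mul_sum]
    _ = 0 := by simp [hψ]

/-- Vectors off the vertices adjacent to `y` only, with zero sums over all cells, whose cell
components are annihilated by the adjacency operator into the omitted cell. -/
def latinSpace (G : SimpleGraph V) (x y : V) : Submodule ℝ (V → ℝ) where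
  carrier := {ψ | (∀ v, G.typ x v = 0 ∨ G.typ y v = 0 ∨ (G.typ x v = 2 ∧ G.typ y v = 1) → ψ v = 0) ∧
    (∀ p q, ∑ v, G.cell x y p q v * ψ v = 0) ∧
    ∀ z, G.typ x z = 2 → G.typ y z = 1 → ∀ p q, ∑ v, G.cell x y p q v * (G.rel 0 1 0 z v * ψ v) = 0}
  add_mem' := by
    rintro ψ φ ⟨h1, h2, h3⟩ ⟨k1, k2, k3⟩
    refine ⟨fun v hv => ?_, fun p q => ?_, fun z hz hz' p q => ?_⟩
    · rw [Pi.add_apply, h1 v hv, k1 v hv, add_zero]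
    · simp only [Pi.add_apply, mul_add, Finset.sum_add_distrib, h2, k2, add_zero]
    · simp only [Pi.add_apply, mul_add, Finset.sum_add_distrib, h3 z hz hz', k3 z hz hz', add_zero]
  zero_mem' := by simp
  smul_mem' := by
    rintro c ψ ⟨h1, h2, h3⟩
    refine ⟨fun v hv => ?_, fun p q => ?_, fun z hz hz' p q => ?_⟩
    · rw [Pi.smul_apply, h1 v hv, smul_zero]
    · simp only [Pi.smul_apply, smul_eq_mul, mul_left_comm _ c, ← Finset.mul_sum, h2, mul_zero]
    · simp only [Pi.smul_apply, smul_eq_mul, mul_left_comm _ c, ← Finset.mul_sum, h3 z hz hz', mul_zero]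

variable {x y : V} {ψ : V → ℝ} (hψ : ψ ∈ G.latinSpace x y)
include hψ

theorem cell_mul_mem_latinSpace (p q : Fin 3) :
    (fun v => G.cell x y p q v * ψ v) ∈ G.latinSpace x y := by
  obtain ⟨h1, h2, h3⟩ := hψ
  have key : ∀ (φ : V → ℝ), (∀ p q, ∑ v, G.cell x y p q v * φ v = 0) → ∀ p' q',
      ∑ v, G.cell x y p' q' v * (G.cell x y p q v * φ v) = 0 := fun φ hφ p' q' => by
    simp only [← mul_assoc]
    exact sum_typ_typ_mul hφ fun i j =>
      (if i = p' ∧ j = q' then 1 else 0) * (if i = p ∧ j = q then 1 else 0)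
  refine ⟨fun v hv => by simp [h1 v hv], key ψ h2, fun z hz hz' p' q' => ?_⟩
  have := key (fun v => G.rel 0 1 0 z v * ψ v) (h3 z hz hz') p' q'
  refine Eq.trans ?_ this
  exact Finset.sum_congr rfl fun v _ => by ring

theorem sum_eq_zero_of_mem_latinSpace : ∑ v, ψ v = 0 := by
  simpa using sum_typ_typ_mul hψ.2.1 fun _ _ => 1

theorem adj_mulVec_mem_latinSpace (h4 : G.IsTupleRegular 4) (hxy : G.Adj x y) :
    G.rel 0 1 0 *ᵥ ψ ∈ G.latinSpace x y := by
  obtain ⟨h1, h2, h3⟩ := hψ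
  refine ⟨?_, fun p q => ?_, fun z hz hz' p q => ?_⟩
  · rintro z (hz | hz | ⟨hz, hz'⟩)
    · obtain rfl := typ_eq_zero.1 hz
      exact sum_typ_typ_mul h2 fun i _ => sel 0 1 0 i
    · obtain rfl := typ_eq_zero.1 hz
      exact sum_typ_typ_mul h2 fun _ i => sel 0 1 0 i
    · have := sum_typ_typ_mul (h3 z hz hz') fun _ _ => 1
      simpa [Matrix.mulVec, dotProduct] using this
  · obtain ⟨f, hf⟩ := (h4.mono (by norm_num : 3 ≤ 4)).exists_typ_three le_rfl fun i j k =>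
      (if i = p ∧ j = q then 1 else 0) * sel 0 1 0 k
    refine Eq.trans ?_ (sum_typ_typ_mul h2 (f 1))
    simp only [Matrix.mulVec, dotProduct, Finset.mul_sum]
    rw [Finset.sum_comm]
    refine Finset.sum_congr rfl fun v _ => ?_
    have := hf x y v
    rw [typ_eq_one.2 hxy] at this
    rw [← this, Finset.sum_mul]
    refine Finset.sum_congr rfl fun u _ => ?_
    rw [cell_apply, rel_apply, typ_comm x u, typ_comm y u]
    ring
  · obtain ⟨f, hf⟩ := h4.exists_typ_four le_rfl fun i j k l =>
      (if i = p ∧ j = q then 1 else 0) * sel 0 1 0 k * sel 0 1 0 l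
    have e1 := sum_typ_typ_mul (h3 z hz hz') fun i j => f 1 2 i 1 j 1 - f 1 2 i 1 j 2
    have e2 := sum_typ_typ_mul h2 fun i j => f 1 2 i 1 j 2
    have e3 := congrArg₂ (· + ·) e1 e2
    simp only [add_zero] at e3
    refine Eq.trans ?_ e3
    rw [← Finset.sum_add_distrib]
    simp only [Matrix.mulVec, dotProduct, Finset.mul_sum]
    rw [Finset.sum_comm]
    refine Finset.sum_congr rfl fun u _ => ?_
    calc _ = (∑ v, G.cell x y p q v * G.rel 0 1 0 z v * G.rel 0 1 0 v u) * ψ u := by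
          rw [Finset.sum_mul]
          exact Finset.sum_congr rfl fun v _ => by ring
      _ = f 1 2 (G.typ x u) 1 (G.typ y u) (G.typ z u) * ψ u := by
          have := hf x y z u
          rw [typ_eq_one.2 hxy, hz, hz'] at this
          rw [← this]
          congr 1
          refine Finset.sum_congr rfl fun v _ => ?_
          rw [cell_apply, rel_apply, rel_apply, typ_comm x v, typ_comm y v, typ_comm z v]
      _ = _ := by
          by_cases hu : ψ u = 0
          · simp [hu]
          have hzu : G.typ z u ≠ 0 := fun h' => hu (by
            obtain rfl := typ_eq_zero.1 h'
            exact h1 _ (Or.inr (Or.inr ⟨hz, hz'⟩)))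
          rw [rel_apply]
          rcases (fin_three_cases (G.typ z u)).resolve_left hzu with t | t <;> rw [t] <;> simp <;> ring

theorem rel_mulVec_mem_latinSpace (h4 : G.IsTupleRegular 4) (hxy : G.Adj x y) (e a b : ℝ) :
    G.rel e a b *ᵥ ψ ∈ G.latinSpace x y := by
  have h1 : G.rel 1 1 1 *ᵥ ψ = 0 := by
    ext z
    simpa [Matrix.mulVec, dotProduct, rel_const] using sum_eq_zero_of_mem_latinSpace hψ
  rw [rel_eq, add_mulVec, add_mulVec, smul_mulVec, smul_mulVec, smul_mulVec, h1, one_mulVec,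
    smul_zero, add_zero]
  exact add_mem (Submodule.smul_mem _ _ hψ)
    (Submodule.smul_mem _ _ (adj_mulVec_mem_latinSpace hψ h4 hxy))

theorem Latin.eq_zero_of_mem (h : G.Eig e a b) (hL : G.Latin e a b) (h4 : G.IsTupleRegular 4)
    (hxy : G.Adj x y) (v : V) (hv : G.typ x v = 1) (hv' : G.typ y v = 2) : ψ v = 0 := by
  set F := G.rel (1 - 1 / Fintype.card V - e) (-(1 / Fintype.card V) - a)
    (-(1 / Fintype.card V) - b) with hF
  let L : (V → ℝ) →ₗ[ℝ] (V → ℝ) := (Matrix.mulVecLin (diagonal (G.cell x y 1 1) * G.rel e a b)) +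
    Matrix.mulVecLin (diagonal (G.cell x y 2 2) * F)
  have hLap : ∀ ψ z, L ψ z = G.cell x y 1 1 z * (G.rel e a b *ᵥ ψ) z +
      G.cell x y 2 2 z * (F *ᵥ ψ) z := fun ψ z => by
    simp only [L, LinearMap.add_apply, mulVecLin_apply, Pi.add_apply, ← mulVec_mulVec, mulVec_diagonal]
  have hLX : ∀ ψ ∈ G.latinSpace x y, L ψ ∈ G.latinSpace x y := fun ψ hψ => by
    have := add_mem (cell_mul_mem_latinSpace (rel_mulVec_mem_latinSpace hψ h4 hxy e a b) 1 1)
      (cell_mul_mem_latinSpace (rel_mulVec_mem_latinSpace hψ h4 hxy (1 - 1 / Fintype.card V - e)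
      (-(1 / Fintype.card V) - a) (-(1 / Fintype.card V) - b)) 2 2)
    convert this using 1
    ext z
    rw [hLap]
    rfl
  have hinj : Function.Injective (L.restrict hLX) := by
    rw [← LinearMap.ker_eq_bot, LinearMap.ker_eq_bot']
    rintro ⟨φ, hφ⟩ h0
    have h1 : ∀ z, G.cell x y 1 1 z * (G.rel e a b *ᵥ φ) z +
        G.cell x y 2 2 z * (F *ᵥ φ) z = 0 := fun z => by
      rw [← hLap]
      exact congrFun (congrArg Subtype.val h0) z
    have h2 := rel_mulVec_mem_latinSpace hφ h4 hxy e a b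
    have h3 : G.rel e a b *ᵥ φ = 0 := by
      refine hL.noFix y _ (by rw [mulVec_mulVec, h.idem]) fun z hz => ?_
      rw [rel_apply] at hz
      rcases fin_three_cases (G.typ y z) with t | t | t
      · exact h2.1 z (Or.inr (Or.inl t))
      · rcases fin_three_cases (G.typ x z) with t' | t' | t'
        · exact h2.1 z (Or.inl t')
        · have := h1 z
          simpa [cell_apply, t, t', one_ne_two_fin] using this
        · exact h2.1 z (Or.inr (Or.inr ⟨t', t⟩))
      · rw [t] at hz
        simp at hz
    have h5 : F *ᵥ φ = φ := by
      have e1 : F = 1 - (1 / Fintype.card V : ℝ) • G.rel 1 1 1 - G.rel e a b := by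
        rw [← rel_one_zero_zero (G := G), smul_rel, rel_sub, rel_sub, hF]
        congr 1 <;> ring
      have e2 : G.rel 1 1 1 *ᵥ φ = 0 := by
        ext z
        simpa [Matrix.mulVec, dotProduct, rel_const] using sum_eq_zero_of_mem_latinSpace hφ
      rw [e1, sub_mulVec, sub_mulVec, smul_mulVec, e2, h3, one_mulVec]
      simp
    have h6 : φ = 0 := by
      refine hL.noFix_dual x _ h5 fun z hz => ?_
      rw [rel_apply] at hz
      rcases fin_three_cases (G.typ x z) with t | t | t
      · exact hφ.1 z (Or.inl t)
      · rw [t] at hz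
        simp at hz
      · rcases fin_three_cases (G.typ y z) with t' | t' | t'
        · exact hφ.1 z (Or.inr (Or.inl t'))
        · exact hφ.1 z (Or.inr (Or.inr ⟨t, t'⟩))
        · have := h1 z
          rw [h5] at this
          simpa [cell_apply, t, t', one_ne_two_fin.symm] using this
    exact Subtype.ext h6
  obtain ⟨⟨φ, hφ⟩, hφ'⟩ := LinearMap.injective_iff_surjective.1 hinj ⟨ψ, hψ⟩
  have : L φ = ψ := congrArg Subtype.val hφ'
  rw [← this, hLap]
  simp [cell_apply, hv, hv', one_ne_two_fin, one_ne_two_fin.symm]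

end SimpleGraph

namespace SimpleGraph

open Matrix

variable {V : Type*} [Fintype V] [DecidableEq V] {G : SimpleGraph V} {e a b k l m : ℝ}

theorem mem_latinSpace_of_supported {x y : V} {φ : V → ℝ}
    (h0 : ∀ v, ¬ (G.typ x v = 1 ∧ G.typ y v = 2) → φ v = 0) (h1 : ∑ v, φ v = 0)
    (h2 : ∀ z, G.typ x z = 2 → G.typ y z = 1 → (G.rel 0 1 0 *ᵥ φ) z = 0) :
    φ ∈ G.latinSpace x y := by
  have key : ∀ (p q : Fin 3) (g : V → ℝ), ∑ v, G.cell x y p q v * (g v * φ v) =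
      (if p = 1 ∧ q = 2 then 1 else 0) * ∑ v, g v * φ v := fun p q g => by
    rw [Finset.mul_sum]
    refine Finset.sum_congr rfl fun v _ => ?_
    by_cases hv : G.typ x v = 1 ∧ G.typ y v = 2
    · rw [cell_apply, hv.1, hv.2]
      simp only [eq_comm]
    · simp [h0 v hv]
  refine ⟨fun v hv => h0 v ?_, fun p q => ?_, fun z hz hz' p q => ?_⟩
  · rintro ⟨t, t'⟩
    rw [t, t'] at hv
    simp at hv
  · have := key p q fun _ => 1
    simp only [one_mul, h1, mul_zero] at this
    exact this
  · have h3 := h2 z hz hz'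
    have h4 : ∑ v, G.rel 0 1 0 z v * φ v = 0 := h3
    rw [key p q fun v => G.rel 0 1 0 z v, h4, mul_zero]

/-- For a fixed edge, adjacency is constant on pairs of distinct vertices adjacent to its first
end only. -/
theorem Latin.exists_rel_eq (h : G.Eig e a b) (hL : G.Latin e a b) (h4 : G.IsTupleRegular 4) :
    ∃ c : ℝ, ∀ ⦃x y u w⦄, G.Adj x y → G.Adj x u → Gᶜ.Adj y u → G.Adj x w → Gᶜ.Adj y w →
      u ≠ w → G.rel 0 1 0 u w = c := by
  obtain ⟨f, hf⟩ := h4.exists_typ_four le_rfl fun i j k l =>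
      (if i = 1 ∧ j = 2 then 1 else 0) * sel 0 1 0 k * sel 0 1 0 l
  obtain ⟨g, hg⟩ := (h4.mono (by norm_num : 3 ≤ 4)).exists_typ_three le_rfl fun i j k =>
      (if i = 1 ∧ j = 2 then 1 else 0) * sel 0 1 0 k
  refine ⟨-(f 1 2 1 1 2 1 - f 1 2 1 1 2 2), fun x y u w hxy hxu hyu hxw hyw huw => ?_⟩
  set ε := f 1 2 1 1 2 1 - f 1 2 1 1 2 2 with hε
  set ψ : V → ℝ := Pi.single u 1 - Pi.single w 1 with hψ
  have hsum : ∀ r : V → ℝ, ∑ v, r v * ψ v = r u - r w := fun r => by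
    simp [hψ, mul_sub, Finset.sum_sub_distrib, Pi.single_apply]
  have hA : ∀ z, (G.rel 0 1 0 *ᵥ ψ) z = G.rel 0 1 0 z u - G.rel 0 1 0 z w := fun z => hsum _
  have tu : G.typ x u = 1 ∧ G.typ y u = 2 := ⟨typ_eq_one.2 hxu, typ_eq_two'.2 hyu⟩
  have tw : G.typ x w = 1 ∧ G.typ y w = 2 := ⟨typ_eq_one.2 hxw, typ_eq_two'.2 hyw⟩
  set φ : V → ℝ := fun z => G.cell x y 1 2 z * (G.rel 0 1 0 *ᵥ ψ) z - ε * ψ z with hφ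
  have hmem : φ ∈ G.latinSpace x y := by
    refine mem_latinSpace_of_supported (fun v hv => ?_) ?_ fun z hz hz' => ?_
    · have hvu : v ≠ u := by rintro rfl; exact hv tu
      have hvw : v ≠ w := by rintro rfl; exact hv tw
      simp [hφ, hψ, cell_apply, hv, hvu, hvw]
    · have e1 : ∀ t, G.typ x t = 1 → G.typ y t = 2 →
          ∑ z, G.cell x y 1 2 z * G.rel 0 1 0 z t = g 1 1 2 := fun t h1 h2 => by
        have := hg x y t
        rw [h1, h2, typ_eq_one.2 hxy] at this
        rw [← this]
        refine Finset.sum_congr rfl fun v _ => ?_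
        rw [cell_apply, rel_apply, typ_comm x v, typ_comm y v]
      have e2 : ∑ z, ψ z = 0 := by simpa using hsum fun _ => 1
      simp only [hφ, Finset.sum_sub_distrib, ← Finset.mul_sum, e2, hA, mul_sub, e1 u tu.1 tu.2,
        e1 w tw.1 tw.2]
      ring
    · have e1 : ∀ t, G.typ x t = 1 → G.typ y t = 2 →
          ∑ v, G.rel 0 1 0 z v * (G.cell x y 1 2 v * G.rel 0 1 0 v t) =
            ε * G.rel 0 1 0 z t + f 1 2 1 1 2 2 := fun t h1 h2 => by
        have hzt : G.typ z t ≠ 0 := fun h' => by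
          obtain rfl := typ_eq_zero.1 h'
          rw [h1] at hz
          exact one_ne_two_fin hz
        have := hf x y z t
        rw [h1, h2, typ_eq_one.2 hxy, hz, hz'] at this
        have e3 : f 1 2 1 1 2 (G.typ z t) = ε * G.rel 0 1 0 z t + f 1 2 1 1 2 2 := by
          rw [rel_apply]
          rcases (fin_three_cases (G.typ z t)).resolve_left hzt with t | t <;> rw [t] <;>
            simp [hε]
        rw [← e3, ← this]
        refine Finset.sum_congr rfl fun v _ => ?_
        rw [cell_apply, rel_apply, rel_apply, typ_comm x v, typ_comm y v, typ_comm z v]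
        ring
      have e2 : (G.rel 0 1 0 *ᵥ φ) z = ∑ v, (G.rel 0 1 0 z v * (G.cell x y 1 2 v * G.rel 0 1 0 v u) -
          G.rel 0 1 0 z v * (G.cell x y 1 2 v * G.rel 0 1 0 v w)) -
          ε * ∑ v, G.rel 0 1 0 z v * ψ v := by
        rw [Finset.mul_sum, ← Finset.sum_sub_distrib]
        refine Finset.sum_congr rfl fun v _ => ?_
        simp only [hφ, hA]
        ring
      rw [e2, Finset.sum_sub_distrib, e1 u tu.1 tu.2, e1 w tw.1 tw.2, hsum]
      ring
  have := Latin.eq_zero_of_mem hmem h hL h4 hxy u tu.1 tu.2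
  have hu : ψ u = 1 := by simp [hψ, huw]
  simp only [hφ, hA, hu, cell_apply, tu.1, tu.2, rel_self] at this
  simp at this
  linarith

/-- The vertices adjacent to just the first end of an edge form a clique. -/
def DiffClique (G : SimpleGraph V) : Prop :=
  ∀ ⦃x y u w⦄, G.Adj x y → G.Adj x u → Gᶜ.Adj y u → G.Adj x w → Gᶜ.Adj y w → u ≠ w → G.Adj u w

theorem Latin.diffClique (h : G.Eig e a b) (hL : G.Latin e a b) (h4 : G.IsTupleRegular 4)
    (hp : G.Prim) (ht : ¬ G.TriFree) : G.DiffClique := by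
  obtain ⟨c, hc⟩ := hL.exists_rel_eq h h4
  by_contra hn
  unfold DiffClique at hn
  push Not at hn
  obtain ⟨x, y, u, w, h1, h2, h3, h5, h6, h7, h8⟩ := hn
  have h9 := hc h1 h2 h3 h5 h6 h7
  rw [rel_nonadj _ _ _ (compl_of_not_adj h7 h8)] at h9
  refine ht (LocMulti.triFree (h4.mono (by norm_num)) hp ?_)
  intro x u v w hu hv hw huv hvw huw
  have := hc hv hu huv.symm hw hvw huw.ne
  rw [rel_adj _ _ _ huw, ← h9] at this
  norm_num at this

theorem Latin.compl (hL : G.Latin e a b) : Gᶜ.Latin (1 - 1 / Fintype.card V - e)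
    (-(1 / Fintype.card V) - b) (-(1 / Fintype.card V) - a) := by
  refine ⟨fun x => ?_, fun x => ?_⟩
  · simpa only [rel_compl] using hL.noFix_dual x
  · have := hL.noFix x
    simp only [rel_compl]
    convert this using 2 <;> ring

theorem DiffClique.sub_le (h1 : G.DiffClique) (h2 : Gᶜ.DiffClique) (h : G.SR k l m) {x y : V}
    (hxy : Gᶜ.Adj x y) : k - m ≤ 2 := by
  rw [h.sub_nonadj hxy, Finset.sum_boole]
  by_contra! hlt
  have hlt' : 2 < (Finset.univ.filter fun v => G.typ x v = 1 ∧ G.typ y v ≠ 1).card := by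
    exact_mod_cast hlt
  obtain ⟨u, hu, v, hv, w, hw, huv, huw, hvw⟩ := Finset.two_lt_card.1 hlt'
  have key : ∀ v, v ∈ (Finset.univ.filter fun v => G.typ x v = 1 ∧ G.typ y v ≠ 1) →
      G.Adj x v ∧ Gᶜ.Adj y v := fun v hv => by
    obtain ⟨e1, e2⟩ := (Finset.mem_filter.1 hv).2
    have e3 := typ_eq_one.1 e1
    refine ⟨e3, compl_of_not_adj ?_ fun h => e2 (typ_eq_one.2 h)⟩
    rintro rfl
    exact not_adj_of_compl hxy e3
  obtain ⟨u1, u2⟩ := key u hu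
  obtain ⟨v1, v2⟩ := key v hv
  obtain ⟨w1, w2⟩ := key w hw
  have co : ∀ {u v}, G.Adj x u → Gᶜ.Adj y u → G.Adj x v → Gᶜ.Adj y v → u ≠ v → Gᶜ.Adj u v :=
    fun u1 u2 v1 v2 huv => h2 hxy.symm u2 (by simpa using u1) v2 (by simpa using v1) huv
  exact not_adj_of_compl (co v1 v2 w1 w2 hvw)
    (h1 u1 v1 (co u1 u2 v1 v2 huv) w1 (co u1 u2 w1 w2 huw) hvw)

theorem DiffClique.latticeParams (h1 : G.DiffClique) (h2 : Gᶜ.DiffClique) (h : G.SR k l m)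
    (hp : G.Prim) (ht : ¬ G.TriFree) (ht' : ¬ Gᶜ.TriFree) :
    LatticeParams (Fintype.card V) k l m := by
  obtain ⟨x, y, z, hxy, hyz, hxz⟩ := hp.exists_path
  have a1 := h1.sub_le h2 h hxz
  have a2 := h2.sub_le (by simpa using h1) h.compl (x := x) (y := y) (by simpa using hxy)
  have a3 := h.m_lt hp
  have a4 := h.compl.m_lt hp.compl
  have a5 := h.l_pos ht
  have a6 := h.compl.l_pos ht'
  have a7 := h.param_eq x
  obtain ⟨k, l, m, rfl, rfl, rfl⟩ := h.exists_nat hp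
  generalize Fintype.card V = n at *
  suffices (n : ℤ) = 9 ∧ (k : ℤ) = 4 ∧ (l : ℤ) = 1 ∧ (m : ℤ) = 2 by
    obtain ⟨b1, b2, b3, b4⟩ := this
    exact ⟨by exact_mod_cast b1, by exact_mod_cast b2, by exact_mod_cast b3, by exact_mod_cast b4⟩
  have b1 : (k : ℤ) - m ≤ 2 := by exact_mod_cast a1
  have b2 : (n : ℤ) - 1 - k - (n - 2 * k + l) ≤ 2 := by exact_mod_cast a2
  have b3 : (m : ℤ) < k := by exact_mod_cast a3
  have b4 : (n : ℤ) - 2 * k + l < n - 1 - k := by exact_mod_cast a4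
  have b5 : (0 : ℤ) < l := by exact_mod_cast a5
  have b6 : (0 : ℤ) < n - 2 - 2 * k + m := by exact_mod_cast a6
  have b7 : (k : ℤ) * k = k + k * l + (n - 1 - k) * m := by exact_mod_cast a7
  generalize (k : ℤ) = k, (l : ℤ) = l, (m : ℤ) = m, (n : ℤ) = n at *
  obtain ⟨s, rfl⟩ : ∃ s, m = k - s := ⟨k - m, by ring⟩
  obtain ⟨r, rfl⟩ : ∃ r, l = k - 1 - r := ⟨k - 1 - l, by ring⟩
  have hs : s = 1 ∨ s = 2 := by omega
  have hr : r = 1 ∨ r = 2 := by omega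
  obtain ⟨k', rfl⟩ : ∃ k', n = k' + 1 + k := ⟨n - 1 - k, by ring⟩
  rcases hs with rfl | rfl <;> rcases hr with rfl | rfl
  · exfalso; nlinarith
  · exfalso; nlinarith
  · exfalso; nlinarith
  · have e1 : (k - 2) * (k' - 2) = 4 := by linarith
    have e2 : k = 4 := by nlinarith
    subst e2
    omega

theorem Latin.latticeParams (h : G.Eig e a b) (hL : G.Latin e a b) (h4 : G.IsTupleRegular 4)
    (hS : G.SR k l m) (hp : G.Prim) (ht : ¬ G.TriFree) (ht' : ¬ Gᶜ.TriFree) :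
    LatticeParams (Fintype.card V) k l m :=
  (hL.diffClique h h4 hp ht).latticeParams (hL.compl.diffClique h.dual.compl h4.compl hp.compl ht')
    hS hp ht ht'

end SimpleGraph

namespace SimpleGraph

open Matrix

variable {V : Type*} [Fintype V] [DecidableEq V] {G : SimpleGraph V} {e a b : ℝ}

theorem Eig.sum_sq_mul_pair (h : G.Eig e a b) (hi : (e - a) * (e - b) = -(a + b)) (z x y : V) :
    ∑ v, G.rel e a b z v * G.rel e a b z v * (G.rel e a b x v * G.rel e a b y v) =
      -(a * b) * G.rel e a b x y - (a + b) * (G.rel e a b x z * G.rel e a b y z) := by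
  have hT := h.tripleZero_of_eq hi x y z
  have h4 := sum_rel_one_zero_zero (G := G) z fun v => G.rel e a b x v * G.rel e a b y v
  calc _ = (a + b) * ∑ v, G.rel e a b x v * G.rel e a b y v * G.rel e a b z v -
        a * b * (∑ v, G.rel e a b x v * G.rel e a b y v) -
        (a + b) * ∑ v, G.rel 1 0 0 z v * (G.rel e a b x v * G.rel e a b y v) := by
        rw [Finset.mul_sum, Finset.mul_sum, Finset.mul_sum, ← Finset.sum_sub_distrib,
          ← Finset.sum_sub_distrib]
        refine Finset.sum_congr rfl fun v _ => ?_
        rw [rel_sq_mul hi]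
        ring
    _ = _ := by
        rw [hT, h.sum_mul, h4]
        ring

theorem Eig.mul_diagonal_mul_eq (h : G.Eig e a b) (hi : (e - a) * (e - b) = -(a + b))
    (hx : (a + b) * e = 2 * (a * b)) (x y : V) :
    G.rel e a b * diagonal (fun v => G.rel e a b x v * G.rel e a b y v) * G.rel e a b =
      -((a + b) / 2) • (G.rel e a b x y • G.rel e a b +
        (vecMulVec (G.rel e a b x) (G.rel e a b y) +
          vecMulVec (G.rel e a b y) (G.rel e a b x))) := by
  set E := G.rel e a b with hE
  set d := fun v => E x v * E y v with hd
  set γ := E x y with hγ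
  set B := E * diagonal d * E with hB
  set U := vecMulVec (E x) (E y) + vecMulVec (E y) (E x) with hU
  set c := -((a + b) / 2) with hc
  have hET : Eᵀ = E := rel_transpose _ _ _
  have hEE : E * E = E := h.idem
  have hBE : B * E = B := by rw [hB, Matrix.mul_assoc, hEE]
  have hEB : E * B = B := by rw [hB, ← Matrix.mul_assoc, ← Matrix.mul_assoc, hEE]
  have hEv : ∀ z, E *ᵥ E z = E z := fun z => h.mulVec_rel z
  have hvE : ∀ z, E z ᵥ* E = E z := fun z => by rw [← hET, vecMul_transpose, hET, hEv]
  have hEU : E * U = U := by rw [hU, mul_add, mul_vecMulVec, mul_vecMulVec, hEv, hEv]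
  have hUE : U * E = U := by rw [hU, add_mul, vecMulVec_mul, vecMulVec_mul, hvE, hvE]
  have hdot : ∀ z w, E z ⬝ᵥ E w = E z w := fun z w => h.sum_mul z w
  have hyx : E y x = γ := rel_comm _ _ _ _ _
  have hself : ∀ z, E z z = e := fun z => rel_self _ _ _ _
  have hsumd : ∑ v, d v = γ := h.sum_mul x y
  have hsumdd : ∑ v, d v * d v = -(a * b) * e - (a + b) * γ ^ 2 := by
    have := h.sum_sq_mul_pair hi x y y
    rw [← hE, hself, hyx] at this
    rw [sq, ← this]
    exact Finset.sum_congr rfl fun v _ => by simp only [hd]; ring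
  have htE : trace E = Fintype.card V * e := by simp [trace, hself]
  have htB : trace B = e * γ := by
    rw [hB, trace_mul_comm, ← Matrix.mul_assoc, hEE, ← hsumd, Finset.mul_sum]
    exact Finset.sum_congr rfl fun v _ => by simp [hself]
  have htU : trace U = 2 * γ := by
    rw [hU, trace_add, trace_vecMulVec, trace_vecMulVec, hdot, hdot, hyx]
    ring
  have htBv : ∀ z w, trace (B * vecMulVec (E z) (E w)) = ∑ v, d v * (E z v * E w v) := fun z w => by
    rw [mul_vecMulVec, trace_vecMulVec, hB, ← mulVec_mulVec, ← mulVec_mulVec, hEv]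
    rw [dotProduct_comm, dotProduct_mulVec, hvE]
    simp only [dotProduct, mulVec_diagonal]
    exact Finset.sum_congr rfl fun v _ => by ring
  have htBU : trace (B * U) = 2 * ∑ v, d v * d v := by
    rw [hU, mul_add, trace_add, htBv, htBv, two_mul]
    congr 1
    exact Finset.sum_congr rfl fun v _ => by simp only [hd]; ring
  have htUU : trace (U * U) = 2 * γ ^ 2 + 2 * e ^ 2 := by
    simp only [hU, mul_add, add_mul, mul_vecMulVec, vecMulVec_mulVec, trace_add, trace_vecMulVec,
      hdot, hyx, hself, op_smul_eq_smul, smul_dotProduct, smul_eq_mul]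
    ring
  have htBB : trace (B * B) = -(a * b) * γ ^ 2 - (a + b) * ∑ v, d v * d v := by
    have e1 : trace (B * B) = trace (diagonal d * E * (diagonal d * E)) := by
      rw [hB, show E * diagonal d * E * (E * diagonal d * E) =
        E * (diagonal d * (E * E) * diagonal d * E) by simp only [Matrix.mul_assoc], trace_mul_comm,
        hEE, show diagonal d * E * diagonal d * E * E = diagonal d * E * diagonal d * (E * E) by
        simp only [Matrix.mul_assoc], hEE]
      simp only [Matrix.mul_assoc]
    rw [e1]
    have e2 : ∀ z, ∑ w, E z w * E z w * d w = -(a * b) * γ - (a + b) * d z := fun z => by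
      have := h.sum_sq_mul_pair hi z x y
      exact this
    calc _ = ∑ z, d z * ∑ w, E z w * E z w * d w := by
          refine Finset.sum_congr rfl fun z _ => ?_
          rw [diag_apply, Matrix.mul_apply, Finset.mul_sum]
          refine Finset.sum_congr rfl fun w _ => ?_
          rw [diagonal_mul, diagonal_mul, show E w z = E z w from rel_comm _ _ _ _ _]
          ring
      _ = ∑ z, (-(a * b) * γ * d z - (a + b) * (d z * d z)) :=
          Finset.sum_congr rfl fun z _ => by rw [e2]; ring
      _ = _ := by
          rw [Finset.sum_sub_distrib, ← Finset.mul_sum, ← Finset.mul_sum, hsumd]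
          ring
  have hBT : Bᵀ = B := by
    rw [hB, transpose_mul, transpose_mul, diagonal_transpose, hET, Matrix.mul_assoc]
  have hUT : Uᵀ = U := by
    rw [hU, transpose_add, transpose_vecMulVec, transpose_vecMulVec, add_comm]
  have hsq : (B - c • (γ • E + U)) * (B - c • (γ • E + U)) =
      B * B - (2 * c * γ) • B - c • (B * U) - c • (U * B) + (c ^ 2 * γ ^ 2) • E +
        (2 * c ^ 2 * γ) • U + c ^ 2 • (U * U) := by
    simp only [sub_mul, mul_sub, mul_add, add_mul, Matrix.smul_mul, Matrix.mul_smul, hBE, hEB, hEU,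
      hUE, hEE]
    module
  refine sub_eq_zero.1 (eq_zero_of_trace_sq ?_ ?_)
  · rw [transpose_sub, transpose_smul, transpose_add, transpose_smul, hBT, hUT, hET]
  · rw [hsq]
    simp only [trace_add, trace_sub, trace_smul, smul_eq_mul, trace_mul_comm U B, htBB, htB, htBU,
      htE, htU, htUU, hsumdd]
    have hn := h.card_mul hi x
    simp only [hc]
    linear_combination (γ ^ 2 / 2 * (a + b) / 2 * (Fintype.card V) - γ ^ 2 / 2 +
      ((a + b) * e / 2 + γ ^ 2)) * hx + γ ^ 2 / 2 * (a + b) * hn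

theorem Eig.sum_four (h : G.Eig e a b) (hi : (e - a) * (e - b) = -(a + b))
    (hx : (a + b) * e = 2 * (a * b)) (x y z w : V) :
    ∑ v, G.rel e a b x v * G.rel e a b y v * G.rel e a b z v * G.rel e a b w v =
      -((a + b) / 2) * (G.rel e a b x y * G.rel e a b z w +
        (G.rel e a b x z * G.rel e a b y w + G.rel e a b y z * G.rel e a b x w)) := by
  have := congrFun (congrFun (h.mul_diagonal_mul_eq hi hx x y) z) w
  rw [mul_diagonal_mul_apply] at this
  simp only [Matrix.smul_apply, Matrix.add_apply, vecMulVec_apply, smul_eq_mul] at this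
  rw [← this]
  refine Finset.sum_congr rfl fun v _ => ?_
  rw [rel_comm e a b w v]
  ring

end SimpleGraph

namespace SimpleGraph

open Matrix

variable {V : Type*} [Fintype V] [DecidableEq V] {G H : SimpleGraph V} {e a b k l m : ℝ}

theorem Prim.rel_injective (hp : G.Prim) {e' a' b' : ℝ} (h : G.rel e a b = G.rel e' a' b') :
    e = e' ∧ a = a' ∧ b = b' := by
  obtain ⟨x, y, z, hxy, hyz, hxz⟩ := hp.exists_path
  have h1 := congrFun (congrFun h x) x
  have h2 := congrFun (congrFun h x) y
  have h3 := congrFun (congrFun h x) z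
  rw [rel_self, rel_self] at h1
  rw [rel_adj _ _ _ hxy, rel_adj _ _ _ hxy] at h2
  rw [rel_nonadj _ _ _ hxz, rel_nonadj _ _ _ hxz] at h3
  exact ⟨h1, h2, h3⟩

/-- The eigenprojections of a strongly regular graph depend only on its parameters. -/
theorem Eig.of_sr (h : H.Eig e a b) (hp : H.Prim) (hH : H.SR k l m) (hG : G.SR k l m) :
    G.Eig e a b := by
  refine ⟨?_, fun x => ?_, h.ne⟩
  · obtain ⟨h1, h2, h3⟩ := hp.rel_injective ((hH.mul_rel e a b e a b).symm.trans h.idem)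
    rw [hG.mul_rel, h1, h2, h3]
  · rw [hG.reg.sum_rel, ← h.row x, hH.reg.sum_rel]

theorem SR.exists_eig (h : G.SR k l m) (hp : G.Prim) : ∃ e a b, G.Eig e a b := by
  obtain ⟨x, -⟩ := hp.exists_path
  have hn : (Fintype.card V : ℝ) ≠ 0 := Nat.cast_ne_zero.2 (Fintype.card_pos_iff.2 ⟨x⟩).ne'
  have hmk := h.m_lt hp
  have hpe := h.param_eq x
  have hD : 0 < (l - m) ^ 2 + 4 * (k - m) := by nlinarith [sq_nonneg (l - m)]
  set d := √((l - m) ^ 2 + 4 * (k - m)) with hd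
  have hd0 : d ≠ 0 := (Real.sqrt_pos.2 hD).ne'
  have hdd : d ^ 2 = (l - m) ^ 2 + 4 * (k - m) := Real.sq_sqrt hD.le
  obtain ⟨τ, hτ⟩ : ∃ τ, τ = (l - m - d) / 2 := ⟨_, rfl⟩
  obtain ⟨c, hc⟩ : ∃ c, c = (k - τ) / Fintype.card V := ⟨_, rfl⟩
  have hnc : Fintype.card V * c = k - τ := by rw [hc]; field_simp
  have hdτ : d = l - m - 2 * τ := by rw [hτ]; ring
  have hτ2 : τ ^ 2 = (l - m) * τ + (k - m) := by
    rw [hdτ] at hdd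
    linarith
  have hcm : m = c * (k - (l - m - τ)) := by
    have : Fintype.card V * m = Fintype.card V * (c * (k - (l - m - τ))) := by
      rw [← mul_assoc, hnc]
      linear_combination hτ2 - hpe
    exact mul_left_cancel₀ hn this
  have hscale : ∀ e a b : ℝ, G.rel (e / d) (a / d) (b / d) = d⁻¹ • G.rel e a b := fun e a b => by
    rw [smul_rel]
    congr 1 <;> ring
  refine ⟨(-τ - c) / d, (1 - c) / d, (-c) / d, ?_, fun x => ?_, fun h' => ?_⟩
  · have key : G.rel (-τ - c) (1 - c) (-c) * G.rel (-τ - c) (1 - c) (-c) =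
        d • G.rel (-τ - c) (1 - c) (-c) := by
      rw [h.mul_rel, smul_rel, hdτ]
      congr 1
      · linear_combination -hτ2 + c * hnc + hcm
      · linear_combination c * hnc + hcm
      · linear_combination c * hnc + hcm
    rw [hscale, Matrix.smul_mul, Matrix.mul_smul, key, smul_smul, smul_smul]
    congr 1
    field_simp
  · rw [h.reg.sum_rel]
    have : (-τ - c) + k * (1 - c) + (Fintype.card V - 1 - k) * (-c) = 0 := by
      linear_combination -hnc
    rw [mul_div_assoc', mul_div_assoc', ← add_div, ← add_div, this, zero_div]
  · have : (1 - c) = -c := by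
      field_simp at h'
      exact h'
    linarith

/-- Extremal strongly regular graphs in the sense of Smith are `4`-tuple regular. -/
theorem Eig.isTupleRegular_four (h : G.Eig e a b) (hi : (e - a) * (e - b) = -(a + b))
    (hx : (a + b) * e = 2 * (a * b)) : G.IsTupleRegular 4 := by
  have h4 : ∀ s ≤ 4, ∀ x y : Fin s → V, (∀ i j, G.typ (x i) (x j) = G.typ (y i) (y j)) →
      ∑ v, ∏ i, G.rel e a b (x i) v = ∑ v, ∏ i, G.rel e a b (y i) v := by
    intro s hs x y hxy
    have hE : ∀ i j, G.rel e a b (x i) (x j) = G.rel e a b (y i) (y j) := fun i j => by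
      rw [rel_apply, rel_apply, hxy]
    interval_cases s
    · simp
    · simp [h.row]
    · simp only [Fin.prod_univ_two, h.sum_mul, hE]
    · simp only [Fin.prod_univ_three, h.tripleZero_of_eq hi _ _ _]
    · simp only [Fin.prod_univ_four, h.sum_four hi hx, hE]
  have hS : ∀ s ≤ 4, ∀ x y : Fin s → V, (∀ i j, G.typ (x i) (x j) = G.typ (y i) (y j)) →
      ∀ S : Finset (Fin s), ∑ v, ∏ i ∈ S, G.rel e a b (x i) v =
        ∑ v, ∏ i ∈ S, G.rel e a b (y i) v := by
    intro s hs x y hxy S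
    have := h4 S.card ((Finset.card_le_univ S).trans (by simpa using hs))
      (fun j => x (S.equivFin.symm j)) (fun j => y (S.equivFin.symm j)) fun i j => hxy _ _
    have key : ∀ (x : Fin s → V) v, ∏ j, G.rel e a b (x (S.equivFin.symm j)) v =
        ∏ i ∈ S, G.rel e a b (x i) v := fun x v => by
      rw [Equiv.prod_comp S.equivFin.symm fun j : S => G.rel e a b (x j) v,
        Finset.prod_coe_sort S fun j => G.rel e a b (x j) v]
    simpa only [key] using this
  have hab : a - b ≠ 0 := sub_ne_zero.2 h.ne
  refine isTupleRegular_of_sum fun s hs x y hx' hxy => ?_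
  have hy' : y.Injective := fun i j hij => hx' (typ_eq_zero.1 (by rw [hxy, hij, typ_self]))
  rcases Nat.eq_zero_or_pos s with rfl | hs0
  · simp
  have key : ∀ x : Fin s → V, x.Injective →
      (a - b) ^ s * ∑ v, ∏ i, sel 0 1 0 (G.typ v (x i)) =
      (∑ S : Finset (Fin s), (∑ v, ∏ i ∈ S, G.rel e a b (x i) v) * (-b) ^ (s - S.card)) -
        ∑ j, ∏ i, (G.rel e a b (x i) (x j) + (-b)) := by
    intro x hx
    have e1 : ∀ v, ∏ i, (G.rel e a b (x i) v + (-b)) =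
        ∑ S : Finset (Fin s), (∏ i ∈ S, G.rel e a b (x i) v) * (-b) ^ (s - S.card) := fun v => by
      rw [Finset.prod_add]
      rw [Finset.powerset_univ]
      refine Finset.sum_congr rfl fun S _ => ?_
      rw [Finset.prod_const, Finset.card_sdiff_of_subset (Finset.subset_univ S)]
      simp
    have e2 : ∑ S : Finset (Fin s), (∑ v, ∏ i ∈ S, G.rel e a b (x i) v) * (-b) ^ (s - S.card) =
        ∑ v, ∏ i, (G.rel e a b (x i) v + (-b)) := by
      simp only [e1, Finset.sum_mul]
      rw [Finset.sum_comm]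
    have e3 : ∑ j, ∏ i, (G.rel e a b (x i) (x j) + (-b)) =
        ∑ v, if v ∈ Finset.univ.image x then ∏ i, (G.rel e a b (x i) v + (-b)) else 0 := by
      rw [← Finset.sum_filter]
      simp only [Finset.filter_mem_eq_inter, Finset.univ_inter]
      rw [Finset.sum_image fun _ _ _ _ h => hx h]
    rw [e2, e3, ← Finset.sum_sub_distrib, Finset.mul_sum]
    refine Finset.sum_congr rfl fun v _ => ?_
    split_ifs with hv
    · obtain ⟨j, -, rfl⟩ := Finset.mem_image.1 hv
      rw [sub_self, Finset.prod_eq_zero (Finset.mem_univ j) (by rw [typ_self]; simp), mul_zero]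
    · rw [sub_zero]
      have : (a - b) ^ s = ∏ i : Fin s, (a - b) := by simp
      rw [this, ← Finset.prod_mul_distrib]
      refine Finset.prod_congr rfl fun i _ => ?_
      have hvi : G.typ v (x i) ≠ 0 := fun h' =>
        hv (Finset.mem_image.2 ⟨i, Finset.mem_univ _, (typ_eq_zero.1 h').symm⟩)
      rw [rel_comm, rel_apply]
      rcases (fin_three_cases (G.typ v (x i))).resolve_left hvi with t | t <;> rw [t] <;>
        simp [sub_eq_add_neg]
  have e1 := key x hx'
  have e2 := key y hy'
  have e3 : ∀ i j, G.rel e a b (x i) (x j) = G.rel e a b (y i) (y j) := fun i j => by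
    rw [rel_apply, rel_apply, hxy]
  simp only [hS s hs x y hxy, e3] at e1
  exact mul_left_cancel₀ (pow_ne_zero s hab) (e1.trans e2.symm)

end SimpleGraph

namespace SimpleGraph

open Matrix

variable {V : Type*} [Fintype V] [DecidableEq V] {G : SimpleGraph V} {e a b k l m : ℝ}

theorem Eig.adj_mul (h : G.Eig e a b) :
    G.rel 0 1 0 * G.rel e a b = ((1 - e + b) / (a - b)) • G.rel e a b := by
  have hab := sub_ne_zero.2 h.ne
  have e1 : G.rel 0 1 0 = (a - b)⁻¹ • (G.rel e a b - (e - b) • (1 : Matrix V V ℝ) - G.rel b b b) := by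
    rw [← rel_one_zero_zero (G := G), smul_rel, rel_sub, rel_sub, smul_rel]
    congr 1
    · ring
    · field_simp
      ring
    · ring
  rw [e1, Matrix.smul_mul, sub_mul, sub_mul, h.idem, Matrix.smul_mul, one_mul, h.const_mul_rel]
  rw [div_eq_inv_mul, mul_smul]
  congr 1
  module

theorem Eig.valency_mul (h : G.Eig e a b) (hS : G.SR k l m) (hp : G.Prim) :
    k * a = (1 - e + b) / (a - b) * e ∧
      m * a + (k - m) * b = (1 - e + b) / (a - b) * b := by
  have h1 := h.adj_mul
  rw [hS.mul_rel, smul_rel] at h1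
  obtain ⟨h2, -, h3⟩ := hp.rel_injective h1
  exact ⟨by linarith, by linarith⟩

theorem Eig.valency_eq (h : G.Eig e a b) (hx : (a + b) * e = 2 * (a * b)) (hS : G.SR k l m)
    (hp : G.Prim) : k = 2 * m := by
  obtain ⟨h1, h2⟩ := h.valency_mul hS hp
  have h3 : e * (a - b) * (k - 2 * m) = 0 := by
    linear_combination -2 * e * h2 + 2 * b * h1 + k * hx
  exact sub_eq_zero.1 ((mul_eq_zero.1 h3).resolve_left
    (mul_ne_zero (h.ne_zero hp) (sub_ne_zero.2 h.ne)))

theorem TriFree.card_eq_five (h4 : G.IsTupleRegular 4) (hp : G.Prim) (ht : G.TriFree) :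
    (Fintype.card V : ℝ) = 5 := by
  obtain ⟨k, l, m, h⟩ := h4.exists_sr (by norm_num)
  obtain rfl := ht.valency_eq_two h4 h hp
  obtain ⟨x, y, z, hxy, hyz, hxz⟩ := hp.exists_path
  have hl : l = 0 := by
    have := h.sum_adj_adj x y
    rw [rel_adj _ _ _ hxy] at this
    rw [← this]
    exact Finset.sum_eq_zero fun v _ => ht.mul_rel_eq_zero hxy.symm v
  have h1 := h.m_pos hp
  have h2 := h.m_lt hp
  have h3 := h.param_eq x
  obtain ⟨k', l', m', -, -, rfl⟩ := h.exists_nat hp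
  have : m' = 1 := by
    have e1 : 0 < m' := by exact_mod_cast h1
    have e2 : m' < 2 := by exact_mod_cast h2
    omega
  subst this
  rw [hl] at h3
  norm_num at h3
  linarith

section Local

variable (x : V) [Fintype {v // G.Adj x v}]

theorem sum_nbhd (f : V → ℝ) : ∑ v : {v // G.Adj x v}, f v = ∑ v, G.rel 0 1 0 x v * f v := by
  classical
  rw [← Finset.sum_subtype (Finset.univ.filter fun v => G.Adj x v) (by simp) f,
    Finset.sum_filter]
  refine Finset.sum_congr rfl fun v _ => ?_
  by_cases h : G.Adj x v
  · simp [h, rel_adj]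
  · have : G.typ x v ≠ 1 := fun h' => h (typ_eq_one.1 h')
    rw [if_neg h, rel_apply]
    rcases fin_three_cases (G.typ x v) with t | t | t <;> simp_all

theorem Reg.card_nbhd (h : G.Reg k) : (Fintype.card {v // G.Adj x v} : ℝ) = k := by
  have := sum_nbhd (G := G) x fun _ => 1
  simpa [h x] using this

theorem nbhd_rel {c d : ℝ} (u w : {v // G.Adj x v}) :
    (G.nbhd x).rel ((e - c) / d) ((a - c) / d) ((b - c) / d) u w = d⁻¹ * (G.rel e a b u w - c) := by
  rw [rel_apply, rel_apply, typ_comap Subtype.val_injective]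
  rcases fin_three_cases (G.typ (u : V) w) with t | t | t <;> rw [t] <;> simp <;> ring

/-- The local graphs inherit an eigenprojection. -/
theorem Eig.nbhd (h : G.Eig e a b) (hi : (e - a) * (e - b) = -(a + b)) (hS : G.SR k l m)
    (hp : G.Prim) (hb : b ≠ 0) :
    (G.nbhd x).Eig ((e - a ^ 2 / e) / (b / (b - a))) ((a - a ^ 2 / e) / (b / (b - a)))
      ((b - a ^ 2 / e) / (b / (b - a))) := by
  have he := h.ne_zero hp
  have hab := sub_ne_zero.2 h.ne
  have hba := sub_ne_zero.2 h.ne.symm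
  have hε : b / (b - a) ≠ 0 := div_ne_zero hb hba
  obtain ⟨hk, -⟩ := h.valency_mul hS hp
  obtain ⟨θ, hθ⟩ : ∃ θ, θ = (1 - e + b) / (a - b) := ⟨_, rfl⟩
  have hθ' : θ * (a - b) = 1 - e + b := by rw [hθ]; field_simp
  obtain ⟨c, hc⟩ : ∃ c, c = a ^ 2 / e := ⟨_, rfl⟩
  have hc' : c * e = a ^ 2 := by rw [hc]; field_simp
  obtain ⟨ε, hε'⟩ : ∃ ε, ε = b / (b - a) := ⟨_, rfl⟩
  have hε'' : ε * (b - a) = b := by rw [hε']; field_simp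
  rw [← hθ] at hk
  rw [← hc, ← hε']
  rw [← hε'] at hε
  have hkc : k * c = θ * a := by
    refine mul_right_cancel₀ he ?_
    linear_combination k * hc' + a * hk
  have s0 : ∑ v, G.rel 0 1 0 x v = k := hS.reg x
  have s1 : ∀ z : {v // G.Adj x v}, ∑ v, G.rel 0 1 0 x v * G.rel e a b z v = θ * a := fun z => by
    have := congrFun (congrFun h.adj_mul x) (z : V)
    rw [Matrix.mul_apply, Matrix.smul_apply, ← hθ, rel_adj _ _ _ z.2] at this
    rw [← smul_eq_mul, ← this]
    exact Finset.sum_congr rfl fun v _ => by rw [rel_comm e a b _ v]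
  have s2 : ∀ z w : {v // G.Adj x v}, ∑ v, G.rel 0 1 0 x v * (G.rel e a b z v * G.rel e a b w v) =
      (a - b)⁻¹ * (-(e - b) * a ^ 2 - b * G.rel e a b z w) := fun z w => by
    have hT := h.tripleZero_of_eq hi x z w
    have h4 := sum_rel_one_zero_zero (G := G) x fun v => G.rel e a b z v * G.rel e a b w v
    have e1 : ∀ v, G.rel 0 1 0 x v =
        (a - b)⁻¹ * (G.rel e a b x v - (e - b) * G.rel 1 0 0 x v - b) := fun v => by
      simp only [rel_apply]
      rcases fin_three_cases (G.typ x v) with t | t | t <;> rw [t] <;> simp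
      field_simp
    calc _ = (a - b)⁻¹ * ((∑ v, G.rel e a b x v * G.rel e a b z v * G.rel e a b w v) -
          (e - b) * (∑ v, G.rel 1 0 0 x v * (G.rel e a b z v * G.rel e a b w v)) -
          b * ∑ v, G.rel e a b z v * G.rel e a b w v) := by
          rw [Finset.mul_sum, Finset.mul_sum, ← Finset.sum_sub_distrib, ← Finset.sum_sub_distrib,
            Finset.mul_sum]
          refine Finset.sum_congr rfl fun v _ => ?_
          rw [e1]
          ring
      _ = _ := by
          rw [hT, h4, h.sum_mul, rel_comm e a b (z : V) x, rel_comm e a b (w : V) x, rel_adj _ _ _ z.2,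
            rel_adj _ _ _ w.2]
          ring
  refine ⟨?_, fun z => ?_, fun h' => h.ne ?_⟩
  · ext z w
    rw [Matrix.mul_apply, nbhd_rel]
    have e1 : ∀ v : {v // G.Adj x v}, (G.nbhd x).rel ((e - c) / ε) ((a - c) / ε) ((b - c) / ε) z v *
        (G.nbhd x).rel ((e - c) / ε) ((a - c) / ε) ((b - c) / ε) v w =
        ε⁻¹ * ε⁻¹ * ((G.rel e a b z v - c) * (G.rel e a b w v - c)) := fun v => by
      rw [nbhd_rel, nbhd_rel, rel_comm e a b (v : V) (w : V)]
      ring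
    simp only [e1, ← Finset.mul_sum]
    rw [sum_nbhd x fun v => (G.rel e a b z v - c) * (G.rel e a b w v - c)]
    have e2 : ∑ v, G.rel 0 1 0 x v * ((G.rel e a b z v - c) * (G.rel e a b w v - c)) =
        (∑ v, G.rel 0 1 0 x v * (G.rel e a b z v * G.rel e a b w v)) -
        c * (∑ v, G.rel 0 1 0 x v * G.rel e a b z v) - c * (∑ v, G.rel 0 1 0 x v * G.rel e a b w v) +
        c ^ 2 * ∑ v, G.rel 0 1 0 x v := by
      simp only [Finset.mul_sum, ← Finset.sum_sub_distrib, ← Finset.sum_add_distrib]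
      exact Finset.sum_congr rfl fun v _ => by ring
    rw [e2, s0, s1, s1, s2]
    have e3 : (a - b)⁻¹ * (-(e - b) * a ^ 2 - b * G.rel e a b z w) - c * (θ * a) - c * (θ * a) +
        c ^ 2 * k = ε * (G.rel e a b z w - c) := by
      have : (-(e - b) * a ^ 2 - b * G.rel e a b z w) - c * (θ * a) * (a - b) =
          ε * (a - b) * (G.rel e a b z w - c) := by
        refine mul_right_cancel₀ he ?_
        linear_combination -θ * a * (a - b) * hc' - a ^ 3 * hθ' - a ^ 2 * hi +
          (G.rel e a b z w - c) * e * hε'' - b * hc'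
      rw [show c ^ 2 * k = c * (θ * a) by rw [← hkc]; ring]
      refine mul_right_cancel₀ hab ?_
      rw [← mul_right_comm, ← this]
      field_simp
      ring
    rw [e3]
    field_simp
  · simp only [nbhd_rel, ← Finset.mul_sum]
    rw [sum_nbhd x fun v => G.rel e a b z v - c]
    simp only [mul_sub, Finset.sum_sub_distrib, ← Finset.sum_mul, s0, s1, hkc]
    ring
  · field_simp at h'
    linarith

end Local

end SimpleGraph

namespace SimpleGraph

variable {V : Type*} [Fintype V] [DecidableEq V] {G : SimpleGraph V} {e a b k l m : ℝ}

theorem LocMulti.of_nbhd (h3 : G.IsTupleRegular 3) {x u v : V} (hu : G.Adj x u)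
    (hv : G.Adj x v) (huv : G.Adj u v) (hc : (G.nbhd x)ᶜ.Cluster) :
    G.LocMulti := by
  intro y p q r hp hq hr hpq hqr hpr
  obtain ⟨d, hd1, hd2, hd3⟩ := h3.transfer_three (x := y) (y := p) (z := r) (x' := x) (y' := u)
    (z' := v) ((typ_eq_one.2 hp).trans (typ_eq_one.2 hu).symm)
    ((typ_eq_one.2 hr).trans (typ_eq_one.2 hv).symm)
    ((typ_eq_one.2 hpr).trans (typ_eq_one.2 huv).symm)
    ⟨q, typ_eq_one.2 hq.symm, typ_eq_two'.2 hpq.symm, typ_eq_two'.2 hqr⟩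
  rw [typ_eq_one] at hd1
  rw [typ_eq_two'] at hd2 hd3
  have key : ∀ s t : {v // G.Adj x v}, Gᶜ.Adj s t → (G.nbhd x)ᶜ.Adj s t := fun s t h =>
    compl_of_not_adj (fun h' => h.ne (congrArg Subtype.val h')) fun h' => not_adj_of_compl h h'
  have := hc (key ⟨u, hu⟩ ⟨d, hd1.symm⟩ hd2.symm) (key ⟨d, hd1.symm⟩ ⟨v, hv⟩ hd3)
    fun h' => huv.ne (congrArg Subtype.val h')
  exact not_adj_of_compl this huv

theorem Eig.locCluster_of_extremal (h : G.Eig e a b) (hi : (e - a) * (e - b) = -(a + b))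
    (hx : (a + b) * e = 2 * (a * b)) (h5 : G.IsTupleRegular 5) (hS : G.SR k l m) (hp : G.Prim)
    (ht : ¬ G.TriFree) : G.LocCluster := by
  classical
  by_contra hl
  unfold LocCluster at hl
  push Not at hl
  obtain ⟨x, u, v, w, hu, hv, hw, huv, hvw, huw, hnuw⟩ := hl
  have he := h.ne_zero hp
  have hab := h.ne
  have hb : b ≠ 0 := fun hb => by
    subst hb
    exact hab ((mul_eq_zero.1 (show a * e = 0 by linear_combination hx)).resolve_right he)
  have ha : a ≠ 0 := fun ha => by
    subst ha
    exact hb ((mul_eq_zero.1 (show b * e = 0 by linear_combination hx)).resolve_right he)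
  have h4 := IsTupleRegular.nbhd h5 x
  have hH := h.nbhd x hi hS hp hb
  have hprim : (G.nbhd x).Prim := by
    refine ⟨fun hc => hnuw ?_, fun hc => ht (LocMulti.triFree (h5.mono (by norm_num)) hp
      (.of_nbhd (h5.mono (by norm_num)) hu hv huv hc))⟩
    exact hc (x := ⟨u, hu⟩) (y := ⟨v, hv⟩) (z := ⟨w, hw⟩) huv hvw
      fun h' => huw (congrArg Subtype.val h')
  have hk := h.valency_eq hx hS hp
  have hcard := Reg.card_nbhd x hS.reg
  obtain ⟨-, -, m', -, -, hm⟩ := hS.exists_nat hp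
  have hcard' : Fintype.card {v // G.Adj x v} = 2 * m' := by
    have : (Fintype.card {v // G.Adj x v} : ℝ) = (2 * m' : ℕ) := by
      rw [hcard, hk, hm]
      push_cast
      ring
    exact_mod_cast this
  by_cases h1 : (G.nbhd x).TriFree
  · have := TriFree.card_eq_five h4 hprim h1
    have : Fintype.card {v // G.Adj x v} = 5 := by exact_mod_cast this
    omega
  by_cases h2 : (G.nbhd x)ᶜ.TriFree
  · have := TriFree.card_eq_five h4.compl hprim.compl h2
    have : Fintype.card {v // G.Adj x v} = 5 := by exact_mod_cast this
    omega
  obtain ⟨k₁, l₁, m₁, hS₁⟩ := h4.exists_sr (by norm_num)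
  have hba := sub_ne_zero.2 hab.symm
  have hi' : ((e - a ^ 2 / e) / (b / (b - a)) - (a - a ^ 2 / e) / (b / (b - a))) *
      ((e - a ^ 2 / e) / (b / (b - a)) - (b - a ^ 2 / e) / (b / (b - a))) =
      -((a - a ^ 2 / e) / (b / (b - a)) + (b - a ^ 2 / e) / (b / (b - a))) := by
    have e1 : ∀ p q : ℝ, (p - a ^ 2 / e) / (b / (b - a)) - (q - a ^ 2 / e) / (b / (b - a)) =
        (p - q) * ((b - a) / b) := fun p q => by
      field_simp
      ring
    have e2 : (a - a ^ 2 / e) / (b / (b - a)) + (b - a ^ 2 / e) / (b / (b - a)) =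
        (a + b) * ((b - a) / b) ^ 2 := by
      field_simp
      linear_combination a * hx
    rw [e1, e1, e2]
    linear_combination ((b - a) / b) ^ 2 * hi
  rcases hH.extremal_or_lattice hS₁ hi' h4 hprim h1 h2 with h3 | h3
  · have h6 : e * a ^ 2 * (a + b - 2 * e) = 0 := by
      have e1 : ∀ p q : ℝ, (p - a ^ 2 / e) / (b / (b - a)) * ((q - a ^ 2 / e) / (b / (b - a))) =
          (p * e - a ^ 2) * (q * e - a ^ 2) * ((b - a) / (b * e)) ^ 2 := fun p q => by
        field_simp
      rw [add_mul, e1, e1, e1] at h3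
      refine mul_right_cancel₀ (pow_ne_zero 2 (div_ne_zero hba (mul_ne_zero hb he))) ?_
      linear_combination h3 - e ^ 2 * ((b - a) / (b * e)) ^ 2 * hx
    have h7 := (mul_eq_zero.1 h6).resolve_left (mul_ne_zero he (pow_ne_zero 2 ha))
    have h8 : (a - b) ^ 2 = 0 := by
      linear_combination (a + b) * h7 + 2 * hx
    exact hab (sub_eq_zero.1 (pow_eq_zero_iff two_ne_zero |>.1 h8))
  · have := h3.1
    have : Fintype.card {v // G.Adj x v} = 9 := by exact_mod_cast this
    omega

end SimpleGraph

namespace SimpleGraph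

section Transfer

variable {V : Type*} [Fintype V] [DecidableEq V] {G H : SimpleGraph V} {k l m : ℝ} {t : ℕ}

theorem Cluster.sr_zero (hc : H.Cluster) (h : H.SR k l m) : H.SR k l 0 := by
  refine Eq.trans h ?_
  ext x y
  rcases H.typ_cases x y with ⟨-, hxy⟩ | ⟨-, hxy⟩ | ⟨h2, -⟩
  · rw [rel_apply, rel_apply, hxy, sel_zero, sel_zero]
  · rw [rel_apply, rel_apply, hxy, sel_one, sel_one]
  · by_contra hne
    rw [rel_nonadj _ _ _ h2, rel_nonadj _ _ _ h2] at hne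
    obtain ⟨u, hu, hu'⟩ := h.exists_common_nbr (v := x) (w := y) (by rwa [rel_nonadj _ _ _ h2])
    exact not_adj_of_compl h2 (hc hu hu'.symm h2.ne)

theorem SR.cluster (h : G.SR k l 0) : G.Cluster := fun _ _ _ hxy hyz hxz => by
  by_contra hn
  exact (mul_rel_pos hxy hyz.symm).ne' (h.apply_nonadj (compl_of_not_adj hxz hn))

theorem Cluster.transfer (hc : H.Cluster) (hH : H.SR k l m) (hG : H.SR k l 0 → G.SR k l 0) (t : ℕ) :
    G.IsTupleRegular t :=
  (hG (hc.sr_zero hH)).cluster.isTupleRegular (hG (hc.sr_zero hH)).reg t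

theorem LatticeParams.isTupleRegular (hL : LatticeParams (Fintype.card V) k l m) (h : G.SR k l m)
    (t : ℕ) : G.IsTupleRegular t := by
  obtain ⟨hn, rfl, rfl, rfl⟩ := hL
  exact h.lattice_isTupleRegular (by exact_mod_cast hn) t

theorem IsTupleRegular.of_cospec_of_prim (h : H.IsTupleRegular t) (ht : 4 ≤ t) (hp : H.Prim)
    (hH : H.SR k l m) (hG : G.SR k l m) : G.IsTupleRegular t := by
  have h4 := h.mono ht
  by_cases h1 : H.TriFree
  · obtain rfl := h1.valency_eq_two h4 hH hp
    exact hG.isTupleRegular_of_valency_two t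
  by_cases h2 : Hᶜ.TriFree
  · have hk := h2.valency_eq_two h4.compl hH.compl hp.compl
    have := hG.compl
    rw [hk] at this
    exact isTupleRegular_compl_iff.1 (this.isTupleRegular_of_valency_two t)
  obtain ⟨e, a, b, he⟩ := hH.exists_eig hp
  rcases he.smith_eq_or_latin (h4.mono (by norm_num)) hp with ⟨e, a, b, he, hi⟩ | ⟨e, a, b, he, hL⟩
  · rcases he.extremal_or_lattice hH hi h4 hp h1 h2 with hx | hL
    · rcases ht.eq_or_lt with rfl | ht5
      · exact (he.of_sr hp hH hG).isTupleRegular_four hi hx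
      · have h5 := h.mono (show 5 ≤ t from ht5)
        refine LatticeParams.isTupleRegular (latticeParams_of_locCluster hH hp h1 h2 ?_ ?_) hG t
        · exact he.locCluster_of_extremal hi hx h5 hH hp h1
        · exact he.compl.locCluster_of_extremal (by linear_combination hi)
            (by linear_combination hx) h5.compl hH.compl hp.compl h2
    · exact hL.isTupleRegular hG t
  · exact (Latin.latticeParams he hL h4 hH hp h1 h2).isTupleRegular hG t

theorem IsTupleRegular.of_cospec (h : H.IsTupleRegular t) (hc : Cospec G H) (ht : 0 < t)
    (ht3 : t ≠ 3) : G.IsTupleRegular t := by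
  rcases (show t = 1 ∨ t = 2 ∨ 4 ≤ t by omega) with rfl | rfl | ht4
  · obtain ⟨k, hk⟩ := h.exists_reg le_rfl
    exact (hk.of_cospec hc).isTupleRegular
  · obtain ⟨k, l, m, hS⟩ := h.exists_sr le_rfl
    exact (hS.of_cospec hc).isTupleRegular
  obtain ⟨k, l, m, hS⟩ := h.exists_sr (by omega)
  by_cases h1 : H.Cluster
  · exact h1.transfer hS (fun h => h.of_cospec hc) t
  by_cases h2 : Hᶜ.Cluster
  · refine isTupleRegular_compl_iff.1 (h2.transfer hS.compl (fun h' => ?_) t)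
    have h3 := h'.compl
    rw [compl_compl] at h3
    have h4 := (h3.of_cospec hc).compl
    convert h4 using 1 <;> ring
  exact h.of_cospec_of_prim ht4 ⟨h1, h2⟩ hS (hS.of_cospec hc)

end Transfer

end SimpleGraph

/-- For `t ≠ 3`, `t`-tuple regularity is determined by the spectrum: if two finite
graphs have cospectral adjacency matrices and one is `t`-tuple regular, so is the other. -/
theorem tupleRegular_determined_by_spectrum {t : ℕ} (ht : 0 < t) (ht3 : t ≠ 3)
    {V W : Type} [Fintype V] [DecidableEq V] [Fintype W] [DecidableEq W]
    (Γ : SimpleGraph V) (Δ : SimpleGraph W)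
    [DecidableRel Γ.Adj] [DecidableRel Δ.Adj]
    (hspec : (Γ.adjMatrix ℤ).charpoly = (Δ.adjMatrix ℤ).charpoly)
    (hΔ : Δ.IsTupleRegular t) : Γ.IsTupleRegular t := by
  have hcard : Fintype.card V = Fintype.card W := by
    rw [← Matrix.charpoly_natDegree_eq_dim (Γ.adjMatrix ℤ), hspec,
      Matrix.charpoly_natDegree_eq_dim]
  let f := Fintype.equivOfCardEq hcard
  exact (hΔ.comap f).of_cospec (SimpleGraph.cospec_comap hspec f) ht ht3
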